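/- Let q > 1 and let χ be a primitive, odd, real Dirichlet character of conductor q (i.e. χ(-1) = -1, χ is primitive, and all values of χ are real). Define ξ_n(s,χ) := 2^s·n^{−s}·(π/q)^{s/2}·Γ((s+1)/2)·L_n((s−1)/2, χ). Fix a real number s with 0 < s < 1 and s ≠ 1/2. Then L(s,χ) ≠ 0 if and only if the sequence n ↦ ξ_n(s,χ) / ξ_n(1−s, χ) tends to 1 as n → ∞. -/

import Mathlib

open Finset

/-- Discrete L-function for odd Dirichlet characters:
`L_n(s,χ) = ∑_{j=1}^{qn−1} χ(j)·cot(πj/(qn))·(4 sin²(πj/(qn)))^{−s}`. -/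
noncomputable def discreteLodd {q : ℕ} (χ : DirichletCharacter ℂ q) (n : ℕ) (s : ℂ) : ℂ :=
  ∑ j ∈ Finset.Ico 1 (q * n),
    χ (j : ZMod q) * (Real.cot (Real.pi * j / (q * n)) : ℂ) *
      ((4 * Real.sin (Real.pi * j / (q * n)) ^ 2 : ℝ) : ℂ) ^ (-s)

/-- The completed discrete L-function
`ξ_n(s,χ) = 2^s·n^{−s}·(π/q)^{s/2}·Γ((s+1)/2)·L_n((s−1)/2, χ)`. -/
noncomputable def xiDiscrete {q : ℕ} (χ : DirichletCharacter ℂ q) (n : ℕ) (s : ℂ) : ℂ :=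
  (2 : ℂ) ^ s * (n : ℂ) ^ (-s) * ((Real.pi / q : ℝ) : ℂ) ^ (s / 2) *
    Complex.Gamma ((s + 1) / 2) * discreteLodd χ n ((s - 1) / 2)

lemma summable_cexp_neg_mul_int_sq {δ : ℂ} (hδ : 0 < δ.re) :
    Summable fun n : ℤ => Complex.exp (-Real.pi * δ * (n : ℂ) ^ 2) := by
  have h := (summable_jacobiTheta₂_term_iff 0 (Complex.I * δ)).2 (by simpa using hδ)
  refine h.congr fun n => ?_
  rw [jacobiTheta₂_term]
  congr 1
  linear_combination (Real.pi * n ^ 2 * δ : ℂ) * Complex.I_sq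

/-- Splitting a Gaussian series with periodic weights into residue classes. -/
lemma tsum_periodic_mul_gaussian (P : ℕ) [NeZero P] (φ : ℤ → ℂ) (hφ : ∀ n k, φ (k * P + n) = φ n)
    (hb : ∀ n, ‖φ n‖ ≤ 1) {δ : ℂ} (hδ : 0 < δ.re) :
    ∑' n : ℤ, φ n * Complex.exp (-Real.pi * δ * (n : ℂ) ^ 2) =
      ∑ r : Fin P, φ (r : ℕ) *
        ∑' k : ℤ, Complex.exp (-Real.pi * (δ * P ^ 2) * ((k : ℂ) + (r : ℕ) / P) ^ 2) := by
  have hP : (P : ℂ) ≠ 0 := NeZero.ne _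
  have hs : Summable fun n : ℤ => φ n * Complex.exp (-Real.pi * δ * (n : ℂ) ^ 2) := by
    refine (summable_cexp_neg_mul_int_sq hδ).norm.of_norm_bounded fun n => ?_
    rw [norm_mul]
    exact mul_le_of_le_one_left (norm_nonneg _) (hb n)
  have hs' := (Equiv.summable_iff (Int.divModEquiv P).symm).2 hs
  rw [← (Int.divModEquiv P).symm.tsum_eq]
  rw [← (Equiv.prodComm _ _).tsum_eq]
  have hs'' := (Equiv.summable_iff (Equiv.prodComm (Fin P) ℤ)).2 hs'
  refine (Summable.tsum_prod hs'').trans ?_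
  rw [tsum_fintype]
  refine Finset.sum_congr rfl fun r _ => ?_
  rw [← tsum_mul_left]
  refine tsum_congr fun k => ?_
  change φ ((Int.divModEquiv P).symm (k, r)) *
    Complex.exp (-Real.pi * δ * (((Int.divModEquiv P).symm (k, r) : ℤ) : ℂ) ^ 2) = _
  have : (Int.divModEquiv P).symm (k, r) = k * P + (r : ℕ) := rfl
  rw [this, hφ]
  congr 2
  push_cast
  field_simp

/-- A shifted theta series is asymptotic to its Gaussian integral. -/
lemma tendsto_gaussian_shift {ι : Type*} {l : Filter ι} {δ : ι → ℂ} (α : ℝ)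
    (h : Filter.Tendsto (fun i => ((δ i)⁻¹).re) l Filter.atTop) :
    Filter.Tendsto (fun i => (δ i) ^ (1 / 2 : ℂ) *
      ∑' k : ℤ, Complex.exp (-Real.pi * δ i * ((k : ℂ) + α) ^ 2)) l (nhds 1) := by
  have key : ∀ᶠ i in l, (δ i) ^ (1 / 2 : ℂ) *
      ∑' k : ℤ, Complex.exp (-Real.pi * δ i * ((k : ℂ) + α) ^ 2) =
      ∑' k : ℤ, Complex.exp (-Real.pi * (δ i)⁻¹ * (k : ℂ) ^ 2
        + 2 * Real.pi * (-Complex.I * α) * k) := by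
    filter_upwards [h.eventually_ge_atTop 1] with i hi
    have hpos : 0 < ((δ i)⁻¹).re := by linarith
    have hne : δ i ≠ 0 := by
      intro h0
      simp [h0] at hpos
    rw [Complex.tsum_exp_neg_quadratic hpos]
    have harg : (δ i).arg ≠ Real.pi := by
      intro h1
      have := (Complex.arg_eq_pi_iff.1 h1).1
      rw [Complex.inv_re] at hpos
      have h2 := Complex.normSq_pos.2 hne
      have := (div_pos_iff_of_pos_right h2).1 hpos
      linarith
    have hinv : 1 / ((δ i) ^ (1 / 2 : ℂ))⁻¹ = (δ i) ^ (1 / 2 : ℂ) := by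
      rw [div_inv_eq_mul, one_mul]
    rw [Complex.inv_cpow _ _ harg, hinv]
    congr 1
    refine tsum_congr fun k => ?_
    congr 1
    rw [div_inv_eq_mul]
    congr 2
    linear_combination (α : ℂ) * Complex.I_sq
  refine Filter.Tendsto.congr' (key.mono fun _ h => h.symm) ?_
  have hsum : Summable fun k : ℤ => Real.exp (-Real.pi * (k : ℝ) ^ 2) := by
    have := (summable_cexp_neg_mul_int_sq (δ := 1) (by simp)).norm
    refine this.congr fun k => ?_
    rw [Complex.norm_exp]
    congr 1
    have : (-Real.pi * 1 * (k : ℂ) ^ 2 : ℂ) = ((-Real.pi * (k : ℝ) ^ 2 : ℝ) : ℂ) := by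
      push_cast; ring
    rw [this, Complex.ofReal_re]
  have h1 : (1 : ℂ) = ∑' k : ℤ, if k = 0 then (1 : ℂ) else 0 := by
    rw [tsum_ite_eq]
  have hnorm : ∀ (i : ι) (k : ℤ), ‖Complex.exp (-Real.pi * (δ i)⁻¹ * (k : ℂ) ^ 2
        + 2 * Real.pi * (-Complex.I * α) * k)‖ =
        Real.exp (-Real.pi * (k : ℝ) ^ 2 * ((δ i)⁻¹).re) := by
    intro i k
    rw [Complex.norm_exp]
    congr 1
    have : (-Real.pi * (δ i)⁻¹ * (k : ℂ) ^ 2 + 2 * Real.pi * (-Complex.I * α) * k : ℂ) =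
      ((-Real.pi * (k : ℝ) ^ 2 : ℝ) : ℂ) * (δ i)⁻¹ + ((-2 * Real.pi * α * k : ℝ) : ℂ) * Complex.I := by
      push_cast; ring
    rw [this, Complex.add_re, Complex.re_ofReal_mul, Complex.re_ofReal_mul]
    simp
  rw [h1]
  refine tendsto_tsum_of_dominated_convergence hsum ?_ ?_
  · intro k
    by_cases hk : k = 0
    · simpa [hk] using tendsto_const_nhds
    · simp only [hk, if_false]
      rw [tendsto_zero_iff_norm_tendsto_zero]
      simp_rw [hnorm]
      refine Real.tendsto_exp_atBot.comp ?_
      refine Filter.Tendsto.const_mul_atTop_of_neg ?_ h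
      have : (0 : ℝ) < (k : ℝ) ^ 2 := by positivity
      nlinarith [Real.pi_pos]
  · filter_upwards [h.eventually_ge_atTop 1] with i hi k
    rw [hnorm, Real.exp_le_exp]
    have : (0 : ℝ) ≤ Real.pi * (k : ℝ) ^ 2 := by positivity
    nlinarith

lemma tendsto_periodic_gaussian {ι : Type*} {l : Filter ι} {δ : ι → ℂ} (P : ℕ) [NeZero P]
    (φ : ℤ → ℂ) (hφ : ∀ n k, φ (k * P + n) = φ n) (hb : ∀ n, ‖φ n‖ ≤ 1)
    (hδ : ∀ᶠ i in l, 0 < (δ i).re)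
    (h : Filter.Tendsto (fun i => ((δ i)⁻¹).re) l Filter.atTop) :
    Filter.Tendsto (fun i => (δ i * P ^ 2) ^ (1 / 2 : ℂ) *
      ∑' n : ℤ, φ n * Complex.exp (-Real.pi * δ i * (n : ℂ) ^ 2)) l
      (nhds (∑ r : Fin P, φ (r : ℕ))) := by
  have hP : 0 < (P : ℝ) := Nat.cast_pos.2 (NeZero.pos P)
  have h2 : Filter.Tendsto (fun i => ((δ i * P ^ 2)⁻¹).re) l Filter.atTop := by
    refine (h.atTop_mul_const (r := ((P : ℝ) ^ 2)⁻¹) (by positivity)).congr fun i => ?_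
    have : (δ i * P ^ 2)⁻¹ = (δ i)⁻¹ * ((((P : ℝ) ^ 2)⁻¹ : ℝ) : ℂ) := by
      push_cast; rw [mul_inv]
    rw [this, Complex.re_mul_ofReal]
  have h3 : Filter.Tendsto (fun i => ∑ r : Fin P, φ (r : ℕ) * ((δ i * P ^ 2) ^ (1 / 2 : ℂ) *
      ∑' k : ℤ, Complex.exp (-Real.pi * (δ i * P ^ 2) * ((k : ℂ) + (((r : ℕ) / P : ℝ) : ℂ)) ^ 2)))
      l (nhds (∑ r : Fin P, φ (r : ℕ) * 1)) :=
    tendsto_finsetSum _ fun r _ => (tendsto_gaussian_shift _ h2).const_mul _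
  simp only [mul_one] at h3
  refine h3.congr' ?_
  filter_upwards [hδ] with i hi
  rw [tsum_periodic_mul_gaussian P φ hφ hb hi, Finset.mul_sum]
  refine Finset.sum_congr rfl fun r _ => ?_
  push_cast
  ring

/-- The value of the quadratic Gauss sum `∑ e(r²/m)`. -/
lemma quadratic_gauss_sum_eq (m : ℕ) [NeZero m] :
    ∑ r : Fin m, Complex.exp (2 * Real.pi * Complex.I * ((r : ℕ) : ℂ) ^ 2 / m) =
      (Real.sqrt m : ℂ) * ((1 + Complex.I) / 2) * (1 + (-Complex.I) ^ m) := by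
  have hm : 0 < (m : ℝ) := Nat.cast_pos.2 (NeZero.pos m)
  have hmC : (m : ℂ) ≠ 0 := NeZero.ne _
  have hI := Complex.I_sq
  set l : Filter ℝ := nhdsWithin 0 (Set.Ioi 0) with hl
  -- first expansion
  let φ₁ : ℤ → ℂ := fun n => Complex.exp (2 * Real.pi * Complex.I * (n : ℂ) ^ 2 / m)
  let φ₂ : ℤ → ℂ := fun n => Complex.exp (-Real.pi * (Complex.I * m / 2) * (n : ℂ) ^ 2)
  let t : ℝ → ℂ := fun ε => ε - 2 * Complex.I / m
  let δ : ℝ → ℂ := fun ε => (t ε)⁻¹ - Complex.I * m / 2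
  have hpos : ∀ᶠ ε in l, 0 < ε := self_mem_nhdsWithin
  have htre : ∀ ε, (t ε).re = ε := by
    intro ε
    have : t ε = (ε : ℂ) + ((-(2 / m) : ℝ) : ℂ) * Complex.I := by
      simp only [t]; push_cast; ring
    rw [this]; simp
  have htim : ∀ ε, (t ε).im = -(2 / m) := by
    intro ε
    have : t ε = (ε : ℂ) + ((-(2 / m) : ℝ) : ℂ) * Complex.I := by
      simp only [t]; push_cast; ring
    rw [this]; simp
  have htne : ∀ ε, t ε ≠ 0 := by
    intro ε h
    have := htim ε
    rw [h, Complex.zero_im] at this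
    have : 0 < 2 / (m : ℝ) := by positivity
    linarith
  have htmul : ∀ ε : ℝ, Complex.I * m / 2 * t ε = Complex.I * m * ε / 2 + 1 := by
    intro ε
    simp only [t]
    field_simp
    linear_combination (-2 : ℂ) * hI
  have hδeq : ∀ ε, δ ε = ε * (-(Complex.I * m / 2) * (t ε)⁻¹) := by
    intro ε
    have h1 : t ε * (t ε)⁻¹ = 1 := mul_inv_cancel₀ (htne ε)
    have h2 := htmul ε
    simp only [δ]
    linear_combination (Complex.I * m / 2) * h1 - (t ε)⁻¹ * h2
  have hδre : ∀ ε, 0 < ε → 0 < (δ ε).re := by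
    intro ε hε
    have : (δ ε).re = ((t ε)⁻¹).re := by
      have h2 : Complex.I * m / 2 = ((m / 2 : ℝ) : ℂ) * Complex.I := by push_cast; ring
      simp only [δ, Complex.sub_re, h2]
      simp
    rw [this, Complex.inv_re, htre]
    exact div_pos hε (Complex.normSq_pos.2 (htne ε))
  have hδinv : ∀ ε, 0 < ε → ((δ ε)⁻¹).re = 4 / (m ^ 2 * ε) := by
    intro ε hε
    have hε' : (ε : ℂ) ≠ 0 := by exact_mod_cast hε.ne'
    have : (δ ε)⁻¹ = ((4 / (m ^ 2 * ε) : ℝ) : ℂ) + ((2 / m : ℝ) : ℂ) * Complex.I := by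
      have h1 := htne ε
      have h2 : ((4 / (m ^ 2 * ε) : ℝ) : ℂ) + ((2 / m : ℝ) : ℂ) * Complex.I =
          2 * Complex.I / (m * ε) * t ε := by
        simp only [t]
        push_cast
        field_simp
        linear_combination (4 : ℂ) * hI
      rw [h2, hδeq]
      refine inv_eq_of_mul_eq_one_left ?_
      field_simp
      linear_combination -hI
    rw [this, Complex.add_re, Complex.ofReal_re, Complex.re_ofReal_mul, Complex.I_re]
    ring
  have hinv : Filter.Tendsto (fun ε : ℝ => ε⁻¹) l Filter.atTop := tendsto_inv_nhdsGT_zero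
  have T1 := tendsto_periodic_gaussian (l := l) (δ := fun ε : ℝ => (ε : ℂ)) m φ₁ (by
      intro n k
      simp only [φ₁]
      rw [Complex.exp_eq_exp_iff_exists_int]
      refine ⟨k ^ 2 * m + 2 * k * n, ?_⟩
      push_cast
      field_simp
      ring) (by
      intro n
      have : 2 * Real.pi * Complex.I * (n : ℂ) ^ 2 / m =
        ((2 * Real.pi * n ^ 2 / m : ℝ) : ℂ) * Complex.I := by push_cast; ring
      simp only [φ₁, this, Complex.norm_exp_ofReal_mul_I, le_refl])
    (by filter_upwards [hpos] with ε hε; simpa using hε)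
    (by refine hinv.congr fun ε => ?_
        rw [← Complex.ofReal_inv, Complex.ofReal_re])
  have T2 := tendsto_periodic_gaussian (l := l) (δ := δ) 2 φ₂ (by
      intro n k
      simp only [φ₂]
      rw [Complex.exp_eq_exp_iff_exists_int]
      refine ⟨-(m * (k ^ 2 + k * n)), ?_⟩
      push_cast
      ring) (by
      intro n
      have : -Real.pi * (Complex.I * m / 2) * (n : ℂ) ^ 2 =
        ((-Real.pi * m / 2 * n ^ 2 : ℝ) : ℂ) * Complex.I := by push_cast; ring
      simp only [φ₂, this, Complex.norm_exp_ofReal_mul_I, le_refl])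
    (by filter_upwards [hpos] with ε hε using hδre ε hε)
    (by have := hinv.const_mul_atTop (r := 4 / (m : ℝ) ^ 2) (by positivity)
        refine this.congr' ?_
        filter_upwards [hpos] with ε hε
        rw [hδinv ε hε]
        field_simp)
  -- the two series are related by the functional equation
  have hfun : ∀ ε : ℝ, 0 < ε → ∑' n : ℤ, φ₁ n * Complex.exp (-Real.pi * (ε : ℂ) * (n : ℂ) ^ 2) =
      1 / (t ε) ^ (1 / 2 : ℂ) *
        ∑' n : ℤ, φ₂ n * Complex.exp (-Real.pi * δ ε * (n : ℂ) ^ 2) := by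
    intro ε hε
    have h := Complex.tsum_exp_neg_quadratic (a := t ε) (by rw [htre]; exact hε) 0
    convert h using 1
    · refine tsum_congr fun n => ?_
      simp only [φ₁]
      rw [← Complex.exp_add]
      congr 1
      simp only [t]
      ring
    · congr 1
      refine tsum_congr fun n => ?_
      simp only [φ₂]
      rw [← Complex.exp_add]
      congr 1
      simp only [δ]
      ring
  have hτ0 : Filter.Tendsto t l (nhds (-(2 * Complex.I / m))) := by
    have : Continuous t := by simp only [t]; fun_prop
    have h := this.tendsto 0
    simp only [t, Complex.ofReal_zero, zero_sub] at h
    exact h.mono_left nhdsWithin_le_nhds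
  have hslit : -(2 * Complex.I / (m : ℂ)) ∈ Complex.slitPlane := by
    have := htim 0
    simp only [t, Complex.ofReal_zero, zero_sub] at this
    refine Complex.mem_slitPlane_iff.2 (Or.inr ?_)
    rw [this]
    have : 0 < 2 / (m : ℝ) := by positivity
    linarith
  have hκ : Filter.Tendsto (fun ε => (m : ℂ) * (1 / (t ε) ^ (1 / 2 : ℂ)) *
      (1 / ((-(Complex.I * m / 2) * (t ε)⁻¹) * 2 ^ 2) ^ (1 / 2 : ℂ))) l
      (nhds ((m : ℂ) * (1 / (-(2 * Complex.I / (m : ℂ))) ^ (1 / 2 : ℂ)) *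
        (1 / (((m : ℝ) ^ 2 : ℝ) : ℂ) ^ (1 / 2 : ℂ)))) := by
    have ha : Filter.Tendsto (fun ε => (t ε) ^ (1 / 2 : ℂ)) l
        (nhds ((-(2 * Complex.I / (m : ℂ))) ^ (1 / 2 : ℂ))) :=
      (continuousAt_cpow_const hslit).tendsto.comp hτ0
    have hne0 := Complex.slitPlane_ne_zero hslit
    have hb : Filter.Tendsto (fun ε => (-(Complex.I * m / 2) * (t ε)⁻¹) * 2 ^ 2) l
        (nhds (((m : ℝ) ^ 2 : ℝ) : ℂ)) := by
      have := ((hτ0.inv₀ hne0).const_mul (-(Complex.I * m / 2))).mul_const (2 ^ 2)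
      convert this using 2
      have h2 := Complex.I_ne_zero
      push_cast
      field_simp
    have hc := (continuousAt_cpow_const (b := (1 / 2 : ℂ)) (Complex.ofReal_mem_slitPlane.2
      (show (0:ℝ) < (m : ℝ) ^ 2 by positivity))).tendsto.comp hb
    refine Filter.Tendsto.mul (Filter.Tendsto.const_mul _ ?_) ?_
    · exact tendsto_const_nhds.div ha (by simp [Complex.cpow_eq_zero_iff, hne0] )
    · exact tendsto_const_nhds.div hc (by simp [Complex.cpow_eq_zero_iff, hmC])
  have T3 := hκ.mul T2
  have heq : (fun ε : ℝ => ((ε : ℂ) * m ^ 2) ^ (1 / 2 : ℂ) *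
      ∑' n : ℤ, φ₁ n * Complex.exp (-Real.pi * (ε : ℂ) * (n : ℂ) ^ 2)) =ᶠ[l] fun ε =>
      (m : ℂ) * (1 / (t ε) ^ (1 / 2 : ℂ)) *
      (1 / ((-(Complex.I * m / 2) * (t ε)⁻¹) * 2 ^ 2) ^ (1 / 2 : ℂ)) *
      ((δ ε * (2 : ℕ) ^ 2) ^ (1 / 2 : ℂ) *
        ∑' n : ℤ, φ₂ n * Complex.exp (-Real.pi * δ ε * (n : ℂ) ^ 2)) := by
    filter_upwards [hpos] with ε hε
    rw [hfun ε hε, hδeq]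
    have h1 : ((ε : ℂ) * m ^ 2) ^ (1 / 2 : ℂ) = (ε : ℂ) ^ (1 / 2 : ℂ) * m := by
      have : ((ε : ℂ) * m ^ 2) = ((ε : ℝ) : ℂ) * (((m : ℝ) ^ 2 : ℝ) : ℂ) := by push_cast; ring
      rw [this, Complex.mul_cpow_ofReal_nonneg hε.le (by positivity)]
      congr 1
      rw [show (1 / 2 : ℂ) = ((1 / 2 : ℝ) : ℂ) by push_cast; ring,
        ← Complex.ofReal_cpow (by positivity), ← Real.sqrt_eq_rpow, Real.sqrt_sq hm.le]
      simp
    have hw : (-(Complex.I * m / 2) * (t ε)⁻¹) * 2 ^ 2 ≠ 0 := by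
      have := htne ε
      simp [this, hmC]
    have h2 : ((ε : ℂ) * (-(Complex.I * m / 2) * (t ε)⁻¹) * ((2 : ℕ) : ℂ) ^ 2) ^ (1 / 2 : ℂ) =
        (ε : ℂ) ^ (1 / 2 : ℂ) * ((-(Complex.I * m / 2) * (t ε)⁻¹) * 2 ^ 2) ^ (1 / 2 : ℂ) := by
      have h3 := Complex.real_smul (x := ε) (z := (-(Complex.I * m / 2) * (t ε)⁻¹) * 2 ^ 2)
      push_cast
      rw [mul_assoc, Complex.cpow_def_of_ne_zero (mul_ne_zero (by exact_mod_cast hε.ne') hw),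
        Complex.log_ofReal_mul hε hw, add_mul, Complex.exp_add,
        Complex.cpow_def_of_ne_zero (by exact_mod_cast hε.ne'),
        Complex.cpow_def_of_ne_zero hw, Complex.ofReal_log hε.le]
    rw [h1, h2]
    have hw' : ((-(Complex.I * m / 2) * (t ε)⁻¹) * 2 ^ 2) ^ (1 / 2 : ℂ) ≠ 0 := by
      rw [Ne, Complex.cpow_eq_zero_iff]; tauto
    generalize ((-(Complex.I * m / 2) * (t ε)⁻¹) * 2 ^ 2) ^ (1 / 2 : ℂ) = w at *
    field_simp
  have hG := tendsto_nhds_unique (T1.congr' heq) T3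
  have e1 : ∑ r : Fin m, φ₁ ((r : ℕ) : ℤ) =
    ∑ r : Fin m, Complex.exp (2 * Real.pi * Complex.I * ((r : ℕ) : ℂ) ^ 2 / m) := by
    simp [φ₁]
  have e2 : ∑ r : Fin 2, φ₂ ((r : ℕ) : ℤ) = 1 + (-Complex.I) ^ m := by
    simp only [Fin.sum_univ_two, φ₂]
    have : -Complex.I = Complex.exp (-(Real.pi / 2 * Complex.I)) := by
      rw [Complex.exp_neg, Complex.exp_pi_div_two_mul_I, Complex.inv_I]
    rw [this, ← Complex.exp_nat_mul]
    simp only [Fin.val_zero, Fin.val_one]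
    congr 1
    · simp
    · congr 1
      push_cast
      ring
  rw [e1, e2] at hG
  rw [hG]
  congr 1
  have e3 : (((m : ℝ) ^ 2 : ℝ) : ℂ) ^ (1 / 2 : ℂ) = m := by
    rw [show (1 / 2 : ℂ) = ((1 / 2 : ℝ) : ℂ) by push_cast; ring,
        ← Complex.ofReal_cpow (by positivity), ← Real.sqrt_eq_rpow, Real.sqrt_sq hm.le]
    simp
  have e4 : (-(2 * Complex.I / (m : ℂ))) ^ (1 / 2 : ℂ) =
      ((Real.sqrt m : ℂ))⁻¹ * (1 - Complex.I) := by
    have hsq : ((Real.sqrt m : ℂ))⁻¹ * (1 - Complex.I) =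
      (((Real.sqrt m)⁻¹ * Real.sqrt 2 : ℝ) : ℂ) * Complex.exp (((-(Real.pi / 4) : ℝ) : ℂ) * Complex.I) := by
      rw [Complex.exp_ofReal_mul_I, Real.cos_neg, Real.sin_neg, Real.cos_pi_div_four,
        Real.sin_pi_div_four]
      have : ((Real.sqrt 2 : ℝ) : ℂ) * (Real.sqrt 2 : ℝ) = 2 := by
        rw [← Complex.ofReal_mul, Real.mul_self_sqrt (by norm_num)]; simp
      push_cast
      linear_combination -((Real.sqrt m : ℂ))⁻¹ * (1 - Complex.I) / 2 * this
    have hpos' : 0 < (Real.sqrt m)⁻¹ * Real.sqrt 2 := by positivity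
    have h2 : -(2 * Complex.I / (m : ℂ)) = (((Real.sqrt m : ℂ))⁻¹ * (1 - Complex.I)) ^ 2 := by
      have : ((Real.sqrt m : ℝ) : ℂ) ^ 2 = m := by
        rw [← Complex.ofReal_pow, Real.sq_sqrt hm.le]; simp
      rw [mul_pow, inv_pow, this]
      field_simp
      linear_combination -hI
    rw [h2]
    have h3 := Complex.pow_cpow_nat_inv (x := ((Real.sqrt m : ℂ))⁻¹ * (1 - Complex.I)) (n := 2)
      two_ne_zero (by
        rw [hsq, Complex.arg_real_mul _ hpos', Complex.arg_exp_mul_I, toIocMod_eq_self _ |>.2]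
        · push_cast; linarith [Real.pi_pos]
        · constructor <;> linarith [Real.pi_pos]) (by
        rw [hsq, Complex.arg_real_mul _ hpos', Complex.arg_exp_mul_I, toIocMod_eq_self _ |>.2]
        · push_cast; linarith [Real.pi_pos]
        · constructor <;> linarith [Real.pi_pos])
    convert h3 using 2
    norm_num
  rw [e3, e4]
  have hs : ((Real.sqrt m : ℝ) : ℂ) ≠ 0 := by
    exact_mod_cast (Real.sqrt_pos.2 hm).ne'
  have h1I : (1 - Complex.I) ≠ 0 := by
    intro h
    have := congrArg Complex.re h
    simp at this
  field_simp
  linear_combination hI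

/-- A primitive character does not factor through a proper divisor of its level. -/
lemma DirichletCharacter.IsPrimitive.eq_of_dvd {q : ℕ} [NeZero q] {χ : DirichletCharacter ℂ q}
    (hχ : χ.IsPrimitive) {d : ℕ} (hd : d ∣ q)
    (h : ∀ u : ℤ, IsCoprime (q : ℤ) u → (d : ℤ) ∣ u - 1 → χ (u : ZMod q) = 1) : d = q := by
  have hfac : χ.FactorsThrough d := by
    rw [DirichletCharacter.factorsThrough_iff_ker_unitsMap hd]
    intro u hu
    rw [MonoidHom.mem_ker] at hu ⊢
    obtain ⟨v, hv⟩ := ZMod.intCast_surjective (u : ZMod q)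
    have hcop : IsCoprime (q : ℤ) v := by
      rw [← ZMod.coe_int_isUnit_iff_isCoprime, hv]
      exact u.isUnit
    have h1 : ((u : ZMod q).cast : ZMod d) = 1 := by
      rw [← ZMod.unitsMap_val hd, hu, Units.val_one]
    have h2 : ((v : ℤ) : ZMod d) = 1 := by
      rw [← h1, ← hv, ZMod.cast_intCast hd]
    have h3 : (d : ℤ) ∣ v - 1 := by
      rw [← ZMod.intCast_zmod_eq_zero_iff_dvd]
      push_cast
      rw [h2, sub_self]
    ext
    rw [MulChar.coe_toUnitHom, ← hv, h v hcop h3, Units.val_one]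
  have h4 : χ.conductor ≤ d := Nat.sInf_le ((DirichletCharacter.mem_conductorSet_iff χ).2 hfac)
  rw [(DirichletCharacter.isPrimitive_def χ).1 hχ] at h4
  exact le_antisymm (Nat.le_of_dvd (NeZero.pos q) hd) h4

lemma DirichletCharacter.isPrimitive_of_forall_dvd {q : ℕ} [NeZero q] {χ : DirichletCharacter ℂ q}
    (H : ∀ d : ℕ, d ∣ q →
      (∀ u : ℤ, IsCoprime (q : ℤ) u → (d : ℤ) ∣ u - 1 → χ (u : ZMod q) = 1) → d = q) :
    χ.IsPrimitive := by
  rw [DirichletCharacter.isPrimitive_def]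
  have hdvd := DirichletCharacter.conductor_dvd_level χ
  refine H _ hdvd fun u hu hdu => ?_
  have hk := (DirichletCharacter.factorsThrough_iff_ker_unitsMap hdvd).1
    (DirichletCharacter.factorsThrough_conductor χ)
  have hunit : IsUnit (u : ZMod q) := (ZMod.coe_int_isUnit_iff_isCoprime u q).2 hu
  have h1 : hunit.unit ∈ (ZMod.unitsMap hdvd).ker := by
    rw [MonoidHom.mem_ker]
    ext
    rw [ZMod.unitsMap_val, IsUnit.unit_spec, ZMod.cast_intCast hdvd, Units.val_one]
    rw [← sub_eq_zero]
    have := (ZMod.intCast_zmod_eq_zero_iff_dvd (u - 1) χ.conductor).2 hdu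
    push_cast at this
    exact this
  have h2 := MonoidHom.mem_ker.1 (hk h1)
  have h3 := congrArg Units.val h2
  rwa [MulChar.coe_toUnitHom, IsUnit.unit_spec, Units.val_one] at h3

/-- The components of a Dirichlet character with respect to a coprime factorization. -/
lemma DirichletCharacter.exists_components {a b : ℕ} (hab : a.Coprime b)
    (χ : DirichletCharacter ℂ (a * b)) (hχ : χ.IsQuadratic) :
    ∃ (χa : DirichletCharacter ℂ a) (χb : DirichletCharacter ℂ b),
      χa.IsQuadratic ∧ χb.IsQuadratic ∧
      ∀ u : ℤ, χ (u : ZMod (a * b)) = χa (u : ZMod a) * χb (u : ZMod b) := by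
  let e := ZMod.chineseRemainder hab
  let fa : ZMod a →* ZMod (a * b) := (e.symm : _ →* _).comp (MonoidHom.inl (ZMod a) (ZMod b))
  let fb : ZMod b →* ZMod (a * b) := (e.symm : _ →* _).comp (MonoidHom.inr (ZMod a) (ZMod b))
  have hfa : ∀ x, fa x = e.symm (x, 1) := fun x => rfl
  have hfb : ∀ x, fb x = e.symm (1, x) := fun x => rfl
  refine ⟨⟨(χ.toMonoidHom).comp fa, ?_⟩, ⟨(χ.toMonoidHom).comp fb, ?_⟩, ?_, ?_, ?_⟩
  · intro x hx
    refine χ.map_nonunit' _ fun h => hx ?_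
    have : IsUnit (e (fa x)) := h.map e
    rw [hfa, e.apply_symm_apply] at this
    exact (Prod.isUnit_iff.1 this).1
  · intro x hx
    refine χ.map_nonunit' _ fun h => hx ?_
    have : IsUnit (e (fb x)) := h.map e
    rw [hfb, e.apply_symm_apply] at this
    exact (Prod.isUnit_iff.1 this).2
  · exact fun x => hχ (fa x)
  · exact fun x => hχ (fb x)
  · intro u
    change χ _ = χ (fa _) * χ (fb _)
    rw [← map_mul, hfa, hfb, ← map_mul, Prod.mk_mul_mk, one_mul, mul_one]
    congr 1
    rw [eq_comm, RingEquiv.symm_apply_eq, map_intCast]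
    rfl

lemma DirichletCharacter.isPrimitive_left {a b : ℕ} [NeZero a] [NeZero b]
    {χ : DirichletCharacter ℂ (a * b)} {χa : DirichletCharacter ℂ a}
    {χb : DirichletCharacter ℂ b}
    (hmul : ∀ u : ℤ, χ (u : ZMod (a * b)) = χa (u : ZMod a) * χb (u : ZMod b))
    (hχ : χ.IsPrimitive) : χa.IsPrimitive := by
  refine DirichletCharacter.isPrimitive_of_forall_dvd fun d hd H => ?_
  have h := hχ.eq_of_dvd (d := d * b) (Nat.mul_dvd_mul_right hd b) fun u hu hdu => ?_
  · exact Nat.eq_of_mul_eq_mul_right (NeZero.pos b) h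
  · push_cast at hu hdu
    have h1 : ((u : ℤ) : ZMod b) = 1 := by
      have := (ZMod.intCast_zmod_eq_zero_iff_dvd (u - 1) b).2 ((Dvd.intro_left _ rfl).trans hdu)
      push_cast at this
      exact sub_eq_zero.1 this
    rw [hmul, h1, map_one, mul_one]
    exact H u (IsCoprime.of_mul_left_left hu) ((Dvd.intro _ rfl).trans hdu)

lemma DirichletCharacter.isPrimitive_right {a b : ℕ} [NeZero a] [NeZero b]
    {χ : DirichletCharacter ℂ (a * b)} {χa : DirichletCharacter ℂ a}
    {χb : DirichletCharacter ℂ b}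
    (hmul : ∀ u : ℤ, χ (u : ZMod (a * b)) = χa (u : ZMod a) * χb (u : ZMod b))
    (hχ : χ.IsPrimitive) : χb.IsPrimitive := by
  refine DirichletCharacter.isPrimitive_of_forall_dvd fun d hd H => ?_
  have h := hχ.eq_of_dvd (d := a * d) (Nat.mul_dvd_mul_left a hd) fun u hu hdu => ?_
  · exact Nat.eq_of_mul_eq_mul_left (NeZero.pos a) h
  · push_cast at hu hdu
    have h1 : ((u : ℤ) : ZMod a) = 1 := by
      have := (ZMod.intCast_zmod_eq_zero_iff_dvd (u - 1) a).2 ((Dvd.intro _ rfl).trans hdu)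
      push_cast at this
      exact sub_eq_zero.1 this
    rw [hmul, h1, map_one, one_mul]
    exact H u (IsCoprime.of_mul_left_right hu) ((Dvd.intro_left _ rfl).trans hdu)

/-- Multiplicativity of Gauss sums for coprime moduli. -/
lemma gaussSum_mul_of_coprime {a b : ℕ} [NeZero a] [NeZero b] (hab : a.Coprime b)
    {χ : DirichletCharacter ℂ (a * b)} {χa : DirichletCharacter ℂ a}
    {χb : DirichletCharacter ℂ b}
    (hmul : ∀ u : ℤ, χ (u : ZMod (a * b)) = χa (u : ZMod a) * χb (u : ZMod b)) :
    gaussSum χ ZMod.stdAddChar = χa (b : ZMod a) * χb (a : ZMod b) *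
      (gaussSum χa ZMod.stdAddChar * gaussSum χb ZMod.stdAddChar) := by
  have hua : IsUnit (b : ZMod a) := (ZMod.isUnit_iff_coprime b a).2 hab.symm
  have hub : IsUnit (a : ZMod b) := (ZMod.isUnit_iff_coprime a b).2 hab
  let N : ZMod a × ZMod b → ℤ := fun p => b * (p.1.val : ℤ) + a * (p.2.val : ℤ)
  let f : ZMod a × ZMod b → ZMod (a * b) := fun p => (N p : ZMod (a * b))
  have hNa : ∀ p, ((N p : ℤ) : ZMod a) = b * p.1 := by
    intro p
    simp [N]
  have hNb : ∀ p, ((N p : ℤ) : ZMod b) = a * p.2 := by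
    intro p
    simp [N]
  have hf : Function.Bijective f := by
    rw [Fintype.bijective_iff_injective_and_card]
    refine ⟨fun p p' h => ?_, by simp [ZMod.card]⟩
    have h0 : ((N p - N p' : ℤ) : ZMod (a * b)) = 0 := by
      push_cast
      exact sub_eq_zero.2 h
    rw [ZMod.intCast_zmod_eq_zero_iff_dvd] at h0
    push_cast at h0
    have h1 := (ZMod.intCast_zmod_eq_zero_iff_dvd _ a).2 ((Dvd.intro _ rfl).trans h0)
    have h2 := (ZMod.intCast_zmod_eq_zero_iff_dvd _ b).2 ((Dvd.intro_left _ rfl).trans h0)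
    rw [Int.cast_sub, hNa, hNa, sub_eq_zero] at h1
    rw [Int.cast_sub, hNb, hNb, sub_eq_zero] at h2
    exact Prod.ext (hua.mul_left_cancel h1) (hub.mul_left_cancel h2)
  have hψ : ∀ p, ZMod.stdAddChar (f p) = ZMod.stdAddChar p.1 * ZMod.stdAddChar p.2 := by
    intro p
    have e1 : p.1 = ((p.1.val : ℤ) : ZMod a) := by simp
    have e2 : p.2 = ((p.2.val : ℤ) : ZMod b) := by simp
    have ha : (a : ℂ) ≠ 0 := NeZero.ne _
    have hb : (b : ℂ) ≠ 0 := NeZero.ne _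
    conv_rhs => rw [e1, e2]
    simp only [f]
    rw [ZMod.stdAddChar_coe, ZMod.stdAddChar_coe, ZMod.stdAddChar_coe, ← Complex.exp_add]
    congr 1
    simp only [N]
    push_cast
    field_simp
  unfold gaussSum
  rw [← hf.sum_comp, Fintype.sum_prod_type, Finset.sum_mul_sum, Finset.mul_sum]
  refine Finset.sum_congr rfl fun x _ => ?_
  rw [Finset.mul_sum]
  refine Finset.sum_congr rfl fun y _ => ?_
  rw [hψ]
  simp only [f]
  rw [hmul, hNa, hNb, map_mul, map_mul]
  ring

/-- The arithmetic of real primitive Dirichlet characters modulo `q`: they are Kronecker symbols and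
their Gauss sums have the expected argument. -/
def RealPrimitiveArithmetic (q : ℕ) : Prop :=
  ∀ [NeZero q] (χ : DirichletCharacter ℂ q), χ.IsPrimitive → χ.IsQuadratic →
    ∃ ε : ℤ, χ (-1) = ε ∧
      (ε = 1 ∧ gaussSum χ ZMod.stdAddChar = (Real.sqrt q : ℂ) ∨
        ε = -1 ∧ gaussSum χ ZMod.stdAddChar = Complex.I * (Real.sqrt q : ℂ)) ∧
      (Odd q → ∀ x : ℤ, χ (x : ZMod q) = jacobiSym x q) ∧
      ∀ n : ℕ, Odd n → χ (n : ZMod q) = jacobiSym (ε * q) n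

lemma realPrimitiveArithmetic_one : RealPrimitiveArithmetic 1 := by
  intro _ χ _ _
  have h1 : ∀ x, χ x = 1 := fun x => by rw [Subsingleton.elim x 1, map_one]
  refine ⟨1, by simp [h1], Or.inl ⟨rfl, ?_⟩, fun _ x => by simp [h1], fun n _ => by simp [h1]⟩
  unfold gaussSum
  rw [Fintype.sum_subsingleton _ (0 : ZMod 1), h1]
  simp

lemma RealPrimitiveArithmetic.mul {a b : ℕ} (hab : a.Coprime b) (ha : RealPrimitiveArithmetic a)
    (hb : RealPrimitiveArithmetic b) : RealPrimitiveArithmetic (a * b) := by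
  intro hne χ hprim hquad
  have : NeZero a := ⟨left_ne_zero_of_mul hne.out⟩
  have : NeZero b := ⟨right_ne_zero_of_mul hne.out⟩
  obtain ⟨χa, χb, hqa, hqb, hmul⟩ := DirichletCharacter.exists_components hab χ hquad
  obtain ⟨εa, ha1, ha2, ha3, ha4⟩ := ha χa (DirichletCharacter.isPrimitive_left hmul hprim) hqa
  obtain ⟨εb, hb1, hb2, hb3, hb4⟩ := hb χb (DirichletCharacter.isPrimitive_right hmul hprim) hqb
  have hab' : IsCoprime (a : ℤ) (b : ℤ) := Nat.isCoprime_iff_coprime.2 hab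
  have hcross : χa (b : ZMod a) * χb (a : ZMod b) = if εa = -1 ∧ εb = -1 then -1 else 1 := by
    have key : ∀ (a b : ℕ) [NeZero a] [NeZero b] (χa : DirichletCharacter ℂ a)
        (χb : DirichletCharacter ℂ b) (εa εb : ℤ), IsCoprime (a : ℤ) (b : ℤ) → Odd a →
        χa (-1) = εa → (εa = 1 ∨ εa = -1) → (εb = 1 ∨ εb = -1) →
        (∀ x : ℤ, χa (x : ZMod a) = jacobiSym x a) →
        (∀ n : ℕ, Odd n → χb (n : ZMod b) = jacobiSym (εb * b) n) →
        χa (b : ZMod a) * χb (a : ZMod b) = if εa = -1 ∧ εb = -1 then -1 else 1 := by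
      intro a b _ _ χa χb εa εb hab hodd h1 hεa hεb h2 h3
      have e1 := h2 b
      have e2 := h3 a hodd
      have e3 := h2 (-1)
      push_cast at e1 e3
      rw [e1, e2, jacobiSym.mul_left]
      have e4 : jacobiSym b a * jacobiSym b a = 1 := by
        rw [← sq]
        exact jacobiSym.sq_one (Int.isCoprime_iff_gcd_eq_one.1 hab.symm)
      rw [h1] at e3
      have e3' : εa = jacobiSym (-1) a := by exact_mod_cast e3
      rcases hεb with rfl | rfl
      · simp only [jacobiSym.one_left]
        rw [if_neg (by norm_num)]
        rw [one_mul]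
        exact_mod_cast e4
      · rw [← e3']
        rcases hεa with rfl | rfl
        · rw [if_neg (by norm_num), one_mul]
          exact_mod_cast e4
        · rw [if_pos ⟨rfl, rfl⟩]
          have : (jacobiSym b a : ℂ) * jacobiSym b a = 1 := by exact_mod_cast e4
          push_cast
          linear_combination -this
    have hεa : εa = 1 ∨ εa = -1 := ha2.imp And.left And.left
    have hεb : εb = 1 ∨ εb = -1 := hb2.imp And.left And.left
    rcases Nat.even_or_odd a with hea | hoa
    · have hob : Odd b := by
        rw [← Nat.not_even_iff_odd]
        intro heb
        have := Nat.dvd_gcd hea.two_dvd heb.two_dvd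
        rw [hab] at this
        norm_num at this
      have := key b a χb χa εb εa hab'.symm hob hb1 hεb hεa (hb3 hob) ha4
      rw [mul_comm, this]
      simp only [and_comm]
    · exact key a b χa χb εa εb hab' hoa ha1 hεa hεb (ha3 hoa) hb4
  have hsq : (Real.sqrt ((a * b : ℕ) : ℝ) : ℂ) = (Real.sqrt a : ℂ) * (Real.sqrt b : ℂ) := by
    rw [Nat.cast_mul, Real.sqrt_mul (Nat.cast_nonneg a), Complex.ofReal_mul]
  refine ⟨εa * εb, ?_, ?_, ?_, ?_⟩
  · have := hmul (-1)
    push_cast at this ⊢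
    rw [this, ha1, hb1]
  · rw [gaussSum_mul_of_coprime hab hmul, hcross, hsq]
    rcases ha2 with ⟨rfl, h1⟩ | ⟨rfl, h1⟩ <;> rcases hb2 with ⟨rfl, h2⟩ | ⟨rfl, h2⟩ <;>
      rw [h1, h2]
    · left; simp
    · right; norm_num; ring
    · right; norm_num; ring
    · left
      norm_num
      linear_combination -((Real.sqrt a : ℂ) * (Real.sqrt b : ℂ)) * Complex.I_sq
  · intro hodd x
    rw [hmul, ha3 (Nat.odd_mul.1 hodd).1, hb3 (Nat.odd_mul.1 hodd).2,
      jacobiSym.mul_right]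
    push_cast
    rfl
  · intro n hn
    have := hmul n
    push_cast at this
    rw [this, ha4 n hn, hb4 n hn, ← Int.cast_mul, ← jacobiSym.mul_left]
    congr 2
    push_cast
    ring

lemma MulChar.IsQuadratic.eq_one_or_neg_one {R : Type*} [CommMonoid R] {χ : MulChar R ℂ}
    (hχ : χ.IsQuadratic) {x : R} (hx : IsUnit x) : χ x = 1 ∨ χ x = -1 :=
  (hχ x).resolve_left (hx.map χ).ne_zero

lemma MulChar.IsQuadratic.sq_eq_one_of_isUnit {R : Type*} [CommMonoid R] {χ : MulChar R ℂ}
    (hχ : χ.IsQuadratic) {x : R} (hx : IsUnit x) : χ x ^ 2 = 1 := by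
  rcases hχ.eq_one_or_neg_one hx with h | h <;> simp [h]

lemma exponent_eq_one_of_isPrimitive {p e : ℕ} (hp : p.Prime) (hp2 : p ≠ 2) (he : 0 < e)
    (χ : DirichletCharacter ℂ (p ^ e)) (hprim : χ.IsPrimitive) (hquad : χ.IsQuadratic) :
    e = 1 := by
  have : NeZero (p ^ e) := ⟨(pow_pos hp.pos e).ne'⟩
  by_contra hne
  have h2 : 2 ≤ e := by omega
  have h := hprim.eq_of_dvd (d := p ^ (e - 1)) (pow_dvd_pow p (by omega)) fun u hu hd => ?_
  · have := Nat.pow_right_injective hp.two_le h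
    omega
  · have hunit := (ZMod.coe_int_isUnit_iff_isCoprime u _).2 hu
    have hpd : (p : ℤ) ∣ u - 1 := by
      refine dvd_trans ?_ hd
      push_cast
      exact dvd_pow_self _ (by omega)
    have hgeom : (p : ℤ) ∣ ∑ i ∈ range p, u ^ i := by
      have h1 : ∑ i ∈ range p, u ^ i ≡ ∑ i ∈ range p, 1 [ZMOD p] :=
        Int.ModEq.sum fun i _ => by
          have : u ≡ 1 [ZMOD p] := (Int.modEq_iff_dvd.2 hpd).symm
          simpa using this.pow i
      simp only [sum_const, card_range, nsmul_eq_mul, mul_one] at h1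
      exact h1.dvd_iff.2 dvd_rfl
    have hpow : ((u : ℤ) : ZMod (p ^ e)) ^ p = 1 := by
      have h3 : ((p ^ e : ℕ) : ℤ) ∣ u ^ p - 1 := by
        rw [← mul_geom_sum]
        have : ((p ^ e : ℕ) : ℤ) = ((p ^ (e - 1) : ℕ) : ℤ) * p := by
          rw [← Nat.cast_mul, ← pow_succ]
          congr 2
          omega
        rw [this]
        exact mul_dvd_mul hd hgeom
      have := (ZMod.intCast_zmod_eq_zero_iff_dvd _ _).2 h3
      rw [Int.cast_sub, Int.cast_pow, Int.cast_one] at this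
      exact sub_eq_zero.1 this
    have h4 : χ (u : ZMod (p ^ e)) ^ p = 1 := by rw [← map_pow, hpow, map_one]
    rcases hquad.eq_one_or_neg_one hunit with h5 | h5
    · exact h5
    · rw [h5, (hp.odd_of_ne_two hp2).neg_one_pow] at h4
      norm_num at h4

lemma eq_quadraticChar_of_isPrimitive {p : ℕ} [Fact p.Prime]
    (χ : DirichletCharacter ℂ p) (hprim : χ.IsPrimitive) (hquad : χ.IsQuadratic) (x : ZMod p) :
    χ x = (quadraticChar (ZMod p) x : ℤ) := by
  have hp := Fact.out (p := p.Prime)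
  have : NeZero p := ⟨hp.ne_zero⟩
  have hsq : ∀ y : ZMod p, y ≠ 0 → quadraticChar (ZMod p) y = 1 → χ y = 1 := by
    intro y hy h
    obtain ⟨z, rfl⟩ := (quadraticChar_one_iff_isSquare hy).1 h
    have hz : z ≠ 0 := fun h => hy (by simp [h])
    rw [map_mul, ← sq]
    exact hquad.sq_eq_one_of_isUnit hz.isUnit
  rcases eq_or_ne x 0 with rfl | hx
  · rw [MulChar.map_zero, MulChar.map_zero, Int.cast_zero]
  obtain ⟨c, hc, hc1⟩ : ∃ c : ZMod p, c ≠ 0 ∧ χ c ≠ 1 := by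
    by_contra! hall
    have := hprim.eq_of_dvd (one_dvd p) fun u hu _ =>
      hall u ((ZMod.coe_int_isUnit_iff_isCoprime u p).2 hu).ne_zero
    exact hp.one_lt.ne this
  have hc2 : χ c = -1 := (hquad.eq_one_or_neg_one hc.isUnit).resolve_left hc1
  have hc3 : quadraticChar (ZMod p) c = -1 :=
    (quadraticChar_dichotomy hc).resolve_left fun h => hc1 (hsq c hc h)
  rcases quadraticChar_dichotomy hx with h | h
  · rw [h, hsq x hx h, Int.cast_one]
  · have h1 := hsq (x * c) (mul_ne_zero hx hc) (by rw [map_mul, h, hc3]; norm_num)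
    rw [map_mul, hc2] at h1
    rw [h]
    push_cast
    linear_combination -h1

lemma gaussSum_quadraticChar {p : ℕ} [Fact p.Prime] (hp2 : p ≠ 2)
    (χ : DirichletCharacter ℂ p)
    (h : ∀ x, χ x = (quadraticChar (ZMod p) x : ℤ)) :
    gaussSum χ ZMod.stdAddChar =
      (Real.sqrt p : ℂ) * ((1 + Complex.I) / 2) * (1 + (-Complex.I) ^ p) := by
  have hp := Fact.out (p := p.Prime)
  rw [← quadratic_gauss_sum_eq]
  have h0 : ∑ y : ZMod p, ZMod.stdAddChar y = 0 :=
    AddChar.sum_eq_zero_of_ne_one (by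
      have := ZMod.isPrimitive_stdAddChar p (one_ne_zero)
      simpa using this)
  have h1 : ∑ x : ZMod p, ZMod.stdAddChar (x ^ 2) = gaussSum χ ZMod.stdAddChar := by
    have h2 : ∑ x : ZMod p, ZMod.stdAddChar (x ^ 2) =
        ∑ y : ZMod p, (χ y + 1) * ZMod.stdAddChar y := by
      rw [← Finset.sum_fiberwise_of_maps_to (s := univ) (t := univ) (g := fun x : ZMod p => x ^ 2)
        (fun _ _ => mem_univ _)]
      refine Finset.sum_congr rfl fun y _ => ?_
      have hc := quadraticChar_card_sqrts (F := ZMod p)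
        (by rw [ZMod.ringChar_zmod_n]; exact hp2) y
      have : ∀ x ∈ univ.filter (fun x : ZMod p => x ^ 2 = y),
          ZMod.stdAddChar (x ^ 2) = (ZMod.stdAddChar y : ℂ) := by
        intro x hx
        rw [(mem_filter.1 hx).2]
      rw [Finset.sum_congr rfl this, sum_const, nsmul_eq_mul]
      congr 1
      rw [h]
      have h3 : ((univ.filter (fun x : ZMod p => x ^ 2 = y)).card : ℤ) =
          quadraticChar (ZMod p) y + 1 := by
        rw [← hc]
        congr 2
        ext x
        simp
      exact_mod_cast h3
    rw [h2]
    simp_rw [add_mul, one_mul, sum_add_distrib, h0, add_zero]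
    rfl
  rw [← h1]
  obtain ⟨k, rfl⟩ := Nat.exists_eq_succ_of_ne_zero hp.ne_zero
  refine Finset.sum_congr rfl fun r _ => ?_
  have e1 : (r : ZMod (k + 1)) = (((r : Fin (k + 1)).val : ℤ) : ZMod (k + 1)) := by
    have := ZMod.natCast_zmod_val (r : ZMod (k + 1))
    rw [Int.cast_natCast]
    exact this.symm
  have := ZMod.stdAddChar_coe (N := k + 1) ((((r : Fin (k + 1)).val : ℤ)) ^ 2)
  push_cast at this e1 ⊢
  exact (congrArg (fun x : ZMod (k + 1) => ZMod.stdAddChar (x ^ 2)) e1).trans this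

lemma RealPrimitiveArithmetic.of_odd_prime {p : ℕ} [Fact p.Prime] (hp2 : p ≠ 2) :
    RealPrimitiveArithmetic p := by
  intro _ χ hprim hquad
  have hp := Fact.out (p := p.Prime)
  have hodd := hp.odd_of_ne_two hp2
  have hχ := eq_quadraticChar_of_isPrimitive χ hprim hquad
  have hjac : ∀ x : ℤ, χ (x : ZMod p) = jacobiSym x p := by
    intro x
    rw [hχ, ← jacobiSym.legendreSym.to_jacobiSym]
    rfl
  have hg := gaussSum_quadraticChar hp2 χ hχ
  have hneg : χ (-1) = (jacobiSym (-1) p : ℤ) := by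
    rw [← hjac]
    simp
  have hI : Complex.I ^ 4 = 1 := Complex.I_pow_four
  have hp4 : p % 4 = 1 ∨ p % 4 = 3 := by
    have := Nat.odd_iff.1 hodd
    omega
  have hpow : (-Complex.I) ^ p = (-Complex.I) ^ (p % 4) := by
    conv_lhs => rw [← Nat.div_add_mod p 4, pow_add, pow_mul]
    rw [show (-Complex.I) ^ 4 = 1 by linear_combination hI, one_pow, one_mul]
  have hneg' := jacobiSym.at_neg_one hodd
  rcases hp4 with h4 | h4
  · have h5 : jacobiSym (-1) p = 1 := by rw [hneg', ZMod.χ₄_nat_one_mod_four h4]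
    refine ⟨1, by rw [hneg, h5], Or.inl ⟨rfl, ?_⟩, fun _ => hjac, fun n hn => ?_⟩
    · rw [hg, hpow, h4]
      linear_combination -(Real.sqrt p : ℂ) / 2 * Complex.I_sq
    · have := hjac n
      rw [Int.cast_natCast] at this
      rw [this, one_mul, jacobiSym.quadratic_reciprocity_one_mod_four h4 hn]
  · have h5 : jacobiSym (-1) p = -1 := by rw [hneg', ZMod.χ₄_nat_three_mod_four h4]
    refine ⟨-1, by rw [hneg, h5], Or.inr ⟨rfl, ?_⟩, fun _ => hjac, fun n hn => ?_⟩
    · rw [hg, hpow, h4]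
      linear_combination (Real.sqrt p : ℂ) / 2 * (1 - Complex.I - Complex.I ^ 2) * Complex.I_sq
    · have := hjac n
      rw [Int.cast_natCast] at this
      rw [this, jacobiSym.mul_left, jacobiSym.at_neg_one hn]
      have hn4 : n % 4 = 1 ∨ n % 4 = 3 := by
        have := Nat.odd_iff.1 hn
        omega
      rcases hn4 with hn4 | hn4
      · rw [ZMod.χ₄_nat_one_mod_four hn4, one_mul,
          jacobiSym.quadratic_reciprocity_one_mod_four hn4 hodd]
      · rw [ZMod.χ₄_nat_three_mod_four hn4,
          jacobiSym.quadratic_reciprocity_three_mod_four hn4 h4, neg_one_mul]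

lemma exponent_lt_four_of_isPrimitive {e : ℕ} (χ : DirichletCharacter ℂ (2 ^ e))
    (hprim : χ.IsPrimitive) (hquad : χ.IsQuadratic) : e < 4 := by
  have : NeZero (2 ^ e) := ⟨(pow_pos two_pos e).ne'⟩
  by_contra! he
  have h := hprim.eq_of_dvd (d := 2 ^ (e - 1)) (pow_dvd_pow 2 (by omega)) fun u hu hd => ?_
  · have := Nat.pow_right_injective le_rfl h
    omega
  · obtain ⟨c, hc⟩ := hd
    have h8 : ((2 ^ (e - 1) : ℕ) : ℤ) = 2 * 2 ^ (e - 2) := by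
      push_cast
      rw [← pow_succ']
      congr 1
      omega
    have hq : ((2 ^ e : ℕ) : ℤ) = 2 * (2 * 2 ^ (e - 2)) := by
      push_cast
      rw [← pow_succ', ← pow_succ']
      congr 1
      omega
    have hz : (2 : ℤ) ^ (e - 2) = 2 * (2 * 2 ^ (e - 4)) := by
      rw [← pow_succ', ← pow_succ']
      congr 1
      omega
    set z : ℤ := 2 ^ (e - 2)
    rw [h8] at hc
    have hsq : (u : ZMod (2 ^ e)) = ((1 + z * c : ℤ) : ZMod (2 ^ e)) ^ 2 := by
      have : ((2 ^ e : ℕ) : ℤ) ∣ (1 + z * c) ^ 2 - u := by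
        rw [hq]
        refine ⟨2 ^ (e - 4) * c ^ 2, ?_⟩
        linear_combination -hc + (z * c ^ 2) * hz
      have h2 := (ZMod.intCast_zmod_eq_zero_iff_dvd _ _).2 this
      rw [Int.cast_sub, Int.cast_pow, sub_eq_zero] at h2
      exact h2.symm
    have hunit := (ZMod.coe_int_isUnit_iff_isCoprime u _).2 hu
    rw [hsq] at hunit ⊢
    rw [map_pow]
    exact hquad.sq_eq_one_of_isUnit ((isUnit_pow_iff two_ne_zero).1 hunit)

lemma not_isPrimitive_two (χ : DirichletCharacter ℂ 2) : ¬χ.IsPrimitive := by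
  intro h
  have := h.eq_of_dvd (one_dvd 2) fun u hu _ => by
    have hunit := (ZMod.coe_int_isUnit_iff_isCoprime u _).2 hu
    generalize (u : ZMod 2) = x at *
    have : ∀ x : ZMod 2, x ≠ 0 → x = 1 := by decide
    rw [this x hunit.ne_zero, map_one]
  norm_num at this

lemma realPrimitiveArithmetic_four : RealPrimitiveArithmetic 4 := by
  intro _ χ hprim hquad
  have hnu : ∀ x : ZMod 4, ¬IsUnit x → χ x = 0 := fun x => χ.map_nonunit
  have h0 : χ 0 = 0 := hnu 0 (by decide)
  have h2 : χ 2 = 0 := hnu 2 (by decide)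
  have h3 : χ 3 = -1 := by
    refine (hquad.eq_one_or_neg_one (by decide)).resolve_left fun h => ?_
    have := hprim.eq_of_dvd (d := 1) (one_dvd 4) fun u hu _ => by
      have hunit := (ZMod.coe_int_isUnit_iff_isCoprime u _).2 hu
      generalize (u : ZMod 4) = x at *
      have : ∀ x : ZMod 4, IsUnit x → x = 1 ∨ x = 3 := by decide
      rcases this x hunit with rfl | rfl
      · exact map_one χ
      · exact h
    norm_num at this
  have hw : (ZMod.stdAddChar (1 : ZMod 4) : ℂ) = Complex.I := by
    have := ZMod.stdAddChar_coe (N := 4) 1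
    push_cast at this
    rw [this, show 2 * Real.pi * Complex.I * 1 / 4 = Real.pi / 2 * Complex.I by ring,
      Complex.exp_pi_div_two_mul_I]
  have hw3 : (ZMod.stdAddChar (3 : ZMod 4) : ℂ) = -Complex.I := by
    have := AddChar.map_nsmul_eq_pow (ZMod.stdAddChar (N := 4)) 3 1
    rw [hw] at this
    rw [show (3 : ZMod 4) = 3 • 1 by decide, this]
    linear_combination Complex.I * Complex.I_sq
  refine ⟨-1, ?_, Or.inr ⟨rfl, ?_⟩, fun h => absurd h (by decide), fun n hn => ?_⟩
  · rw [show (-1 : ZMod 4) = 3 by decide, h3]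
    norm_num
  · have hs : Real.sqrt ((4 : ℕ) : ℝ) = 2 := by
      rw [Real.sqrt_eq_iff_mul_self_eq_of_pos] <;> norm_num
    have : gaussSum χ ZMod.stdAddChar = χ 0 * ZMod.stdAddChar (0 : ZMod 4) +
        χ 1 * ZMod.stdAddChar (1 : ZMod 4) + χ 2 * ZMod.stdAddChar (2 : ZMod 4) +
        χ 3 * ZMod.stdAddChar (3 : ZMod 4) := Fin.sum_univ_four _
    rw [this, h0, h2, h3, map_one, hw, hw3, hs]
    push_cast
    ring
  · have hJ : jacobiSym (-1 * (4 : ℕ)) n = jacobiSym (-1) n := by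
      rw [jacobiSym.mul_left, show ((4 : ℕ) : ℤ) = 2 ^ 2 by norm_num,
        jacobiSym.sq_one', mul_one]
      exact (Int.gcd_natCast_natCast 2 n).trans (Nat.coprime_two_left.2 hn)
    rw [hJ, jacobiSym.at_neg_one hn]
    have hn4 : n % 4 = 1 ∨ n % 4 = 3 := by
      have := Nat.odd_iff.1 hn
      omega
    rw [← ZMod.natCast_mod n 4]
    rcases hn4 with h | h <;> rw [h]
    · simp
    · have : ZMod.χ₄ ((3 : ℕ) : ZMod 4) = -1 := by decide
      rw [this]
      push_cast
      exact h3

lemma realPrimitiveArithmetic_eight : RealPrimitiveArithmetic 8 := by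
  intro _ χ hprim hquad
  have hnu : ∀ x : ZMod 8, ¬IsUnit x → χ x = 0 := fun x => χ.map_nonunit
  have h0 : χ 0 = 0 := hnu 0 (by decide)
  have h2 : χ 2 = 0 := hnu 2 (by decide)
  have h4 : χ 4 = 0 := hnu 4 (by decide)
  have h6 : χ 6 = 0 := hnu 6 (by decide)
  have h5 : χ 5 = -1 := by
    refine (hquad.eq_one_or_neg_one (by decide)).resolve_left fun h => ?_
    have := hprim.eq_of_dvd (d := 4) (by norm_num) fun u hu hd => by
      obtain ⟨c, hc⟩ := hd
      have hx : (u : ZMod 8) = 1 + 4 * (c : ZMod 8) := by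
        rw [show u = 1 + 4 * c by push_cast at hc; linarith]
        push_cast
        rfl
      rw [hx]
      generalize (c : ZMod 8) = x
      have : ∀ x : ZMod 8, 1 + 4 * x = 1 ∨ 1 + 4 * x = 5 := by decide
      rcases this x with h' | h' <;> rw [h']
      · exact map_one χ
      · exact h
    norm_num at this
  have h7 : χ 7 = -χ 3 := by
    rw [show (7 : ZMod 8) = 3 * 5 by decide, map_mul, h5, mul_neg_one]
  have hs8 : Real.sqrt ((8 : ℕ) : ℝ) = 2 * Real.sqrt 2 := by
    rw [show ((8 : ℕ) : ℝ) = 2 ^ 2 * 2 by norm_num, Real.sqrt_mul (by norm_num),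
      Real.sqrt_sq (by norm_num)]
  have hs2 : (Real.sqrt 2 : ℂ) ^ 2 = 2 := by
    rw [← Complex.ofReal_pow, Real.sq_sqrt (by norm_num)]
    norm_num
  set w : ℂ := ZMod.stdAddChar (1 : ZMod 8) with hwdef
  have hw : w = (Real.sqrt 2 : ℂ) / 2 * (1 + Complex.I) := by
    have := ZMod.stdAddChar_coe (N := 8) 1
    rw [Int.cast_one] at this
    rw [hwdef, this]
    have e : 2 * Real.pi * Complex.I * ((1 : ℤ) : ℂ) / ((8 : ℕ) : ℂ) =
        ((Real.pi / 4 : ℝ) : ℂ) * Complex.I := by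
      push_cast
      ring
    rw [e, Complex.exp_ofReal_mul_I, Real.cos_pi_div_four, Real.sin_pi_div_four]
    push_cast
    ring
  have hw2 : w ^ 2 = Complex.I := by
    rw [hw]
    linear_combination (1 + Complex.I) ^ 2 / 4 * hs2 + Complex.I_sq / 2
  have hpow : ∀ k : ℕ, (ZMod.stdAddChar ((k : ℕ) : ZMod 8) : ℂ) = w ^ k := by
    intro k
    have := AddChar.map_nsmul_eq_pow (ZMod.stdAddChar (N := 8)) k 1
    rwa [nsmul_one] at this
  have hg : gaussSum χ ZMod.stdAddChar = 2 * w * (1 + χ 3 * Complex.I) := by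
    have : gaussSum χ ZMod.stdAddChar = χ 0 * ZMod.stdAddChar (0 : ZMod 8) +
        χ 1 * ZMod.stdAddChar (1 : ZMod 8) + χ 2 * ZMod.stdAddChar (2 : ZMod 8) +
        χ 3 * ZMod.stdAddChar (3 : ZMod 8) + χ 4 * ZMod.stdAddChar (4 : ZMod 8) +
        χ 5 * ZMod.stdAddChar (5 : ZMod 8) + χ 6 * ZMod.stdAddChar (6 : ZMod 8) +
        χ 7 * ZMod.stdAddChar (7 : ZMod 8) := Fin.sum_univ_eight _
    have p3 := hpow 3
    have p5 := hpow 5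
    have p7 := hpow 7
    push_cast at p3 p5 p7
    rw [this, h0, h2, h4, h6, h5, h7, map_one, p3, p5, p7, ← hwdef]
    linear_combination (χ 3 * w - w * (w ^ 2 + Complex.I) -
      χ 3 * w * (w ^ 4 + w ^ 2 * Complex.I + Complex.I ^ 2)) * hw2
      + (-w - χ 3 * w * Complex.I) * Complex.I_sq
  have hneg : χ (-1) = -χ 3 := by
    rw [show (-1 : ZMod 8) = 7 by decide, h7]
  have hn8 : ∀ n : ℕ, Odd n → n % 8 = 1 ∨ n % 8 = 3 ∨ n % 8 = 5 ∨ n % 8 = 7 := by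
    intro n hn
    have := Nat.odd_iff.1 hn
    omega
  have hJ : ∀ (ε : ℤ) (n : ℕ), Odd n → jacobiSym (ε * (8 : ℕ)) n = jacobiSym (ε * 2) n := by
    intro ε n hn
    rw [show ε * ((8 : ℕ) : ℤ) = ε * 2 * 2 ^ 2 by push_cast; ring, jacobiSym.mul_left,
      jacobiSym.sq_one', mul_one]
    exact (Int.gcd_natCast_natCast 2 n).trans (Nat.coprime_two_left.2 hn)
  rcases hquad.eq_one_or_neg_one (x := (3 : ZMod 8)) (by decide) with h3 | h3
  · refine ⟨-1, by rw [hneg, h3]; norm_num, Or.inr ⟨rfl, ?_⟩, fun h => absurd h (by decide),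
      fun n hn => ?_⟩
    · rw [hg, h3, hs8, hw]
      push_cast
      linear_combination (Real.sqrt 2 : ℂ) * Complex.I_sq
    · rw [hJ _ _ hn, neg_one_mul, jacobiSym.at_neg_two hn, ← ZMod.natCast_mod n 8]
      rcases hn8 n hn with h | h | h | h <;> rw [h]
      · simp
      · rw [show ZMod.χ₈' ((3 : ℕ) : ZMod 8) = 1 by decide]
        push_cast
        exact h3
      · rw [show ZMod.χ₈' ((5 : ℕ) : ZMod 8) = -1 by decide]
        push_cast
        exact h5
      · rw [show ZMod.χ₈' ((7 : ℕ) : ZMod 8) = -1 by decide]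
        push_cast
        rw [h7, h3]
  · refine ⟨1, by rw [hneg, h3]; norm_num, Or.inl ⟨rfl, ?_⟩, fun h => absurd h (by decide),
      fun n hn => ?_⟩
    · rw [hg, h3, hs8, hw]
      push_cast
      linear_combination -(Real.sqrt 2 : ℂ) * Complex.I_sq
    · rw [hJ _ _ hn, one_mul, jacobiSym.at_two hn, ← ZMod.natCast_mod n 8]
      rcases hn8 n hn with h | h | h | h <;> rw [h]
      · simp
      · rw [show ZMod.χ₈ ((3 : ℕ) : ZMod 8) = -1 by decide]
        push_cast
        exact h3
      · rw [show ZMod.χ₈ ((5 : ℕ) : ZMod 8) = -1 by decide]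
        push_cast
        exact h5
      · rw [show ZMod.χ₈ ((7 : ℕ) : ZMod 8) = 1 by decide]
        push_cast
        rw [h7, h3, neg_neg]

lemma realPrimitiveArithmetic_of_ne_zero : ∀ q : ℕ, q ≠ 0 → RealPrimitiveArithmetic q := by
  intro q
  induction q using Nat.recOnPosPrimePosCoprime with
  | zero => exact fun h => absurd rfl h
  | one => exact fun _ => realPrimitiveArithmetic_one
  | prime_pow p e hp he =>
    intro _ hne χ hprim hquad
    rcases eq_or_ne p 2 with rfl | hp2
    · have h4 := exponent_lt_four_of_isPrimitive χ hprim hquad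
      interval_cases e
      · exact absurd hprim (not_isPrimitive_two χ)
      · exact realPrimitiveArithmetic_four χ hprim hquad
      · exact realPrimitiveArithmetic_eight χ hprim hquad
    · obtain rfl := exponent_eq_one_of_isPrimitive hp hp2 he χ hprim hquad
      have : Fact p.Prime := ⟨hp⟩
      have key : RealPrimitiveArithmetic (p ^ 1) := by
        rw [pow_one]
        exact RealPrimitiveArithmetic.of_odd_prime hp2
      exact key χ hprim hquad
  | coprime a b ha hb hab iha ihb =>
    exact fun _ => RealPrimitiveArithmetic.mul hab (iha (by omega)) (ihb (by omega))

/-- The root number of a real primitive character is `1`. -/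
lemma rootNumber_eq_one_of_isQuadratic {q : ℕ} [NeZero q] {χ : DirichletCharacter ℂ q}
    (hprim : χ.IsPrimitive) (hquad : χ.IsQuadratic) (hodd : χ.Odd) : χ.rootNumber = 1 := by
  obtain ⟨ε, h1, h2, -, -⟩ := realPrimitiveArithmetic_of_ne_zero q (NeZero.ne q) χ hprim hquad
  have hε : ε = -1 := by
    have : (ε : ℂ) = ((-1 : ℤ) : ℂ) := by rw [← h1, hodd]; norm_num
    exact_mod_cast this
  subst hε
  have h3 := (h2.resolve_left (by norm_num)).2
  have hq : 0 < (q : ℝ) := Nat.cast_pos.2 (NeZero.pos q)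
  have hpow : (q : ℂ) ^ (1 / 2 : ℂ) = (Real.sqrt q : ℂ) := by
    rw [Real.sqrt_eq_rpow, Complex.ofReal_cpow hq.le]
    push_cast
    rfl
  have hs : (Real.sqrt q : ℂ) ≠ 0 := by exact_mod_cast (Real.sqrt_pos.2 hq).ne'
  rw [DirichletCharacter.rootNumber, h3, if_neg hodd.not_even, hpow, pow_one]
  field_simp

lemma MulChar.IsQuadratic.exists_real {q : ℕ} {χ : DirichletCharacter ℂ q} (hχ : χ.IsQuadratic)
    (x : ZMod q) : ∃ r : ℝ, χ x = (r : ℂ) ∧ -1 ≤ r ∧ r ≤ 1 := by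
  rcases hχ x with h | h | h
  · exact ⟨0, by simp [h], by norm_num, by norm_num⟩
  · exact ⟨1, by simp [h], by norm_num, by norm_num⟩
  · exact ⟨-1, by simp [h], by norm_num, by norm_num⟩

lemma prime_rpow_neg_lt_one {p : ℕ} (hp : p.Prime) {u : ℝ} (hu : 1 < u) :
    (p : ℝ) ^ (-u) < 1 :=
  Real.rpow_lt_one_of_one_lt_of_neg (by exact_mod_cast hp.one_lt) (by linarith)

lemma riemannZeta_ofReal_eq_tsum {u : ℝ} (hu : 1 < u) :
    riemannZeta u = ((∑' n : ℕ, 1 / (n : ℝ) ^ u : ℝ) : ℂ) := by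
  rw [zeta_eq_tsum_one_div_nat_cpow (by simpa using hu), Complex.ofReal_tsum]
  refine tsum_congr fun n => ?_
  rw [Complex.ofReal_div, Complex.ofReal_cpow (Nat.cast_nonneg n)]
  simp

lemma tendsto_prod_primesBelow_zeta {u : ℝ} (hu : 1 < u) :
    Filter.Tendsto (fun n : ℕ => ∏ p ∈ n.primesBelow, (1 - (p : ℝ) ^ (-u))⁻¹) Filter.atTop
      (nhds (∑' n : ℕ, 1 / (n : ℝ) ^ u)) := by
  have h := riemannZeta_eulerProduct (s := u) (by simpa using hu)
  rw [riemannZeta_ofReal_eq_tsum hu] at h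
  have h2 := (Complex.continuous_re.tendsto _).comp h
  rw [Complex.ofReal_re] at h2
  refine h2.congr fun n => ?_
  have : ∏ p ∈ n.primesBelow, (1 - (p : ℂ) ^ (-(u : ℂ)))⁻¹ =
      ((∏ p ∈ n.primesBelow, (1 - (p : ℝ) ^ (-u))⁻¹ : ℝ) : ℂ) := by
    rw [Complex.ofReal_prod]
    refine Finset.prod_congr rfl fun p _ => ?_
    rw [Complex.ofReal_inv, Complex.ofReal_sub, Complex.ofReal_cpow (Nat.cast_nonneg p)]
    simp
  rw [Function.comp_apply, this, Complex.ofReal_re]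

/-- Euler product of a real character at a real point. -/
lemma exists_tendsto_prod_primesBelow {q : ℕ} [NeZero q] {χ : DirichletCharacter ℂ q}
    (hχ : χ.IsQuadratic) :
    ∃ r : ℕ → ℝ, (∀ n, -1 ≤ r n ∧ r n ≤ 1) ∧ ∀ u : ℝ, 1 < u →
      DirichletCharacter.LFunction χ u = (((DirichletCharacter.LFunction χ u).re : ℝ) : ℂ) ∧
      Filter.Tendsto (fun n : ℕ => ∏ p ∈ n.primesBelow, (1 - r p * (p : ℝ) ^ (-u))⁻¹) Filter.atTop
        (nhds (DirichletCharacter.LFunction χ u).re) := by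
  choose r hr1 hr2 hr3 using fun n : ℕ => hχ.exists_real (n : ZMod q)
  refine ⟨r, fun n => ⟨hr2 n, hr3 n⟩, fun u hu => ?_⟩
  have hu' : 1 < (u : ℂ).re := by simpa using hu
  have h := DirichletCharacter.LSeries_eulerProduct χ hu'
  rw [← DirichletCharacter.LFunction_eq_LSeries χ hu'] at h
  have hprod : ∀ n : ℕ, ∏ p ∈ n.primesBelow, (1 - χ p * (p : ℂ) ^ (-(u : ℂ)))⁻¹ =
      ((∏ p ∈ n.primesBelow, (1 - r p * (p : ℝ) ^ (-u))⁻¹ : ℝ) : ℂ) := by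
    intro n
    rw [Complex.ofReal_prod]
    refine Finset.prod_congr rfl fun p _ => ?_
    rw [Complex.ofReal_inv, Complex.ofReal_sub, Complex.ofReal_mul,
      Complex.ofReal_cpow (Nat.cast_nonneg p), hr1]
    simp
  simp_rw [hprod] at h
  have h2 := (Complex.continuous_re.tendsto _).comp h
  have h3 := (Complex.continuous_im.tendsto _).comp h
  simp only [Function.comp_def, Complex.ofReal_re, Complex.ofReal_im] at h2 h3
  refine ⟨?_, h2⟩
  apply Complex.ext
  · simp
  · rw [Complex.ofReal_im]
    exact tendsto_nhds_unique h3 tendsto_const_nhds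

lemma LFunction_re_pos {q : ℕ} [NeZero q] {χ : DirichletCharacter ℂ q}
    (hχ : χ.IsQuadratic) {u : ℝ} (hu : 1 < u) : 0 < (DirichletCharacter.LFunction χ u).re := by
  obtain ⟨r, hr, h⟩ := exists_tendsto_prod_primesBelow hχ
  obtain ⟨h1, h2⟩ := h u hu
  have hne := DirichletCharacter.LFunction_ne_zero_of_one_le_re χ (s := u)
    (Or.inr (by exact_mod_cast hu.ne')) (by simpa using hu.le)
  refine lt_of_le_of_ne (ge_of_tendsto' h2 fun n => ?_) fun h0 => hne ?_
  · refine Finset.prod_nonneg fun p hp => inv_nonneg.2 ?_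
    have hlt := prime_rpow_neg_lt_one (Nat.prime_of_mem_primesBelow hp) hu
    have hpos : 0 ≤ (p : ℝ) ^ (-u) := by positivity
    nlinarith [hr p]
  · rw [h1, ← h0, Complex.ofReal_zero]

/-- The quotient of the `L`-function of a real character by `ζ` is monotone on `(1, ∞)`. -/
lemma LFunction_re_mul_zeta_le {q : ℕ} [NeZero q] {χ : DirichletCharacter ℂ q}
    (hχ : χ.IsQuadratic) {a b : ℝ} (ha : 1 < a) (hab : a < b) :
    (DirichletCharacter.LFunction χ a).re * ∑' n : ℕ, 1 / (n : ℝ) ^ b ≤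
      (DirichletCharacter.LFunction χ b).re * ∑' n : ℕ, 1 / (n : ℝ) ^ a := by
  obtain ⟨r, hr, h⟩ := exists_tendsto_prod_primesBelow hχ
  have hb : 1 < b := ha.trans hab
  refine le_of_tendsto_of_tendsto' ((h a ha).2.mul (tendsto_prod_primesBelow_zeta hb))
    ((h b hb).2.mul (tendsto_prod_primesBelow_zeta ha)) fun n => ?_
  rw [← Finset.prod_mul_distrib, ← Finset.prod_mul_distrib]
  have hx : ∀ p ∈ n.primesBelow, (p : ℝ) ^ (-a) < 1 := fun p hp =>
    prime_rpow_neg_lt_one (Nat.prime_of_mem_primesBelow hp) ha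
  have hxy : ∀ p ∈ n.primesBelow, (p : ℝ) ^ (-b) ≤ (p : ℝ) ^ (-a) := fun p hp =>
    Real.rpow_le_rpow_of_exponent_le
      (by exact_mod_cast (Nat.prime_of_mem_primesBelow hp).one_le) (by linarith)
  refine Finset.prod_le_prod (fun p hp => ?_) fun p hp => ?_
  all_goals
    have h1 := hx p hp
    have h2 := hxy p hp
    have h3 : 0 ≤ (p : ℝ) ^ (-b) := by positivity
    have h4 := hr p
    generalize (p : ℝ) ^ (-a) = x at *
    generalize (p : ℝ) ^ (-b) = y at *
    generalize r p = t at *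
    have h5 : 0 < 1 - t * x := by nlinarith
  · exact mul_nonneg (inv_nonneg.2 h5.le) (inv_nonneg.2 (by linarith))
  · have h6 : 0 < 1 - t * y := by nlinarith
    rw [← mul_inv, ← mul_inv]
    refine inv_anti₀ (mul_pos h6 (by linarith)) ?_
    nlinarith [mul_nonneg (sub_nonneg.2 h2) (sub_nonneg.2 h4.2)]

lemma one_le_tsum_one_div_rpow {u : ℝ} (hu : 1 < u) : 1 ≤ ∑' n : ℕ, 1 / (n : ℝ) ^ u := by
  have h := (Real.summable_one_div_nat_rpow.2 hu).le_tsum 1 fun n _ => by positivity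
  simpa using h

/-- The function `(u - 2) ζ(u)` is strictly increasing on `(2, ∞)`. -/
lemma sub_two_mul_zeta_lt {a b : ℝ} (ha : 2 < a) (hab : a < b) :
    (a - 2) * ∑' n : ℕ, 1 / (n : ℝ) ^ a < (b - 2) * ∑' n : ℕ, 1 / (n : ℝ) ^ b := by
  have sa := Real.summable_one_div_nat_rpow.2 (show 1 < a by linarith)
  have sb := Real.summable_one_div_nat_rpow.2 (show 1 < b by linarith)
  have hsum : HasSum (fun n : ℕ => 1 / (n : ℝ) ^ 2 - if n = 1 then 1 else 0)
      (Real.pi ^ 2 / 6 - 1) := hasSum_zeta_two.sub (hasSum_ite_eq 1 1)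
  have hterm : ∀ n : ℕ, (a - 2) * (1 / (n : ℝ) ^ a - 1 / (n : ℝ) ^ b) ≤
      (b - a) * (1 / (n : ℝ) ^ 2 - if n = 1 then 1 else 0) := by
    intro n
    rcases Nat.eq_zero_or_pos n with rfl | hn
    · have h1 : a ≠ 0 := by linarith
      have h2 : b ≠ 0 := by linarith
      simp [Real.zero_rpow h1, Real.zero_rpow h2]
    rcases Nat.eq_or_lt_of_le hn with rfl | hn1
    · simp
    rw [if_neg (by omega), sub_zero]
    have hn0 : (0 : ℝ) < n := by exact_mod_cast hn
    have hlog := Real.log_le_rpow_div hn0.le (show 0 < a - 2 by linarith)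
    rw [le_div_iff₀ (by linarith)] at hlog
    have e1 : 1 / (n : ℝ) ^ b = 1 / (n : ℝ) ^ a * (n : ℝ) ^ (-(b - a)) := by
      rw [one_div, one_div, ← Real.rpow_neg hn0.le, ← Real.rpow_neg hn0.le, ← Real.rpow_add hn0]
      congr 1
      ring
    have e2 : 1 - (b - a) * Real.log n ≤ (n : ℝ) ^ (-(b - a)) := by
      rw [Real.rpow_def_of_pos hn0]
      have := Real.add_one_le_exp (Real.log n * -(b - a))
      linarith
    have e3 : 1 / (n : ℝ) ^ a * (n : ℝ) ^ (a - 2) = 1 / (n : ℝ) ^ 2 := by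
      rw [one_div, one_div, ← Real.rpow_neg hn0.le, ← Real.rpow_add hn0, ← Real.rpow_natCast,
        ← Real.rpow_neg hn0.le]
      congr 1
      push_cast
      ring
    have hA : 0 ≤ 1 / (n : ℝ) ^ a := by positivity
    rw [e1, ← e3]
    calc (a - 2) * (1 / (n : ℝ) ^ a - 1 / (n : ℝ) ^ a * (n : ℝ) ^ (-(b - a)))
        = (a - 2) * (1 / (n : ℝ) ^ a * (1 - (n : ℝ) ^ (-(b - a)))) := by ring
      _ ≤ (a - 2) * (1 / (n : ℝ) ^ a * ((b - a) * Real.log n)) := by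
        refine mul_le_mul_of_nonneg_left (mul_le_mul_of_nonneg_left ?_ hA) (by linarith)
        linarith
      _ = (b - a) * (1 / (n : ℝ) ^ a * (Real.log n * (a - 2))) := by ring
      _ ≤ (b - a) * (1 / (n : ℝ) ^ a * (n : ℝ) ^ (a - 2)) := by
        refine mul_le_mul_of_nonneg_left (mul_le_mul_of_nonneg_left hlog hA) (by linarith)
  have h1 := ((sa.hasSum.sub sb.hasSum).mul_left (a - 2))
  have h2 := hasSum_le hterm h1 (hsum.mul_left (b - a))
  have h3 := one_le_tsum_one_div_rpow (show 1 < b by linarith)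
  have hpi : Real.pi ^ 2 < 12 := by nlinarith [Real.pi_lt_d2, Real.pi_pos]
  nlinarith

lemma rpow_mul_Gamma_le {c : ℝ} (hc : 1 < c * (3 / 2)) {a b : ℝ} (ha : 2 < a) (hab : a < b) :
    c ^ ((a - 2) / 2) * Real.Gamma ((a + 3) / 2) ≤
      c ^ ((b - 2) / 2) * Real.Gamma ((b + 3) / 2) := by
  have hc0 : 0 < c := by linarith
  have hga : 0 < Real.Gamma ((a + 3) / 2) := Real.Gamma_pos_of_pos (by linarith)
  have hgb : 0 < Real.Gamma ((b + 3) / 2) := Real.Gamma_pos_of_pos (by linarith)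
  have hg1 : 0 < Real.Gamma ((a + 1) / 2) := Real.Gamma_pos_of_pos (by linarith)
  have hslope := Real.convexOn_log_Gamma.slope_mono_adjacent (x := (a + 1) / 2)
    (y := (a + 3) / 2) (z := (b + 3) / 2) (Set.mem_Ioi.2 (by linarith))
    (Set.mem_Ioi.2 (by linarith)) (by linarith) (by linarith)
  simp only [Function.comp_apply] at hslope
  have hrec : Real.log (Real.Gamma ((a + 3) / 2)) =
      Real.log ((a + 1) / 2) + Real.log (Real.Gamma ((a + 1) / 2)) := by
    rw [← Real.log_mul (by linarith) hg1.ne', ← Real.Gamma_add_one (by linarith)]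
    congr 2
    ring
  have hlog : Real.log (3 / 2) ≤ Real.log ((a + 1) / 2) :=
    Real.log_le_log (by norm_num) (by linarith)
  have hlogc : 0 < Real.log c + Real.log (3 / 2) := by
    rw [← Real.log_mul hc0.ne' (by norm_num)]
    exact Real.log_pos hc
  have e1 : (Real.log (Real.Gamma ((a + 3) / 2)) - Real.log (Real.Gamma ((a + 1) / 2))) /
      ((a + 3) / 2 - (a + 1) / 2) = Real.log ((a + 1) / 2) := by
    rw [hrec]
    ring
  rw [e1, le_div_iff₀ (by linarith)] at hslope
  rw [← Real.log_le_log_iff (by positivity) (by positivity),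
    Real.log_mul (by positivity) hga.ne', Real.log_mul (by positivity) hgb.ne',
    Real.log_rpow hc0, Real.log_rpow hc0]
  nlinarith

/-- Strict monotonicity on `(2, ∞)` of the function describing the second-order term. -/
lemma secondary_term_lt {q : ℕ} [NeZero q] {χ : DirichletCharacter ℂ q} (hq : 3 ≤ q)
    (hχ : χ.IsQuadratic) {a b : ℝ} (ha : 2 < a) (hab : a < b) :
    a * (a - 2) * (q / Real.pi) ^ ((a - 2) / 2) * Real.Gamma ((a + 1) / 2) *
        (DirichletCharacter.LFunction χ a).re <
      b * (b - 2) * (q / Real.pi) ^ ((b - 2) / 2) * Real.Gamma ((b + 1) / 2) *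
        (DirichletCharacter.LFunction χ b).re := by
  have hq' : (3 : ℝ) ≤ q := by exact_mod_cast hq
  have hc : 1 < (q / Real.pi) * (3 / 2 : ℝ) := by
    rw [div_mul_eq_mul_div, lt_div_iff₀ Real.pi_pos]
    nlinarith [Real.pi_lt_d2]
  have h1 := rpow_mul_Gamma_le hc ha hab
  have h2 := sub_two_mul_zeta_lt ha hab
  have h3 := LFunction_re_mul_zeta_le hχ (show 1 < a by linarith) hab
  have hLa := LFunction_re_pos hχ (show 1 < a by linarith)
  have hLb := LFunction_re_pos hχ (show 1 < b by linarith)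
  have hza := one_le_tsum_one_div_rpow (show 1 < a by linarith)
  have hzb := one_le_tsum_one_div_rpow (show 1 < b by linarith)
  have hrec : ∀ x : ℝ, 2 < x → Real.Gamma ((x + 1) / 2) =
      2 / (x + 1) * Real.Gamma ((x + 3) / 2) := by
    intro x hx
    have : (x + 3) / 2 = (x + 1) / 2 + 1 := by ring
    rw [this, Real.Gamma_add_one (by linarith)]
    have : x + 1 ≠ 0 := by linarith
    field_simp
  rw [hrec a ha, hrec b (by linarith)]
  have hga : 0 < (q / Real.pi) ^ ((a - 2) / 2) * Real.Gamma ((a + 3) / 2) := by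
    have : 0 < Real.Gamma ((a + 3) / 2) := Real.Gamma_pos_of_pos (by linarith)
    positivity
  set ga := (q / Real.pi) ^ ((a - 2) / 2) * Real.Gamma ((a + 3) / 2)
  set gb := (q / Real.pi) ^ ((b - 2) / 2) * Real.Gamma ((b + 3) / 2)
  set La := (DirichletCharacter.LFunction χ a).re
  set Lb := (DirichletCharacter.LFunction χ b).re
  set za := ∑' n : ℕ, 1 / (n : ℝ) ^ a
  set zb := ∑' n : ℕ, 1 / (n : ℝ) ^ b
  have hfrac : a / (a + 1) < b / (b + 1) := by
    rw [div_lt_div_iff₀ (by linarith) (by linarith)]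
    linarith
  have hquot : La / za ≤ Lb / zb := by
    rw [div_le_div_iff₀ (by linarith) (by linarith)]
    exact h3
  have hza0 : za ≠ 0 := by linarith
  have hzb0 : zb ≠ 0 := by linarith
  have hA : a * (a - 2) * (q / Real.pi) ^ ((a - 2) / 2) *
      (2 / (a + 1) * Real.Gamma ((a + 3) / 2)) * La =
      2 * (a / (a + 1)) * ((a - 2) * za) * (La / za) * ga := by
    simp only [ga]
    field_simp
  have hB : b * (b - 2) * (q / Real.pi) ^ ((b - 2) / 2) *
      (2 / (b + 1) * Real.Gamma ((b + 3) / 2)) * Lb =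
      2 * (b / (b + 1)) * ((b - 2) * zb) * (Lb / zb) * gb := by
    simp only [gb]
    field_simp
  rw [hA, hB]
  have hp : 0 < (a - 2) * za := mul_pos (by linarith) (by linarith)
  have hq2 : 0 < La / za := div_pos hLa (by linarith)
  have hfa : 0 < a / (a + 1) := div_pos (by linarith) (by linarith)
  have hfa2 : 2 * (a / (a + 1)) < 2 * (b / (b + 1)) := by linarith
  have hgb : 0 < gb := hga.trans_le h1
  have s1 := mul_lt_mul'' hfa2 h2 (by linarith) hp.le
  have s0 : 0 ≤ 2 * (b / (b + 1)) * ((b - 2) * zb) :=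
    (lt_of_le_of_lt (mul_nonneg (by linarith) hp.le) s1).le
  have s2 := mul_lt_mul s1 hquot hq2 s0
  exact mul_lt_mul s2 h1 hga (mul_nonneg s0 (hq2.le.trans hquot))

/-- Every function with zero sum on `ZMod q` is the difference of a function with zero sum. -/
lemma exists_sub_eq_of_sum_eq_zero {q : ℕ} [NeZero q] (f : ZMod q → ℂ) (hf : ∑ x, f x = 0) :
    ∃ g : ZMod q → ℂ, (∑ x, g x = 0) ∧ ∀ x, g (x + 1) - g x = f x := by
  let T : (ZMod q → ℂ) →ₗ[ℂ] ℂ := ∑ x, LinearMap.proj x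
  have hT : ∀ g, T g = ∑ x, g x := fun g => by simp [T]
  let E : (ZMod q → ℂ) →ₗ[ℂ] (ZMod q → ℂ) :=
    LinearMap.funLeft ℂ ℂ (fun x : ZMod q => x + 1) - LinearMap.id
  have hE : ∀ g x, E g x = g (x + 1) - g x := fun g x => by simp [E, LinearMap.funLeft_apply]
  have hmap : ∀ g ∈ LinearMap.ker T, E g ∈ LinearMap.ker T := by
    intro g _
    rw [LinearMap.mem_ker, hT]
    simp only [hE, Finset.sum_sub_distrib]
    rw [sub_eq_zero]
    exact Equiv.sum_comp (Equiv.addRight (1 : ZMod q)) g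
  have hinj : Function.Injective (E.restrict hmap) := by
    rw [← LinearMap.ker_eq_bot, LinearMap.ker_eq_bot']
    rintro ⟨g, hg⟩ h
    have h1 : ∀ x, g (x + 1) = g x := by
      intro x
      have := congrFun (congrArg Subtype.val h) x
      rw [LinearMap.coe_restrict_apply, hE] at this
      exact sub_eq_zero.mp this
    have h2 : ∀ n : ℕ, g (n : ZMod q) = g 0 := by
      intro n
      induction n with
      | zero => simp
      | succ k ih => rw [Nat.cast_succ, h1, ih]
    have h3 : ∀ x, g x = g 0 := fun x => by
      rw [← ZMod.natCast_zmod_val x]; exact h2 _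
    rw [LinearMap.mem_ker, hT] at hg
    simp only [h3, Finset.sum_const, Finset.card_univ, ZMod.card, nsmul_eq_mul] at hg
    have h0 : g 0 = 0 := (mul_eq_zero.mp hg).resolve_left (Nat.cast_ne_zero.mpr (NeZero.ne q))
    ext x
    simp [h3 x, h0]
  obtain ⟨⟨g, hg⟩, hgf⟩ :=
    LinearMap.injective_iff_surjective.mp hinj ⟨f, by rw [LinearMap.mem_ker, hT, hf]⟩
  refine ⟨g, by rw [← hT]; exact hg, fun x => ?_⟩
  have := congrFun (congrArg Subtype.val hgf) x
  rwa [LinearMap.coe_restrict_apply, hE] at this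

lemma exists_third_difference_eq {q : ℕ} [NeZero q] (f : ZMod q → ℂ) (hf : ∑ x, f x = 0) :
    ∃ A : ZMod q → ℂ, ∀ x, A (x + 3) - 3 * A (x + 2) + 3 * A (x + 1) - A x = f x := by
  obtain ⟨g, hg, hgf⟩ := exists_sub_eq_of_sum_eq_zero f hf
  obtain ⟨h, hh, hhg⟩ := exists_sub_eq_of_sum_eq_zero g hg
  obtain ⟨A, -, hA⟩ := exists_sub_eq_of_sum_eq_zero h hh
  refine ⟨A, fun x => ?_⟩
  rw [← hgf, ← hhg, ← hhg, ← hA, ← hA, ← hA]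
  have e2 : x + 1 + 1 = x + 2 := by ring
  have e3 : x + 2 + 1 = x + 3 := by ring
  rw [e2, e3]
  ring

/-- The third forward difference of a function on the integers. -/
def thirdDiff (F : ℤ → ℂ) (j : ℤ) : ℂ := F (j + 3) - 3 * F (j + 2) + 3 * F (j + 1) - F j

lemma thirdDiff_reflect {F : ℤ → ℂ} (hF : ∀ j, F (-j) = -F j) (j : ℤ) :
    thirdDiff F (-j - 3) = thirdDiff F j := by
  have e0 : -j - 3 + 3 = -j := by ring
  have e1 : -j - 3 + 2 = -(j + 1) := by ring
  have e2 : -j - 3 + 1 = -(j + 2) := by ring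
  have e3 : -j - 3 = -(j + 3) := by ring
  simp only [thirdDiff, e0, e1, e2]
  rw [e3]
  simp only [hF]
  ring

lemma sum_Ico_add_period {N : ℤ} (hN : 0 ≤ N) {h : ℤ → ℂ} (hh : ∀ j, h (j + N) = h j) (a : ℤ) :
    ∑ j ∈ Finset.Ico a (a + N), h j = ∑ j ∈ Finset.Ico 0 N, h j := by
  have step : ∀ a : ℤ, ∑ j ∈ Finset.Ico (a + 1) (a + 1 + N), h j =
      ∑ j ∈ Finset.Ico a (a + N), h j := by
    intro a
    rcases hN.eq_or_lt with rfl | hN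
    · simp
    · have h1 : Finset.Ico a (a + N) = insert a (Finset.Ico (a + 1) (a + N)) := by
        ext x; simp; omega
      have h2 : Finset.Ico (a + 1) (a + 1 + N) = insert (a + N) (Finset.Ico (a + 1) (a + N)) := by
        ext x; simp; omega
      rw [h1, h2, Finset.sum_insert (by simp), Finset.sum_insert (by simp), hh]
  induction a using Int.induction_on with
  | zero => simp
  | succ i ih => rw [step, ih]
  | pred i ih => rw [← step, sub_add_cancel, ih]

/-- Cyclic summation by parts. -/
lemma sum_Ico_thirdDiff_mul {N : ℤ} (hN : 0 ≤ N) {A F : ℤ → ℂ} (hA : ∀ j, A (j + N) = A j)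
    (hF : ∀ j, F (j + N) = F j) (a : ℤ) :
    ∑ j ∈ Finset.Ico 0 N, thirdDiff A j * F j =
      -∑ j ∈ Finset.Ico a (a + N), A (j + 3) * thirdDiff F j := by
  have key : ∀ k : ℤ, ∑ j ∈ Finset.Ico 0 N, A (j + k) * F j =
      ∑ j ∈ Finset.Ico a (a + N), A (j + 3) * F (j + (3 - k)) := by
    intro k
    have hp : ∀ j, A (j + N + k) * F (j + N) = A (j + k) * F j := fun j => by
      rw [hF, show j + N + k = j + k + N by ring, hA]
    rw [← sum_Ico_add_period hN (h := fun j => A (j + k) * F j) hp (a + (3 - k)),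
      show a + (3 - k) + N = (a + N) + (3 - k) by ring, ← Finset.map_add_right_Ico,
      Finset.sum_map]
    refine Finset.sum_congr rfl fun j _ => ?_
    simp only [addRightEmbedding_apply]
    rw [show j + (3 - k) + k = j + 3 by ring]
  have k0 := key 0
  have k1 := key 1
  have k2 := key 2
  have k3 := key 3
  norm_num at k0 k1 k2 k3
  have e1 : ∀ j, thirdDiff A j * F j =
      A (j + 3) * F j - 3 * (A (j + 2) * F j) + 3 * (A (j + 1) * F j) - A j * F j :=
    fun j => by simp only [thirdDiff]; ring
  have e2 : ∀ j, A (j + 3) * thirdDiff F j =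
      A (j + 3) * F (j + 3) - 3 * (A (j + 3) * F (j + 2)) + 3 * (A (j + 3) * F (j + 1)) -
        A (j + 3) * F j :=
    fun j => by simp only [thirdDiff]; ring
  simp only [e1, e2, Finset.sum_add_distrib, Finset.sum_sub_distrib, ← Finset.mul_sum]
  rw [k0, k1, k2, k3]
  ring

/-- Summation by parts over the integers. -/
lemma tsum_thirdDiff_mul {A F : ℤ → ℂ} {M : ℝ} (hA : ∀ j, ‖A j‖ ≤ M) (hF : Summable F) :
    ∑' j, thirdDiff A j * F j = -∑' j, A (j + 3) * thirdDiff F j := by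
  have hs : ∀ k l : ℤ, Summable fun j => A (j + k) * F (j + l) := by
    intro k l
    have h1 : Summable fun j => F (j + l) := (Equiv.addRight l).summable_iff.mpr hF
    exact (h1.norm.mul_left M).of_norm_bounded fun j => by
      rw [norm_mul]
      exact mul_le_mul_of_nonneg_right (hA _) (norm_nonneg _)
  have key : ∀ k : ℤ, ∑' j, A (j + k) * F j = ∑' j, A (j + 3) * F (j + (3 - k)) := by
    intro k
    rw [← (Equiv.addRight (3 - k)).tsum_eq (fun j => A (j + k) * F j)]
    refine tsum_congr fun j => ?_
    simp only [Equiv.coe_addRight]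
    rw [show j + (3 - k) + k = j + 3 by ring]
  have k0 := key 0
  have k1 := key 1
  have k2 := key 2
  norm_num at k0 k1 k2
  have e1 : ∀ j, thirdDiff A j * F j =
      A (j + 3) * F j - 3 * (A (j + 2) * F j) + 3 * (A (j + 1) * F j) - A j * F j :=
    fun j => by simp only [thirdDiff]; ring
  have e2 : ∀ j, A (j + 3) * thirdDiff F j =
      A (j + 3) * F (j + 3) - 3 * (A (j + 3) * F (j + 2)) + 3 * (A (j + 3) * F (j + 1)) -
        A (j + 3) * F j :=
    fun j => by simp only [thirdDiff]; ring
  have s30 : Summable fun j => A (j + 3) * F j := by simpa using hs 3 0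
  have s20 : Summable fun j => A (j + 2) * F j := by simpa using hs 2 0
  have s10 : Summable fun j => A (j + 1) * F j := by simpa using hs 1 0
  have s00 : Summable fun j => A j * F j := by simpa using hs 0 0
  simp only [e1, e2]
  rw [Summable.tsum_sub ((s30.sub (s20.mul_left 3)).add (s10.mul_left 3)) s00,
    Summable.tsum_add (s30.sub (s20.mul_left 3)) (s10.mul_left 3),
    Summable.tsum_sub s30 (s20.mul_left 3),
    Summable.tsum_sub (((hs 3 3).sub ((hs 3 2).mul_left 3)).add ((hs 3 1).mul_left 3)) s30,
    Summable.tsum_add ((hs 3 3).sub ((hs 3 2).mul_left 3)) ((hs 3 1).mul_left 3),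
    Summable.tsum_sub (hs 3 3) ((hs 3 2).mul_left 3)]
  simp only [tsum_mul_left]
  rw [k0, k1, k2]
  ring

lemma norm_thirdDifference_le {φ₀ φ₁ φ₂ φ₃ : ℝ → ℂ} {a h C : ℝ} (hh : 0 ≤ h)
    (h₀ : ∀ x ∈ Set.Icc a (a + 3 * h), HasDerivAt φ₀ (φ₁ x) x)
    (h₁ : ∀ x ∈ Set.Icc a (a + 3 * h), HasDerivAt φ₁ (φ₂ x) x)
    (h₂ : ∀ x ∈ Set.Icc a (a + 3 * h), HasDerivAt φ₂ (φ₃ x) x)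
    (hC : ∀ x ∈ Set.Icc a (a + 3 * h), ‖φ₃ x‖ ≤ C) :
    ‖φ₀ (a + 3 * h) - 3 * φ₀ (a + 2 * h) + 3 * φ₀ (a + h) - φ₀ a‖ ≤ C * h ^ 3 := by
  have mvt : ∀ {f f' : ℝ → ℂ} {b K : ℝ}, (∀ x ∈ Set.Icc b (b + h), HasDerivAt f (f' x) x) →
      (∀ x ∈ Set.Icc b (b + h), ‖f' x‖ ≤ K) → ‖f (b + h) - f b‖ ≤ K * h := by
    intro f f' b K hd hK
    have := norm_image_sub_le_of_norm_deriv_le_segment' (f := f) (f' := f') (a := b) (b := b + h)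
      (C := K) (fun x hx => (hd x hx).hasDerivWithinAt)
      (fun x hx => hK x (Set.Ico_subset_Icc_self hx)) (b + h) (by simp [hh])
    simpa using this
  have sh : ∀ {f f' : ℝ → ℂ} {x : ℝ}, HasDerivAt f (f' x) x → HasDerivAt f (f' (x + h)) (x + h) →
      HasDerivAt (fun y => f (y + h) - f y) (f' (x + h) - f' x) x := by
    intro f f' x hd hd'
    exact (hd'.comp_add_const x h).sub hd
  have b2 : ∀ x ∈ Set.Icc a (a + 2 * h), ‖φ₂ (x + h) - φ₂ x‖ ≤ C * h := fun x hx =>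
    mvt (f := φ₂) (f' := φ₃)
      (fun y hy => h₂ y ⟨by linarith [hx.1, hy.1], by linarith [hx.2, hy.2]⟩)
      (fun y hy => hC y ⟨by linarith [hx.1, hy.1], by linarith [hx.2, hy.2]⟩)
  have b1 : ∀ x ∈ Set.Icc a (a + h),
      ‖(φ₁ (x + h + h) - φ₁ (x + h)) - (φ₁ (x + h) - φ₁ x)‖ ≤ C * h * h := fun x hx =>
    mvt (f := fun y => φ₁ (y + h) - φ₁ y) (f' := fun y => φ₂ (y + h) - φ₂ y)
      (fun y hy => sh (h₁ y ⟨by linarith [hx.1, hy.1], by linarith [hx.2, hy.2]⟩)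
        (h₁ (y + h) ⟨by linarith [hx.1, hy.1], by linarith [hx.2, hy.2]⟩))
      (fun y hy => b2 y ⟨by linarith [hx.1, hy.1], by linarith [hx.2, hy.2]⟩)
  have b0 : ‖((φ₀ (a + h + h + h) - φ₀ (a + h + h)) - (φ₀ (a + h + h) - φ₀ (a + h))) -
      ((φ₀ (a + h + h) - φ₀ (a + h)) - (φ₀ (a + h) - φ₀ a))‖ ≤ C * h * h * h :=
    mvt (f := fun y => (φ₀ (y + h + h) - φ₀ (y + h)) - (φ₀ (y + h) - φ₀ y))
      (f' := fun y => (φ₁ (y + h + h) - φ₁ (y + h)) - (φ₁ (y + h) - φ₁ y))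
      (fun y hy => sh (f := fun y => φ₀ (y + h) - φ₀ y) (f' := fun y => φ₁ (y + h) - φ₁ y)
        (sh (h₀ y ⟨by linarith [hy.1], by linarith [hy.2]⟩)
          (h₀ (y + h) ⟨by linarith [hy.1], by linarith [hy.2]⟩))
        (sh (h₀ (y + h) ⟨by linarith [hy.1], by linarith [hy.2]⟩)
          (h₀ (y + h + h) ⟨by linarith [hy.1], by linarith [hy.2]⟩)))
      b1
  have e2 : a + 2 * h = a + h + h := by ring
  have e3 : a + 3 * h = a + h + h + h := by ring
  rw [e2, e3]
  convert b0 using 1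
  · congr 1; ring
  · ring

/-- Third difference bound for a power times a smooth function. -/
lemma norm_thirdDifference_cpow_mul_le {p : ℂ} {U₀ U₁ U₂ U₃ : ℝ → ℂ} {a h C : ℝ} (ha : 0 < a)
    (hh : 0 ≤ h)
    (h₀ : ∀ x ∈ Set.Icc a (a + 3 * h), HasDerivAt U₀ (U₁ x) x)
    (h₁ : ∀ x ∈ Set.Icc a (a + 3 * h), HasDerivAt U₁ (U₂ x) x)
    (h₂ : ∀ x ∈ Set.Icc a (a + 3 * h), HasDerivAt U₂ (U₃ x) x)
    (hC : ∀ x ∈ Set.Icc a (a + 3 * h),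
      ‖p * (p - 1) * (p - 2)‖ * ‖U₀ x‖ * x ^ (p.re - 3) +
      ‖3 * p * (p - 1)‖ * ‖U₁ x‖ * x ^ (p.re - 2) + ‖3 * p‖ * ‖U₂ x‖ * x ^ (p.re - 1) +
      ‖U₃ x‖ * x ^ p.re ≤ C) :
    ‖((a + 3 * h : ℝ) : ℂ) ^ p * U₀ (a + 3 * h) - 3 * (((a + 2 * h : ℝ) : ℂ) ^ p * U₀ (a + 2 * h))
      + 3 * (((a + h : ℝ) : ℂ) ^ p * U₀ (a + h)) - (a : ℂ) ^ p * U₀ a‖ ≤ C * h ^ 3 := by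
  have hpow : ∀ r : ℂ, ∀ x : ℝ, 0 < x →
      HasDerivAt (fun y : ℝ => (y : ℂ) ^ r) (r * (x : ℂ) ^ (r - 1)) x := by
    intro r x hx
    have := (hasDerivAt_id (x : ℂ)).cpow_const (c := r) (Or.inl (by simpa using hx))
    simpa using this.comp_ofReal
  refine norm_thirdDifference_le (φ₀ := fun x : ℝ => (x : ℂ) ^ p * U₀ x)
    (φ₁ := fun x => p * (x : ℂ) ^ (p - 1) * U₀ x + (x : ℂ) ^ p * U₁ x)
    (φ₂ := fun x => p * (p - 1) * (x : ℂ) ^ (p - 2) * U₀ x + 2 * p * (x : ℂ) ^ (p - 1) * U₁ x +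
      (x : ℂ) ^ p * U₂ x)
    (φ₃ := fun x => p * (p - 1) * (p - 2) * (x : ℂ) ^ (p - 3) * U₀ x +
      3 * p * (p - 1) * (x : ℂ) ^ (p - 2) * U₁ x + 3 * p * (x : ℂ) ^ (p - 1) * U₂ x +
      (x : ℂ) ^ p * U₃ x) hh ?_ ?_ ?_ ?_
  · intro x hx
    exact (hpow p x (ha.trans_le hx.1)).mul (h₀ x hx)
  · intro x hx
    have hx0 := ha.trans_le hx.1
    have d1 := hpow (p - 1) x hx0
    rw [show p - 1 - 1 = p - 2 by ring] at d1
    refine (((d1.const_mul p).mul (h₀ x hx)).add ((hpow p x hx0).mul (h₁ x hx))).congr_deriv ?_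
    ring
  · intro x hx
    have hx0 := ha.trans_le hx.1
    have d1 := hpow (p - 1) x hx0
    have d2 := hpow (p - 2) x hx0
    rw [show p - 1 - 1 = p - 2 by ring] at d1
    rw [show p - 2 - 1 = p - 3 by ring] at d2
    refine ((((d2.const_mul (p * (p - 1))).mul (h₀ x hx)).add
      ((d1.const_mul (2 * p)).mul (h₁ x hx))).add
        ((hpow p x hx0).mul (h₂ x hx))).congr_deriv ?_
    ring
  · intro x hx
    have hx0 := ha.trans_le hx.1
    refine le_trans ?_ (hC x hx)
    refine (norm_add_le _ _).trans (add_le_add ((norm_add_le _ _).trans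
      (add_le_add ((norm_add_le _ _).trans (add_le_add ?_ ?_)) ?_)) ?_)
    · rw [norm_mul, norm_mul, Complex.norm_cpow_eq_rpow_re_of_pos hx0]
      apply le_of_eq
      simp
      ring
    · rw [norm_mul, norm_mul, Complex.norm_cpow_eq_rpow_re_of_pos hx0]
      apply le_of_eq
      simp
      ring
    · rw [norm_mul, norm_mul, Complex.norm_cpow_eq_rpow_re_of_pos hx0]
      apply le_of_eq
      simp
      ring
    · rw [norm_mul, Complex.norm_cpow_eq_rpow_re_of_pos hx0, mul_comm]

/-- The odd extension of `j ↦ j ^ (-w)` to the integers. -/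
noncomputable def signedPow (w : ℂ) (j : ℤ) : ℂ := (Int.sign j : ℂ) * (j.natAbs : ℂ) ^ (-w)

lemma signedPow_neg (w : ℂ) (j : ℤ) : signedPow w (-j) = -signedPow w j := by
  simp [signedPow]

lemma signedPow_of_pos (w : ℂ) {j : ℤ} (hj : 0 < j) :
    signedPow w j = (((j : ℝ) : ℝ) : ℂ) ^ (-w) := by
  rw [signedPow, Int.sign_eq_one_of_pos hj]
  have : ((j.natAbs : ℕ) : ℂ) = ((j : ℝ) : ℂ) := by
    have h : ((j.natAbs : ℤ) : ℂ) = (j : ℂ) := by rw [Int.natAbs_of_nonneg hj.le]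
    rw [Int.cast_natCast] at h
    rw [h, Complex.ofReal_intCast]
  rw [this]; simp

lemma norm_thirdDiff_signedPow_le {w : ℂ} (hw : -3 ≤ w.re) {j : ℤ} (hj : 1 ≤ j) :
    ‖thirdDiff (signedPow w) j‖ ≤ ‖w * (w + 1) * (w + 2)‖ * (j : ℝ) ^ (-(w.re + 3)) := by
  have hj' : (1 : ℝ) ≤ j := by exact_mod_cast hj
  have := norm_thirdDifference_cpow_mul_le (p := -w) (U₀ := fun _ => 1) (U₁ := fun _ => 0)
    (U₂ := fun _ => 0) (U₃ := fun _ => 0) (a := j) (h := 1)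
    (C := ‖w * (w + 1) * (w + 2)‖ * (j : ℝ) ^ (-(w.re + 3))) (by linarith) zero_le_one
    (fun x _ => hasDerivAt_const _ _) (fun x _ => hasDerivAt_const _ _)
    (fun x _ => hasDerivAt_const _ _) (fun x hx => ?_)
  · rw [one_pow, mul_one] at this
    rw [thirdDiff, signedPow_of_pos w (show 0 < j by omega),
      signedPow_of_pos w (show 0 < j + 1 by omega), signedPow_of_pos w (show 0 < j + 2 by omega),
      signedPow_of_pos w (show 0 < j + 3 by omega)]
    push_cast at this ⊢
    simpa using this
  · have e : -w * (-w - 1) * (-w - 2) = -(w * (w + 1) * (w + 2)) := by ring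
    rw [e, norm_neg]
    simp only [norm_one, norm_zero, mul_one, mul_zero, zero_mul, add_zero]
    refine mul_le_mul_of_nonneg_left ?_ (norm_nonneg _)
    have : (-w).re - 3 = -(w.re + 3) := by simp; ring
    rw [this]
    exact Real.rpow_le_rpow_of_nonpos (by linarith) hx.1 (by linarith)

lemma reflect_rpow_le {r : ℝ} (hr : 0 ≤ r) {j : ℤ} (hj : j ≤ -4) :
    ((-j - 3 : ℤ) : ℝ) ^ (-r) ≤ 4 ^ r * |(j : ℝ)| ^ (-r) := by
  have hj' : (j : ℝ) ≤ -4 := by exact_mod_cast hj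
  have h4 : (4 : ℝ) ^ r = (1 / 4 : ℝ) ^ (-r) := by
    rw [one_div, Real.inv_rpow (by norm_num), Real.rpow_neg (by norm_num), inv_inv]
  rw [h4, ← Real.mul_rpow (by norm_num) (abs_nonneg _)]
  refine Real.rpow_le_rpow_of_nonpos ?_ ?_ (by linarith)
  · have : 0 < |(j : ℝ)| := abs_pos.mpr (by linarith)
    positivity
  · rw [abs_of_neg (by linarith)]
    push_cast
    linarith

lemma norm_thirdDiff_le_of_odd {F : ℤ → ℂ} (hF : ∀ j, F (-j) = -F j) {C r : ℝ} (hr : 0 ≤ r)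
    (hC : 0 ≤ C) {P : ℤ → Prop} (h : ∀ j, 1 ≤ j → P j → ‖thirdDiff F j‖ ≤ C * (j : ℝ) ^ (-r))
    {j : ℤ} (hj : j ∉ Finset.Icc (-3) (0 : ℤ)) (hP : 1 ≤ j → P j)
    (hP' : j ≤ -4 → P (-j - 3)) :
    ‖thirdDiff F j‖ ≤ C * 4 ^ r * |(j : ℝ)| ^ (-r) := by
  rw [Finset.mem_Icc] at hj
  rcases le_or_gt 1 j with h1 | h1
  · have hj1 : (1 : ℝ) ≤ j := by exact_mod_cast h1
    rw [abs_of_pos (by linarith)]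
    refine (h j h1 (hP h1)).trans ?_
    have : 0 ≤ (j : ℝ) ^ (-r) := Real.rpow_nonneg (by linarith) _
    have h4 : (1 : ℝ) ≤ 4 ^ r := Real.one_le_rpow (by norm_num) hr
    exact mul_le_mul_of_nonneg_right (le_mul_of_one_le_right hC h4) this
  · have h4 : j ≤ -4 := by omega
    rw [← thirdDiff_reflect hF, mul_assoc]
    exact (h _ (by omega) (hP' h4)).trans
      (mul_le_mul_of_nonneg_left (reflect_rpow_le hr h4) hC)

lemma norm_signedPow_le {w : ℂ} {R : ℝ} (hR : ‖w‖ ≤ R) {j : ℤ} (hj : |j| ≤ 3) :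
    ‖signedPow w j‖ ≤ 3 ^ R := by
  have hR0 : 0 ≤ R := (norm_nonneg _).trans hR
  rcases eq_or_ne j 0 with rfl | h0
  · simp [signedPow]; positivity
  have hn : 0 < j.natAbs := by omega
  have hn3 : j.natAbs ≤ 3 := by rw [Int.abs_eq_natAbs] at hj; omega
  rw [signedPow, norm_mul, Complex.norm_natCast_cpow_of_pos hn]
  have h1 : ‖((Int.sign j : ℤ) : ℂ)‖ ≤ 1 := by
    rcases lt_or_gt_of_ne h0 with h | h
    · simp [Int.sign_eq_neg_one_of_neg h]
    · simp [Int.sign_eq_one_of_pos h]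
  have hn1 : (1 : ℝ) ≤ j.natAbs := by exact_mod_cast hn
  have h2 : (j.natAbs : ℝ) ^ (-w).re ≤ 3 ^ R :=
    calc (j.natAbs : ℝ) ^ (-w).re ≤ (j.natAbs : ℝ) ^ R := by
          refine Real.rpow_le_rpow_of_exponent_le hn1 ?_
          have := Complex.abs_re_le_norm w
          simp only [Complex.neg_re]
          linarith [neg_abs_le w.re]
      _ ≤ 3 ^ R := Real.rpow_le_rpow (by linarith) (by exact_mod_cast hn3) hR0
  calc _ ≤ 1 * (3 : ℝ) ^ R := mul_le_mul h1 h2 (by positivity) zero_le_one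
    _ = 3 ^ R := one_mul _

/-- The summable majorant used for third differences of odd functions on the integers. -/
noncomputable def tailBound (K r B : ℝ) (j : ℤ) : ℝ :=
  K * |(j : ℝ)| ^ (-r) + if j ∈ Finset.Icc (-3) (0 : ℤ) then B else 0

lemma summable_tailBound (K : ℝ) {r : ℝ} (hr : 1 < r) (B : ℝ) : Summable (tailBound K r B) := by
  refine ((Real.summable_abs_int_rpow hr).mul_left K).add ?_
  exact summable_of_ne_finset_zero (s := Finset.Icc (-3) (0 : ℤ)) fun j hj => if_neg hj

lemma norm_thirdDiff_signedPow_le_tailBound {σ R : ℝ} (hσ : -3 ≤ σ) {w : ℂ} (hw : σ < w.re)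
    (hR : ‖w‖ < R) (j : ℤ) :
    ‖thirdDiff (signedPow w) j‖ ≤
      tailBound (R * (R + 1) * (R + 2) * 4 ^ (σ + 3)) (σ + 3) (8 * 3 ^ R) j := by
  have hR0 : 0 < R := (norm_nonneg _).trans_lt hR
  rw [tailBound]
  split_ifs with hj
  · have : 0 ≤ R * (R + 1) * (R + 2) * 4 ^ (σ + 3) * |(j : ℝ)| ^ (-(σ + 3)) := by positivity
    have hb : ∀ k : ℤ, |k| ≤ 3 → ‖signedPow w k‖ ≤ 3 ^ R := fun k hk =>
      norm_signedPow_le hR.le hk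
    rw [Finset.mem_Icc] at hj
    have b0 := hb j (abs_le.mpr (by omega))
    have b1 := hb (j + 1) (abs_le.mpr (by omega))
    have b2 := hb (j + 2) (abs_le.mpr (by omega))
    have b3 := hb (j + 3) (abs_le.mpr (by omega))
    have : ‖thirdDiff (signedPow w) j‖ ≤ ‖signedPow w (j + 3)‖ + 3 * ‖signedPow w (j + 2)‖ +
        3 * ‖signedPow w (j + 1)‖ + ‖signedPow w j‖ := by
      rw [thirdDiff]
      refine (norm_sub_le _ _).trans (add_le_add_left ((norm_add_le _ _).trans
        (add_le_add ((norm_sub_le _ _).trans (add_le_add le_rfl ?_)) ?_)) _)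
      · simp
      · simp
    linarith
  · rw [add_zero]
    refine norm_thirdDiff_le_of_odd (signedPow_neg w) (by linarith) (by positivity)
      (P := fun _ => True) (fun k hk _ => ?_) hj (fun _ => trivial) (fun _ => trivial)
    refine (norm_thirdDiff_signedPow_le (by linarith) hk).trans ?_
    have hk' : (1 : ℝ) ≤ k := by exact_mod_cast hk
    refine mul_le_mul ?_ (Real.rpow_le_rpow_of_exponent_le hk' (by linarith)) (by positivity)
      (by positivity)
    rw [norm_mul, norm_mul]
    have h1 : ‖w + 1‖ ≤ R + 1 := (norm_add_le _ _).trans (by simp; linarith)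
    have h2 : ‖w + 2‖ ≤ R + 2 := (norm_add_le _ _).trans (by simp; linarith)
    exact mul_le_mul (mul_le_mul hR.le h1 (norm_nonneg _) hR0.le) h2 (norm_nonneg _)
      (by positivity)

lemma differentiable_thirdDiff_signedPow (j : ℤ) :
    Differentiable ℂ fun w => thirdDiff (signedPow w) j := by
  have h : ∀ k : ℤ, Differentiable ℂ fun w => signedPow w k := by
    intro k
    rcases eq_or_ne k 0 with rfl | h0
    · simp [signedPow]
    · unfold signedPow
      refine Differentiable.const_mul ?_ _
      intro w
      refine DifferentiableAt.const_cpow differentiableAt_id.neg (Or.inl ?_)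
      exact_mod_cast Int.natAbs_ne_zero.mpr h0
  unfold thirdDiff
  exact (((h _).sub ((h _).const_mul 3)).add ((h _).const_mul 3)).sub (h _)

lemma DirichletCharacter.Odd.ne_one {q : ℕ} {χ : DirichletCharacter ℂ q} (hodd : χ.Odd) : χ ≠ 1 := by
  rintro rfl
  have h : (1 : DirichletCharacter ℂ q) (-1) = -1 := hodd
  rw [MulChar.one_apply (isUnit_one.neg)] at h
  norm_num at h

lemma hasSum_mul_signedPow {q : ℕ} [NeZero q] {χ : DirichletCharacter ℂ q} (hodd : χ.Odd) {w : ℂ}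
    (hw : 1 < w.re) :
    HasSum (fun j : ℤ => χ (j : ZMod q) * signedPow w j)
      (2 * DirichletCharacter.LFunction χ w) := by
  have hw0 : w ≠ 0 := by rintro rfl; norm_num at hw
  have h0 : HasSum (fun n : ℕ => χ ((n : ℤ) : ZMod q) * signedPow w n)
      (DirichletCharacter.LFunction χ w) := by
    rw [DirichletCharacter.LFunction_eq_LSeries χ hw]
    have := (DirichletCharacter.LSeriesSummable_of_one_lt_re χ hw).LSeriesHasSum
    refine HasSum.congr_fun this ?_
    intro n
    rcases Nat.eq_zero_or_pos n with rfl | hn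
    · simp [signedPow]
    · rw [LSeries.term_of_ne_zero hn.ne', signedPow_of_pos w (by exact_mod_cast hn),
        Complex.cpow_neg]
      simp [div_eq_mul_inv]
  have h1 : HasSum (fun n : ℕ => χ ((-((n : ℤ) + 1) : ℤ) : ZMod q) * signedPow w (-((n : ℤ) + 1)))
      (DirichletCharacter.LFunction χ w) := by
    have h2 := (hasSum_nat_add_iff' 1).mpr h0
    simp only [Finset.sum_range_one, Nat.cast_zero, Int.cast_zero] at h2
    have h3 : signedPow w 0 = 0 := by simp [signedPow]
    rw [h3, mul_zero, sub_zero] at h2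
    refine HasSum.congr_fun h2 fun n => ?_
    rw [signedPow_neg, Int.cast_neg, hodd.eval_neg]
    push_cast
    ring
  rw [two_mul]
  exact h0.of_nat_of_neg_add_one h1

lemma summable_signedPow {w : ℂ} (hw : 1 < w.re) : Summable (signedPow w) := by
  have h : Summable fun n : ℕ => signedPow w n := by
    refine Summable.congr (Complex.summable_one_div_nat_cpow.mpr hw) fun n => ?_
    rcases Nat.eq_zero_or_pos n with rfl | hn
    · have hw0 : w ≠ 0 := by rintro rfl; norm_num at hw
      simp [signedPow, hw0]
    · rw [signedPow_of_pos w (by exact_mod_cast hn), Complex.cpow_neg]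
      simp
  refine Summable.of_nat_of_neg_add_one h ?_
  simp only [signedPow_neg]
  exact_mod_cast ((summable_nat_add_iff 1).mpr h).neg

/-- Analytic continuation of an odd Dirichlet L-function to `-2 < re w` via third differences. -/
lemma two_mul_LFunction_eq_tsum {q : ℕ} [NeZero q] {χ : DirichletCharacter ℂ q} (hodd : χ.Odd)
    {A : ZMod q → ℂ} (hA : ∀ x, A (x + 3) - 3 * A (x + 2) + 3 * A (x + 1) - A x = χ x)
    {w : ℂ} (hw : -2 < w.re) :
    2 * DirichletCharacter.LFunction χ w =
      -∑' j : ℤ, A ((j + 3 : ℤ) : ZMod q) * thirdDiff (signedPow w) j := by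
  obtain ⟨M, hM⟩ : ∃ M, ∀ x, ‖A x‖ ≤ M := by
    obtain ⟨M, hM⟩ := (Set.finite_range fun x => ‖A x‖).bddAbove
    exact ⟨M, fun x => hM ⟨x, rfl⟩⟩
  obtain ⟨σ, hσ, hσw⟩ := exists_between hw
  set σ' := min σ 0 with hσ'
  set R := ‖w‖ + 3 with hR
  have hσ2 : -2 < σ' := lt_min hσ (by norm_num)
  set S : Set ℂ := {z | σ' < z.re} ∩ Metric.ball 0 R with hS
  have hSo : IsOpen S := (isOpen_lt continuous_const Complex.continuous_re).inter Metric.isOpen_ball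
  have hSc : IsPreconnected S :=
    ((convex_halfSpace_re_gt σ').inter (convex_ball 0 R)).isPreconnected
  have hwS : w ∈ S := ⟨(min_le_left _ _).trans_lt hσw, by simp [hR]⟩
  have h2S : (2 : ℂ) ∈ S := by
    refine ⟨?_, ?_⟩
    · have : σ' ≤ 0 := min_le_right _ _
      simp only [Set.mem_ofPred_eq, Complex.re_ofNat]; linarith
    · have := norm_nonneg w
      simp only [Metric.mem_ball, dist_zero_right, hR]
      norm_num
      linarith
  have hd1 : DifferentiableOn ℂ (fun z => 2 * DirichletCharacter.LFunction χ z) S :=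
    ((DirichletCharacter.differentiable_LFunction (DirichletCharacter.Odd.ne_one
      hodd)).const_mul 2).differentiableOn
  have hd2 : DifferentiableOn ℂ
      (fun z => -∑' j : ℤ, A ((j + 3 : ℤ) : ZMod q) * thirdDiff (signedPow z) j) S := by
    refine (Complex.differentiableOn_tsum_of_summable_norm
      (u := fun j => M * tailBound (R * (R + 1) * (R + 2) * 4 ^ (σ' + 3)) (σ' + 3) (8 * 3 ^ R) j)
      ((summable_tailBound _ (by linarith) _).mul_left M) (fun j => ?_) hSo
      (fun j z hz => ?_)).neg
    · exact ((differentiable_thirdDiff_signedPow j).const_mul _).differentiableOn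
    · rw [norm_mul]
      exact mul_le_mul (hM _) (norm_thirdDiff_signedPow_le_tailBound (by linarith) hz.1
        (by simpa using hz.2) j) (norm_nonneg _) ((norm_nonneg _).trans (hM 0))
  refine (hd1.analyticOnNhd hSo).eqOn_of_preconnected_of_eventuallyEq (hd2.analyticOnNhd hSo) hSc
    h2S ?_ hwS
  have hnear : {z : ℂ | 1 < z.re} ∈ nhds (2 : ℂ) :=
    (isOpen_lt continuous_const Complex.continuous_re).mem_nhds (by simp)
  filter_upwards [hnear] with z hz
  have hz' : 1 < z.re := hz
  rw [← (hasSum_mul_signedPow hodd hz').tsum_eq,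
    ← tsum_thirdDiff_mul (A := fun j : ℤ => A (j : ZMod q)) (fun j => hM _)
      (summable_signedPow hz')]
  refine tsum_congr fun j => ?_
  rw [← hA, thirdDiff]
  push_cast
  rfl

/-- The entire function `sin z / z`. -/
noncomputable def entireSinc : ℂ → ℂ := dslope Complex.sin 0

lemma differentiable_entireSinc : Differentiable ℂ entireSinc := by
  rw [← differentiableOn_univ]
  exact (Complex.differentiableOn_dslope Filter.univ_mem).mpr
    Complex.differentiable_sin.differentiableOn

lemma entireSinc_zero : entireSinc 0 = 1 := by
  simp [entireSinc, dslope_same]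

lemma entireSinc_of_ne {z : ℂ} (hz : z ≠ 0) : entireSinc z = Complex.sin z / z := by
  rw [entireSinc, dslope_of_ne _ hz, slope_def_field]
  simp

lemma entireSinc_neg (z : ℂ) : entireSinc (-z) = entireSinc z := by
  rcases eq_or_ne z 0 with rfl | hz
  · simp
  · rw [entireSinc_of_ne hz, entireSinc_of_ne (neg_ne_zero.mpr hz), Complex.sin_neg, neg_div_neg_eq]

lemma entireSinc_mem_slitPlane {x : ℝ} (hx : x ∈ Set.Icc 0 (3 * Real.pi / 4)) :
    entireSinc x ∈ Complex.slitPlane := by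
  rcases hx.1.eq_or_lt with h | h
  · rw [← h]; simp [entireSinc_zero]
  · rw [entireSinc_of_ne (by exact_mod_cast h.ne')]
    left
    have hs : 0 < Real.sin x := Real.sin_pos_of_pos_of_lt_pi h (by linarith [hx.2, Real.pi_pos])
    have : Complex.sin x / x = ((Real.sin x / x : ℝ) : ℂ) := by push_cast; rfl
    rw [this, Complex.ofReal_re]
    positivity

/-- The factor comparing `cos x * (sin x) ^ (-s)` with `x ^ (-s)`, minus `1`. -/
noncomputable def sincCorrection (s : ℝ) (z : ℂ) : ℂ :=
  Complex.cos z * entireSinc z ^ (-s : ℂ) - 1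

lemma sincCorrection_neg (s : ℝ) (z : ℂ) : sincCorrection s (-z) = sincCorrection s z := by
  simp [sincCorrection, entireSinc_neg]

lemma sincCorrection_ofReal (s : ℝ) {x : ℝ} (hx : x ∈ Set.Ioc 0 (3 * Real.pi / 4)) :
    sincCorrection s x = ((Real.cos x * (Real.sin x / x) ^ (-s) - 1 : ℝ) : ℂ) := by
  have hs : 0 < Real.sin x := Real.sin_pos_of_pos_of_lt_pi hx.1 (by linarith [hx.2, Real.pi_pos])
  have hx0 := hx.1
  rw [sincCorrection, entireSinc_of_ne (by exact_mod_cast hx.1.ne')]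
  push_cast
  rw [Complex.ofReal_cpow (by positivity)]
  push_cast
  rfl

lemma exists_sincCorrection_derivs (s : ℝ) : ∃ (U₁ U₂ U₃ : ℝ → ℂ) (M : ℝ), 0 ≤ M ∧
    ∀ x ∈ Set.Icc 0 (3 * Real.pi / 4),
      HasDerivAt (fun y : ℝ => sincCorrection s y) (U₁ x) x ∧ HasDerivAt U₁ (U₂ x) x ∧
      HasDerivAt U₂ (U₃ x) x ∧ ‖sincCorrection s x‖ ≤ M * x ^ 2 ∧ ‖U₁ x‖ ≤ M * x ∧
      ‖U₂ x‖ ≤ M ∧ ‖U₃ x‖ ≤ M := by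
  set V := sincCorrection s with hV
  set Ω : Set ℂ := entireSinc ⁻¹' Complex.slitPlane with hΩ
  have hΩo : IsOpen Ω := Complex.isOpen_slitPlane.preimage differentiable_entireSinc.continuous
  have hmem : ∀ x : ℝ, x ∈ Set.Icc 0 (3 * Real.pi / 4) → (x : ℂ) ∈ Ω := fun x hx =>
    entireSinc_mem_slitPlane hx
  have d0 : DifferentiableOn ℂ V Ω := by
    refine DifferentiableOn.sub_const (DifferentiableOn.mul
      Complex.differentiable_cos.differentiableOn ?_) 1
    intro z hz
    exact ((differentiable_entireSinc z).cpow_const hz).differentiableWithinAt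
  have d1 := d0.deriv hΩo
  have d2 := d1.deriv hΩo
  have d3 := d2.deriv hΩo
  have hd : ∀ f : ℂ → ℂ, DifferentiableOn ℂ f Ω → ∀ x : ℝ, x ∈ Set.Icc 0 (3 * Real.pi / 4) →
      HasDerivAt (fun y : ℝ => f y) (deriv f x) x := fun f hf x hx =>
    ((hf.differentiableAt (hΩo.mem_nhds (hmem x hx))).hasDerivAt).comp_ofReal
  have hbd : ∀ f : ℂ → ℂ, DifferentiableOn ℂ f Ω → ∃ M, ∀ x : ℝ,
      x ∈ Set.Icc 0 (3 * Real.pi / 4) → ‖f x‖ ≤ M := by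
    intro f hf
    refine isCompact_Icc.exists_bound_of_continuousOn (f := fun x : ℝ => f x) ?_
    exact hf.continuousOn.comp Complex.continuous_ofReal.continuousOn hmem
  obtain ⟨M2, h2⟩ := hbd _ d2
  obtain ⟨M3, h3⟩ := hbd _ d3
  set M := max M2 M3 with hM
  have hpi := Real.pi_pos
  have hM0 : 0 ≤ M := (norm_nonneg _).trans ((h2 0 ⟨le_rfl, by positivity⟩).trans (le_max_left _ _))
  have hzero : deriv V ((0 : ℝ) : ℂ) = 0 := by
    have h := deriv_comp_neg V 0
    have e : (fun x => V (-x)) = V := funext fun z => sincCorrection_neg s z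
    rw [e, neg_zero] at h
    rw [Complex.ofReal_zero]
    exact self_eq_neg.mp h
  have hV0 : V ((0 : ℝ) : ℂ) = 0 := by simp [hV, sincCorrection, entireSinc_zero]
  have hU1 : ∀ x ∈ Set.Icc 0 (3 * Real.pi / 4), ‖deriv V (x : ℂ)‖ ≤ M * x := by
    intro x hx
    have := norm_image_sub_le_of_norm_deriv_le_segment' (f := fun y : ℝ => deriv V y)
      (f' := fun y : ℝ => deriv (deriv V) y) (a := 0) (b := x) (C := M)
      (fun y hy => (hd _ d1 y ⟨hy.1, hy.2.trans hx.2⟩).hasDerivWithinAt)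
      (fun y hy => (h2 y ⟨hy.1, hy.2.le.trans hx.2⟩).trans (le_max_left _ _)) x
      ⟨hx.1, le_rfl⟩
    rwa [hzero, sub_zero, sub_zero] at this
  have hU0 : ∀ x ∈ Set.Icc 0 (3 * Real.pi / 4), ‖V (x : ℂ)‖ ≤ M * x ^ 2 := by
    intro x hx
    have := norm_image_sub_le_of_norm_deriv_le_segment' (f := fun y : ℝ => V y)
      (f' := fun y : ℝ => deriv V y) (a := 0) (b := x) (C := M * x)
      (fun y hy => (hd _ d0 y ⟨hy.1, hy.2.trans hx.2⟩).hasDerivWithinAt)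
      (fun y hy => (hU1 y ⟨hy.1, hy.2.le.trans hx.2⟩).trans
        (mul_le_mul_of_nonneg_left hy.2.le hM0)) x
      ⟨hx.1, le_rfl⟩
    rw [hV0, sub_zero, sub_zero] at this
    linarith
  exact ⟨fun y => deriv V y, fun y => deriv (deriv V) y, fun y => deriv (deriv (deriv V)) y, M,
    hM0, fun x hx => ⟨hd _ d0 x hx, hd _ d1 x hx, hd _ d2 x hx, hU0 x hx, hU1 x hx,
      (h2 x hx).trans (le_max_left _ _), (h3 x hx).trans (le_max_right _ _)⟩⟩

lemma tendsto_sincCorrection_div_sq (s : ℝ) :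
    Filter.Tendsto (fun x : ℝ => sincCorrection s x / (x : ℂ) ^ 2) (nhdsWithin 0 (Set.Ioi 0))
      (nhds (-(3 - s) / 6 : ℂ)) := by
  have hcos : Filter.Tendsto (fun x : ℝ => (Real.cos x - 1) / x ^ 2) (nhdsWithin 0 (Set.Ioi 0))
      (nhds (-1 / 2)) := by
    rw [tendsto_iff_norm_sub_tendsto_zero]
    have hz : Filter.Tendsto (fun x : ℝ => x ^ 2 * (5 / 96)) (nhdsWithin 0 (Set.Ioi 0))
        (nhds 0) := by
      have : Filter.Tendsto (fun x : ℝ => x ^ 2 * (5 / 96)) (nhds 0) (nhds (0 ^ 2 * (5 / 96))) :=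
        Continuous.tendsto (by fun_prop) 0
      simpa using this.mono_left nhdsWithin_le_nhds
    refine squeeze_zero' (Filter.Eventually.of_forall fun x => norm_nonneg _) ?_ hz
    filter_upwards [Ioo_mem_nhdsGT (zero_lt_one (α := ℝ))] with x hx
    have hx0 : 0 < x := hx.1
    have hb := Real.cos_bound (x := x) (by rw [abs_of_pos hx.1]; exact hx.2.le)
    rw [abs_of_pos hx.1] at hb
    have e : (Real.cos x - 1) / x ^ 2 - -1 / 2 = (Real.cos x - (1 - x ^ 2 / 2)) / x ^ 2 := by
      field_simp; ring
    rw [e, Real.norm_eq_abs, abs_div, abs_of_pos (show 0 < x ^ 2 by positivity),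
      div_le_iff₀ (by positivity)]
    calc _ ≤ _ := hb
      _ = _ := by ring
  have hsin : Filter.Tendsto (fun x : ℝ => (Real.sin x / x - 1) / x ^ 2)
      (nhdsWithin 0 (Set.Ioi 0)) (nhds (-1 / 6)) := by
    rw [tendsto_iff_norm_sub_tendsto_zero]
    have hz : Filter.Tendsto (fun x : ℝ => x ^ 2 * (1 / 100)) (nhdsWithin 0 (Set.Ioi 0))
        (nhds 0) := by
      have : Filter.Tendsto (fun x : ℝ => x ^ 2 * (1 / 100)) (nhds 0) (nhds (0 ^ 2 * (1 / 100))) :=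
        Continuous.tendsto (by fun_prop) 0
      simpa using this.mono_left nhdsWithin_le_nhds
    refine squeeze_zero' (Filter.Eventually.of_forall fun x => norm_nonneg _) ?_ hz
    filter_upwards [Ioo_mem_nhdsGT (zero_lt_one (α := ℝ))] with x hx
    have hx0 : 0 < x := hx.1
    have hb := Real.sin_bound (x := x) (by rw [abs_of_pos hx.1]; exact hx.2.le)
    rw [abs_of_pos hx.1] at hb
    have e : (Real.sin x / x - 1) / x ^ 2 - -1 / 6 = (Real.sin x - (x - x ^ 3 / 6)) / x ^ 3 := by
      field_simp; ring
    rw [e, Real.norm_eq_abs, abs_div, abs_of_pos (show 0 < x ^ 3 by positivity),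
      div_le_iff₀ (by positivity)]
    calc _ ≤ _ := hb
      _ = _ := by ring
  have hsinc : Filter.Tendsto (fun x : ℝ => Real.sin x / x) (nhdsWithin 0 (Set.Ioi 0))
      (nhds 1) := by
    have h2 : Filter.Tendsto (fun x : ℝ => x ^ 2) (nhdsWithin 0 (Set.Ioi 0)) (nhds 0) := by
      have : Filter.Tendsto (fun x : ℝ => x ^ 2) (nhds 0) (nhds (0 ^ 2)) :=
        Continuous.tendsto (by fun_prop) 0
      simpa using this.mono_left nhdsWithin_le_nhds
    have := (hsin.mul h2).add_const 1
    simp only [mul_zero, zero_add] at this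
    refine this.congr' ?_
    filter_upwards [self_mem_nhdsWithin] with x hx
    have : x ≠ 0 := (Set.mem_Ioi.mp hx).ne'
    field_simp
    ring
  have hder : HasDerivAt (fun t : ℝ => t ^ (-s)) (-s) 1 := by
    have := Real.hasDerivAt_rpow_const (x := 1) (p := -s) (Or.inl one_ne_zero)
    simpa using this
  have hds : Filter.Tendsto (fun x : ℝ => dslope (fun t : ℝ => t ^ (-s)) 1 (Real.sin x / x))
      (nhdsWithin 0 (Set.Ioi 0)) (nhds (-s)) := by
    have hc : ContinuousAt (dslope (fun t : ℝ => t ^ (-s)) 1) 1 :=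
      continuousAt_dslope_same.mpr hder.differentiableAt
    have := hc.tendsto
    rw [dslope_same, hder.deriv] at this
    exact this.comp hsinc
  have hpow : Filter.Tendsto (fun x : ℝ => (Real.sin x / x) ^ (-s)) (nhdsWithin 0 (Set.Ioi 0))
      (nhds 1) := by
    have := hsinc.rpow_const (p := -s) (Or.inl one_ne_zero)
    simpa using this
  have hall := (hcos.mul hpow).add (hds.mul hsin)
  have hval : (-1 / 2 * 1 + -s * (-1 / 6) : ℝ) = -(3 - s) / 6 := by ring
  rw [hval] at hall
  have hall' := (Complex.continuous_ofReal.tendsto _).comp hall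
  have e : ((-(3 - s) / 6 : ℝ) : ℂ) = -(3 - s) / 6 := by push_cast; ring
  rw [e] at hall'
  refine hall'.congr' ?_
  filter_upwards [Ioo_mem_nhdsGT (show (0 : ℝ) < 3 * Real.pi / 4 by positivity)] with x hx
  rw [sincCorrection_ofReal s ⟨hx.1, hx.2.le⟩]
  have hk : (Real.sin x / x - 1) * dslope (fun t : ℝ => t ^ (-s)) 1 (Real.sin x / x) =
      (Real.sin x / x) ^ (-s) - 1 := by
    have := sub_smul_dslope (fun t : ℝ => t ^ (-s)) 1 (Real.sin x / x)
    simpa using this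
  rw [← Complex.ofReal_pow, ← Complex.ofReal_div, Function.comp_apply]
  congr 1
  have : Real.cos x * (Real.sin x / x) ^ (-s) - 1 =
      (Real.cos x - 1) * (Real.sin x / x) ^ (-s) + ((Real.sin x / x) ^ (-s) - 1) := by ring
  rw [this, ← hk]
  ring

/-- The odd, `N`-periodic function `j ↦ cos (π j / N) sin (π j / N) ^ (-s)`. -/
noncomputable def cosSinPow (s : ℝ) (N : ℕ) (j : ℤ) : ℂ :=
  ((Real.cos (Real.pi * j / N) *
    (Real.sin (Real.pi * j / N) * |Real.sin (Real.pi * j / N)| ^ (-s - 1)) : ℝ) : ℂ)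

lemma cosSinPow_neg (s : ℝ) (N : ℕ) (j : ℤ) : cosSinPow s N (-j) = -cosSinPow s N j := by
  have : Real.pi * ((-j : ℤ) : ℝ) / N = -(Real.pi * j / N) := by push_cast; ring
  rw [cosSinPow, this, Real.cos_neg, Real.sin_neg, abs_neg, cosSinPow]
  push_cast
  ring

lemma cosSinPow_add_period (s : ℝ) {N : ℕ} (hN : 0 < N) (j : ℤ) :
    cosSinPow s N (j + N) = cosSinPow s N j := by
  have hN' : (N : ℝ) ≠ 0 := by exact_mod_cast hN.ne'
  have : Real.pi * ((j + N : ℤ) : ℝ) / N = Real.pi * j / N + Real.pi := by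
    push_cast; field_simp
  rw [cosSinPow, this, Real.cos_add_pi, Real.sin_add_pi, abs_neg, cosSinPow]
  push_cast
  ring

/-- The difference between `cosSinPow` and its leading term. -/
noncomputable def cosSinError (s : ℝ) (N : ℕ) (j : ℤ) : ℂ :=
  cosSinPow s N j - (((Real.pi / N) ^ (-s) : ℝ) : ℂ) * signedPow s j

lemma cosSinError_neg (s : ℝ) (N : ℕ) (j : ℤ) : cosSinError s N (-j) = -cosSinError s N j := by
  rw [cosSinError, cosSinPow_neg, signedPow_neg, cosSinError]
  ring

lemma cosSinPow_of_pos (s : ℝ) {N : ℕ} {j : ℤ} (hs : 0 < Real.sin (Real.pi * j / N)) :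
    cosSinPow s N j =
      ((Real.cos (Real.pi * j / N) * Real.sin (Real.pi * j / N) ^ (-s) : ℝ) : ℂ) := by
  rw [cosSinPow, abs_of_pos hs, Real.rpow_sub_one hs.ne', mul_div_cancel₀ _ hs.ne']

lemma cosSinError_eq (s : ℝ) {N : ℕ} (hN : 0 < N) {j : ℤ} (hj : 1 ≤ j) (hjN : 4 * j ≤ 3 * N) :
    cosSinError s N j = ((Real.pi * j / N : ℝ) : ℂ) ^ (-s : ℂ) *
      sincCorrection s ((Real.pi * j / N : ℝ) : ℂ) := by
  have hN' : (0 : ℝ) < N := by exact_mod_cast hN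
  have hj' : (0 : ℝ) < j := by exact_mod_cast hj
  have hpi := Real.pi_pos
  have hy : Real.pi * j / N ∈ Set.Ioc 0 (3 * Real.pi / 4) := by
    refine ⟨by positivity, ?_⟩
    rw [div_le_div_iff₀ hN' (by norm_num)]
    have : (4 * j : ℝ) ≤ 3 * N := by exact_mod_cast hjN
    nlinarith
  have hsin : 0 < Real.sin (Real.pi * j / N) :=
    Real.sin_pos_of_pos_of_lt_pi hy.1 (by linarith [hy.2])
  have e1 : (((Real.pi / N) ^ (-s) : ℝ) : ℂ) * signedPow s j =
      (((Real.pi * j / N) ^ (-s) : ℝ) : ℂ) := by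
    rw [signedPow_of_pos _ (show 0 < j by omega), ← Complex.ofReal_neg,
      ← Complex.ofReal_cpow hj'.le, ← Complex.ofReal_mul, ← Real.mul_rpow (by positivity) hj'.le,
      div_mul_eq_mul_div]
  have e2 : ((Real.pi * j / N : ℝ) : ℂ) ^ (-s : ℂ) = (((Real.pi * j / N) ^ (-s) : ℝ) : ℂ) := by
    rw [← Complex.ofReal_neg, ← Complex.ofReal_cpow hy.1.le]
  rw [cosSinError, e1, e2, sincCorrection_ofReal s hy, cosSinPow_of_pos s hsin, ← Complex.ofReal_sub,
    ← Complex.ofReal_mul]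
  congr 1
  have : Real.sin (Real.pi * j / N) ^ (-s) =
      (Real.pi * j / N) ^ (-s) * (Real.sin (Real.pi * j / N) / (Real.pi * j / N)) ^ (-s) := by
    rw [← Real.mul_rpow hy.1.le (div_pos hsin hy.1).le, mul_div_cancel₀ _ hy.1.ne']
  rw [this]
  ring

lemma tendsto_scaled_cosSinError (s : ℝ) (k : ℤ) :
    Filter.Tendsto (fun N : ℕ => (((N : ℝ) ^ (2 - s) : ℝ) : ℂ) * cosSinError s N k)
      Filter.atTop (nhds ((-(3 - s) / 6 : ℂ) * ((Real.pi ^ (2 - s) : ℝ) : ℂ) *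
        signedPow (s - 2) k)) := by
  have hpos : ∀ k : ℤ, 1 ≤ k →
      Filter.Tendsto (fun N : ℕ => (((N : ℝ) ^ (2 - s) : ℝ) : ℂ) * cosSinError s N k)
      Filter.atTop (nhds ((-(3 - s) / 6 : ℂ) * ((Real.pi ^ (2 - s) : ℝ) : ℂ) *
        signedPow (s - 2) k)) := by
    intro k hk
    have hk' : (0 : ℝ) < k := by exact_mod_cast hk
    have hpi := Real.pi_pos
    have hy : Filter.Tendsto (fun N : ℕ => Real.pi * k / N) Filter.atTop
        (nhdsWithin 0 (Set.Ioi 0)) := by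
      refine tendsto_nhdsWithin_iff.mpr ⟨tendsto_const_div_atTop_nhds_zero_nat _, ?_⟩
      filter_upwards [Filter.eventually_gt_atTop 0] with N hN
      have : (0 : ℝ) < N := by exact_mod_cast hN
      exact Set.mem_Ioi.mpr (by positivity)
    have h := ((tendsto_sincCorrection_div_sq s).comp hy).const_mul
      (((Real.pi * k) ^ (2 - s) : ℝ) : ℂ)
    have e : (((Real.pi * k) ^ (2 - s) : ℝ) : ℂ) * (-(3 - s) / 6 : ℂ) =
        (-(3 - s) / 6 : ℂ) * ((Real.pi ^ (2 - s) : ℝ) : ℂ) * signedPow (s - 2) k := by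
      rw [signedPow_of_pos _ (show 0 < k by omega)]
      have : -((s : ℂ) - 2) = ((2 - s : ℝ) : ℂ) := by push_cast; ring
      rw [this, ← Complex.ofReal_cpow hk'.le, Real.mul_rpow hpi.le hk'.le]
      push_cast
      ring
    rw [e] at h
    refine h.congr' ?_
    filter_upwards [Filter.eventually_gt_atTop 0, Filter.eventually_ge_atTop (2 * k.toNat)]
      with N hN hNk
    have hN' : (0 : ℝ) < N := by exact_mod_cast hN
    rw [cosSinError_eq s hN hk (by omega)]
    have hy0 : 0 < Real.pi * k / N := by positivity
    have e2 : ((Real.pi * k / N : ℝ) : ℂ) ^ (-s : ℂ) = (((Real.pi * k / N) ^ (-s) : ℝ) : ℂ) := by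
      rw [← Complex.ofReal_neg, ← Complex.ofReal_cpow hy0.le]
    have e3 : (Real.pi * k) ^ (2 - s) =
        (N : ℝ) ^ (2 - s) * ((Real.pi * k / N) ^ (-s) * (Real.pi * k / N) ^ 2) := by
      rw [← Real.rpow_natCast (Real.pi * k / N) 2, ← Real.rpow_add hy0,
        show -s + ((2 : ℕ) : ℝ) = 2 - s by push_cast; ring, ← Real.mul_rpow hN'.le hy0.le,
        mul_div_cancel₀ _ hN'.ne']
    rw [Function.comp_apply, e2, e3]
    have hy1 : ((Real.pi * k / N : ℝ) : ℂ) ≠ 0 := by exact_mod_cast hy0.ne'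
    generalize Real.pi * k / N = y at *
    push_cast
    field_simp
  rcases lt_trichotomy k 0 with h | rfl | h
  · have := (hpos (-k) (by omega)).neg
    simp only [signedPow_neg, cosSinError_neg, mul_neg, neg_neg] at this
    exact this
  · simp [cosSinError, cosSinPow, signedPow]
  · exact hpos k h

lemma exists_norm_thirdDiff_cosSinError_le (s : ℝ) (hs : 0 < s) : ∃ K : ℝ, 0 ≤ K ∧
    ∀ N : ℕ, 0 < N → ∀ j : ℤ, 1 ≤ j → 4 * (j + 3) ≤ 3 * N →
      ‖thirdDiff (fun k => (((N : ℝ) ^ (2 - s) : ℝ) : ℂ) * cosSinError s N k) j‖ ≤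
        K * (j : ℝ) ^ (-(s + 1)) := by
  obtain ⟨U₁, U₂, U₃, M, hM, hU⟩ := exists_sincCorrection_derivs s
  set p : ℂ := -(s : ℂ) with hp
  have hpre : p.re = -s := by simp [hp]
  set K := (‖p * (p - 1) * (p - 2)‖ + ‖3 * p * (p - 1)‖ + ‖3 * p‖ + 3) * M with hK
  have hK0 : 0 ≤ K := by positivity
  have hpi := Real.pi_pos
  refine ⟨K * Real.pi ^ (2 - s), by positivity, fun N hN j hj hjN => ?_⟩
  have hN' : (0 : ℝ) < N := by exact_mod_cast hN
  have hj' : (0 : ℝ) < j := by exact_mod_cast hj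
  have ha : 0 < Real.pi * j / N := by positivity
  have hend : Real.pi * j / N + 3 * (Real.pi / N) ≤ 3 * Real.pi / 4 := by
    have : (4 * (j + 3) : ℝ) ≤ 3 * N := by exact_mod_cast hjN
    have e : Real.pi * j / N + 3 * (Real.pi / N) = Real.pi * (j + 3) / N := by ring
    rw [e, div_le_div_iff₀ hN' (by norm_num)]
    nlinarith
  have hIcc : ∀ x ∈ Set.Icc (Real.pi * j / N) (Real.pi * j / N + 3 * (Real.pi / N)),
      x ∈ Set.Icc 0 (3 * Real.pi / 4) := fun x hx => ⟨ha.le.trans hx.1, hx.2.trans hend⟩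
  have key := norm_thirdDifference_cpow_mul_le (p := p)
    (U₀ := fun y : ℝ => sincCorrection s y) (U₁ := U₁) (U₂ := U₂) (U₃ := U₃)
    (a := Real.pi * j / N) (h := Real.pi / N) (C := K * (Real.pi * j / N) ^ (-(s + 1))) ha
    (by positivity) (fun x hx => (hU x (hIcc x hx)).1) (fun x hx => (hU x (hIcc x hx)).2.1)
    (fun x hx => (hU x (hIcc x hx)).2.2.1) (fun x hx => ?_)
  · have hterm : ∀ k : ℤ, 0 ≤ k → k ≤ 3 → cosSinError s N (j + k) =
        ((Real.pi * j / N + k * (Real.pi / N) : ℝ) : ℂ) ^ p *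
          sincCorrection s ((Real.pi * j / N + k * (Real.pi / N) : ℝ) : ℂ) := by
      intro k hk0 hk3
      rw [cosSinError_eq s hN (by omega) (by omega)]
      have : Real.pi * ((j + k : ℤ) : ℝ) / N = Real.pi * j / N + k * (Real.pi / N) := by
        push_cast; ring
      rw [this]
    have t0 := hterm 0 le_rfl (by norm_num)
    have t1 := hterm 1 (by norm_num) (by norm_num)
    have t2 := hterm 2 (by norm_num) (by norm_num)
    have t3 := hterm 3 (by norm_num) (by norm_num)
    simp only [Int.cast_zero, zero_mul, add_zero, Int.cast_one, one_mul, Int.cast_ofNat] at t0 t1 t2 t3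
    beta_reduce at key
    rw [← t0, ← t1, ← t2, ← t3] at key
    have e : thirdDiff (fun k => (((N : ℝ) ^ (2 - s) : ℝ) : ℂ) * cosSinError s N k) j =
        (((N : ℝ) ^ (2 - s) : ℝ) : ℂ) * (cosSinError s N (j + 3) - 3 * cosSinError s N (j + 2) +
          3 * cosSinError s N (j + 1) - cosSinError s N j) := by
      rw [thirdDiff]; ring
    have hNs : 0 ≤ (N : ℝ) ^ (2 - s) := by positivity
    rw [e, norm_mul, Complex.norm_real, Real.norm_eq_abs, abs_of_nonneg hNs]
    refine (mul_le_mul_of_nonneg_left key hNs).trans (le_of_eq ?_)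
    have hNp : (Real.pi / N) ^ (-(s + 1)) * (Real.pi / N) ^ 3 = (Real.pi / N) ^ (2 - s) := by
      rw [← Real.rpow_natCast (Real.pi / N) 3, ← Real.rpow_add (by positivity)]
      congr 1
      push_cast
      ring
    have hprod : (N : ℝ) ^ (2 - s) * (Real.pi / N) ^ (2 - s) = Real.pi ^ (2 - s) := by
      rw [← Real.mul_rpow hN'.le (by positivity), mul_div_cancel₀ _ hN'.ne']
    rw [mul_div_right_comm, Real.mul_rpow (by positivity) hj'.le, ← hprod, ← hNp]
    ring
  · have hx' := hIcc x hx
    have hx0 : 0 < x := ha.trans_le hx.1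
    have hx3 : x ≤ 3 := by linarith [hx'.2, Real.pi_lt_d2]
    obtain ⟨-, -, -, b0, b1, b2, b3⟩ := hU x hx'
    have hmono : x ^ (-(s + 1)) ≤ (Real.pi * j / N) ^ (-(s + 1)) :=
      Real.rpow_le_rpow_of_nonpos ha hx.1 (by linarith)
    refine le_trans ?_ (mul_le_mul_of_nonneg_left hmono hK0)
    rw [hpre]
    set X := x ^ (-(s + 1)) with hX
    have hX0 : 0 ≤ X := by positivity
    have p3 : x ^ 2 * x ^ (-s - 3) = X := by
      rw [← Real.rpow_natCast x 2, ← Real.rpow_add hx0, hX]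
      congr 1; push_cast; ring
    have p2 : x * x ^ (-s - 2) = X := by
      nth_rewrite 1 [← Real.rpow_one x]
      rw [← Real.rpow_add hx0, hX]
      congr 1; ring
    have p1 : x ^ (-s - 1) = X := by rw [hX]; congr 1; ring
    have p0 : x ^ (-s) = x * X := by
      nth_rewrite 2 [← Real.rpow_one x]
      rw [hX, ← Real.rpow_add hx0]
      congr 1; ring
    have i3 : ‖p * (p - 1) * (p - 2)‖ * ‖sincCorrection s x‖ * x ^ (-s - 3) ≤
        ‖p * (p - 1) * (p - 2)‖ * M * X := by
      have h := mul_le_mul_of_nonneg_left (mul_le_mul_of_nonneg_right b0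
        (Real.rpow_nonneg hx0.le (-s - 3))) (norm_nonneg (p * (p - 1) * (p - 2)))
      rw [mul_assoc]
      refine h.trans (le_of_eq ?_)
      rw [← p3]
      ring
    have i2 : ‖3 * p * (p - 1)‖ * ‖U₁ x‖ * x ^ (-s - 2) ≤ ‖3 * p * (p - 1)‖ * M * X := by
      have h := mul_le_mul_of_nonneg_left (mul_le_mul_of_nonneg_right b1
        (Real.rpow_nonneg hx0.le (-s - 2))) (norm_nonneg (3 * p * (p - 1)))
      rw [mul_assoc]
      refine h.trans (le_of_eq ?_)
      rw [← p2]
      ring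
    have i1 : ‖3 * p‖ * ‖U₂ x‖ * x ^ (-s - 1) ≤ ‖3 * p‖ * M * X := by
      rw [p1]
      exact mul_le_mul_of_nonneg_right (mul_le_mul_of_nonneg_left b2 (norm_nonneg _)) hX0
    have i0 : ‖U₃ x‖ * x ^ (-s) ≤ 3 * M * X := by
      rw [p0, ← mul_assoc]
      refine mul_le_mul_of_nonneg_right ?_ hX0
      calc ‖U₃ x‖ * x ≤ M * 3 := mul_le_mul b3 hx3 hx0.le hM
        _ = 3 * M := by ring
    rw [hK]
    linarith

/-- A complete residue system modulo `N` centred at the origin. -/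
noncomputable def centredWindow (N : ℕ) : Finset ℤ := Finset.Ico (-((N : ℤ) / 2)) (-((N : ℤ) / 2) + N)

/-- Scaled difference of the third differences of `cosSinPow` (restricted to a window) and of its
leading term. -/
noncomputable def windowedError (s : ℝ) (N : ℕ) (j : ℤ) : ℂ :=
  (((N : ℝ) ^ (2 - s) : ℝ) : ℂ) * ((if j ∈ centredWindow N then thirdDiff (cosSinPow s N) j else 0) -
    (((Real.pi / N) ^ (-s) : ℝ) : ℂ) * thirdDiff (signedPow s) j)

lemma windowedError_of_mem {s : ℝ} {N : ℕ} {j : ℤ} (hj : j ∈ centredWindow N) :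
    windowedError s N j =
      thirdDiff (fun k => (((N : ℝ) ^ (2 - s) : ℝ) : ℂ) * cosSinError s N k) j := by
  rw [windowedError, if_pos hj]
  simp only [thirdDiff, cosSinError]
  ring

lemma tendsto_windowedError (s : ℝ) (j : ℤ) :
    Filter.Tendsto (fun N : ℕ => windowedError s N j) Filter.atTop
      (nhds ((-(3 - s) / 6 : ℂ) * ((Real.pi ^ (2 - s) : ℝ) : ℂ) *
        thirdDiff (signedPow (s - 2)) j)) := by
  have h := fun k : ℤ => tendsto_scaled_cosSinError s k
  have hlim := (((h (j + 3)).sub ((h (j + 2)).const_mul 3)).add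
    ((h (j + 1)).const_mul 3)).sub (h j)
  have e : (-(3 - s) / 6 : ℂ) * ((Real.pi ^ (2 - s) : ℝ) : ℂ) * thirdDiff (signedPow (s - 2)) j =
      (-(3 - s) / 6 : ℂ) * ((Real.pi ^ (2 - s) : ℝ) : ℂ) * signedPow (s - 2) (j + 3) -
      3 * ((-(3 - s) / 6 : ℂ) * ((Real.pi ^ (2 - s) : ℝ) : ℂ) * signedPow (s - 2) (j + 2)) +
      3 * ((-(3 - s) / 6 : ℂ) * ((Real.pi ^ (2 - s) : ℝ) : ℂ) * signedPow (s - 2) (j + 1)) -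
      (-(3 - s) / 6 : ℂ) * ((Real.pi ^ (2 - s) : ℝ) : ℂ) * signedPow (s - 2) j := by
    rw [thirdDiff]; ring
  rw [e]
  refine hlim.congr' ?_
  filter_upwards [Filter.eventually_ge_atTop (2 * j.natAbs + 2)] with N hN
  rw [windowedError_of_mem (by rw [centredWindow, Finset.mem_Ico]; omega), thirdDiff]

lemma exists_norm_windowedError_le {s : ℝ} (hs : 0 < s) : ∃ K B : ℝ,
    ∀ᶠ N : ℕ in Filter.atTop, ∀ j : ℤ, ‖windowedError s N j‖ ≤ tailBound K (s + 1) B j := by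
  obtain ⟨K₁, hK₁, h₁⟩ := exists_norm_thirdDiff_cosSinError_le s hs
  set C := ‖(s : ℂ) * (s + 1) * (s + 2)‖ with hC
  set K₂ := 4 * Real.pi ^ (-s) * (C * 4 ^ (s + 3)) with hK₂
  have hpi := Real.pi_pos
  have hK₂0 : 0 ≤ K₂ := by positivity
  set K := K₁ * 4 ^ (s + 1) + K₂ with hK
  have hmid : ∀ j : ℤ, ∃ b : ℝ, ∀ᶠ N : ℕ in Filter.atTop, ‖windowedError s N j‖ ≤ b := by
    intro j
    have := (tendsto_windowedError s j).norm
    exact ⟨_, (this.eventually_lt_const (lt_add_one _)).mono fun N hN => hN.le⟩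
  choose b hb using hmid
  set B := ∑ j ∈ Finset.Icc (-3) (0 : ℤ), |b j| with hB
  refine ⟨K, B, ?_⟩
  have hmid' : ∀ᶠ N : ℕ in Filter.atTop, ∀ j ∈ Finset.Icc (-3) (0 : ℤ),
      ‖windowedError s N j‖ ≤ b j :=
    (Filter.eventually_all_finset (Finset.Icc (-3) (0 : ℤ))).mpr fun j _ => hb j
  filter_upwards [hmid', Filter.eventually_ge_atTop 12] with N hN hN12 j
  have hN0 : (0 : ℝ) < N := by exact_mod_cast (show 0 < N by omega)
  rw [tailBound]
  have hpow0 : 0 ≤ |(j : ℝ)| ^ (-(s + 1)) := Real.rpow_nonneg (abs_nonneg _) _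
  split_ifs with hj
  · have h1 : b j ≤ B := (le_abs_self _).trans
      (Finset.single_le_sum (f := fun j => |b j|) (fun i _ => abs_nonneg _) hj)
    have h2 : 0 ≤ K * |(j : ℝ)| ^ (-(s + 1)) := by positivity
    linarith [hN j hj]
  · rw [add_zero]
    by_cases hW : j ∈ centredWindow N
    · rw [windowedError_of_mem hW]
      rw [centredWindow, Finset.mem_Ico] at hW
      have := norm_thirdDiff_le_of_odd
        (F := fun k => (((N : ℝ) ^ (2 - s) : ℝ) : ℂ) * cosSinError s N k)
        (fun k => by simp only [cosSinError_neg, mul_neg]) (r := s + 1) (by linarith) hK₁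
        (P := fun k => 4 * (k + 3) ≤ 3 * N) (fun k hk hP => h₁ N (by omega) k hk hP) hj
        (fun _ => by omega) (fun _ => by omega)
      refine this.trans (mul_le_mul_of_nonneg_right ?_ hpow0)
      linarith
    · have hp := norm_thirdDiff_le_of_odd (signedPow_neg s) (r := s + 3) (C := C)
        (by linarith) (norm_nonneg _) (P := fun _ => True)
        (fun k hk _ => by
          have := norm_thirdDiff_signedPow_le (w := s) (by simp; linarith) hk
          rwa [Complex.ofReal_re] at this) hj (fun _ => trivial) (fun _ => trivial)
      have hNj : (N : ℝ) ≤ 2 * |(j : ℝ)| := by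
        have : (N : ℤ) ≤ 2 * |j| := by
          rw [centredWindow, Finset.mem_Ico] at hW
          rw [Int.abs_eq_natAbs]
          omega
        exact_mod_cast this
      have hj0 : 0 < |(j : ℝ)| := by linarith
      rw [windowedError, if_neg hW, zero_sub, mul_neg, norm_neg, ← mul_assoc, ← Complex.ofReal_mul,
        norm_mul, Complex.norm_real, Real.norm_eq_abs, abs_of_nonneg (by positivity)]
      have e1 : (N : ℝ) ^ (2 - s) * (Real.pi / N) ^ (-s) = Real.pi ^ (-s) * (N : ℝ) ^ 2 := by
        rw [Real.div_rpow hpi.le hN0.le, Real.rpow_neg hN0.le, div_inv_eq_mul,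
          show (2 : ℝ) - s = ((2 : ℕ) : ℝ) - s by norm_num, Real.rpow_sub hN0, Real.rpow_natCast]
        have : (N : ℝ) ^ s ≠ 0 := by positivity
        field_simp
      rw [e1]
      have e2 : |(j : ℝ)| ^ 2 * |(j : ℝ)| ^ (-(s + 3)) = |(j : ℝ)| ^ (-(s + 1)) := by
        rw [← Real.rpow_natCast |(j : ℝ)| 2, ← Real.rpow_add hj0]
        congr 1; push_cast; ring
      have hN2 : (N : ℝ) ^ 2 ≤ 4 * |(j : ℝ)| ^ 2 := by nlinarith
      calc Real.pi ^ (-s) * (N : ℝ) ^ 2 * ‖thirdDiff (signedPow s) j‖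
          ≤ Real.pi ^ (-s) * (4 * |(j : ℝ)| ^ 2) * (C * 4 ^ (s + 3) * |(j : ℝ)| ^ (-(s + 3))) :=
            mul_le_mul (mul_le_mul_of_nonneg_left hN2 (by positivity)) hp (norm_nonneg _)
              (by positivity)
        _ = K₂ * |(j : ℝ)| ^ (-(s + 1)) := by rw [← e2, hK₂]; ring
        _ ≤ K * |(j : ℝ)| ^ (-(s + 1)) := by
            refine mul_le_mul_of_nonneg_right ?_ hpow0
            have : 0 ≤ K₁ * 4 ^ (s + 1) := by positivity
            linarith

/-- Two-term asymptotics of the cyclic cosecant-type sums twisted by an odd character. -/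
lemma tendsto_scaled_sum_cosSinPow {q : ℕ} [NeZero q] {χ : DirichletCharacter ℂ q}
    (hodd : χ.Odd) {s : ℝ} (hs : 0 < s) :
    Filter.Tendsto (fun n : ℕ => ((((q * n : ℕ) : ℝ) ^ (2 - s) : ℝ) : ℂ) *
      (∑ j ∈ Finset.Ico 0 ((q * n : ℕ) : ℤ), χ (j : ZMod q) * cosSinPow s (q * n) j -
        (((Real.pi / (q * n : ℕ)) ^ (-s) : ℝ) : ℂ) * (2 * DirichletCharacter.LFunction χ s)))
      Filter.atTop (nhds ((-(3 - s) / 6 : ℂ) * ((Real.pi ^ (2 - s) : ℝ) : ℂ) *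
        (2 * DirichletCharacter.LFunction χ (s - 2)))) := by
  obtain ⟨A, hA⟩ := exists_third_difference_eq (fun x => χ x)
    (MulChar.sum_eq_zero_of_ne_one (DirichletCharacter.Odd.ne_one hodd))
  obtain ⟨M, hM⟩ : ∃ M, ∀ x, ‖A x‖ ≤ M := by
    obtain ⟨M, hM⟩ := (Set.finite_range fun x => ‖A x‖).bddAbove
    exact ⟨M, fun x => hM ⟨x, rfl⟩⟩
  obtain ⟨K, B, hKB⟩ := exists_norm_windowedError_le hs
  have hT : Filter.Tendsto (fun N : ℕ => ∑' j : ℤ, A ((j + 3 : ℤ) : ZMod q) * windowedError s N j)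
      Filter.atTop (nhds (∑' j : ℤ, A ((j + 3 : ℤ) : ZMod q) *
        ((-(3 - s) / 6 : ℂ) * ((Real.pi ^ (2 - s) : ℝ) : ℂ) *
          thirdDiff (signedPow (s - 2)) j))) := by
    refine tendsto_tsum_of_dominated_convergence (bound := fun j => M * tailBound K (s + 1) B j)
      ((summable_tailBound K (by linarith) B).mul_left M)
      (fun j => (tendsto_windowedError s j).const_mul _) ?_
    filter_upwards [hKB] with N hN j
    rw [norm_mul]
    exact mul_le_mul (hM _) (hN j) (norm_nonneg _) ((norm_nonneg _).trans (hM 0))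
  have hq : 0 < q := Nat.pos_of_ne_zero (NeZero.ne q)
  have hqn : Filter.Tendsto (fun n : ℕ => q * n) Filter.atTop Filter.atTop :=
    Filter.tendsto_id.const_mul_atTop' hq
  have hT' := (hT.comp hqn).neg
  have elim : -∑' j : ℤ, A ((j + 3 : ℤ) : ZMod q) *
        ((-(3 - s) / 6 : ℂ) * ((Real.pi ^ (2 - s) : ℝ) : ℂ) * thirdDiff (signedPow (s - 2)) j) =
      (-(3 - s) / 6 : ℂ) * ((Real.pi ^ (2 - s) : ℝ) : ℂ) *
        (2 * DirichletCharacter.LFunction χ (s - 2)) := by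
    rw [two_mul_LFunction_eq_tsum hodd hA (by simp; linarith), mul_neg, ← tsum_mul_left]
    congr 1
    exact tsum_congr fun j => by ring
  rw [elim] at hT'
  refine hT'.congr' ?_
  filter_upwards [Filter.eventually_gt_atTop 0] with n hn
  rw [Function.comp_apply]
  have hN : 0 < q * n := Nat.mul_pos hq hn
  have hparts := sum_Ico_thirdDiff_mul (N := ((q * n : ℕ) : ℤ)) (by positivity)
    (A := fun j : ℤ => A (j : ZMod q)) (F := cosSinPow s (q * n)) (fun j => by simp)
    (cosSinPow_add_period s hN) (-(((q * n : ℕ) : ℤ) / 2))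
  have hχA : ∀ j : ℤ, thirdDiff (fun j : ℤ => A (j : ZMod q)) j = χ (j : ZMod q) := by
    intro j
    rw [← hA, thirdDiff]
    push_cast
    rfl
  simp only [hχA] at hparts
  rw [hparts, two_mul_LFunction_eq_tsum hodd hA (by simp; linarith)]
  have hsum1 : Summable fun j : ℤ => A ((j + 3 : ℤ) : ZMod q) *
      (if j ∈ centredWindow (q * n) then thirdDiff (cosSinPow s (q * n)) j else 0) :=
    summable_of_ne_finset_zero (s := centredWindow (q * n)) fun j hj => by
      rw [if_neg hj, mul_zero]
  have hsum2 : Summable fun j : ℤ => A ((j + 3 : ℤ) : ZMod q) * thirdDiff (signedPow s) j := by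
    set R := ‖(s : ℂ)‖ + 1 with hR
    refine Summable.of_norm_bounded (g := fun j => M *
      tailBound (R * (R + 1) * (R + 2) * 4 ^ ((-1 : ℝ) + 3)) (-1 + 3) (8 * 3 ^ R) j)
      ((summable_tailBound _ (by norm_num) _).mul_left M) (fun j => ?_)
    rw [norm_mul]
    exact mul_le_mul (hM _) (norm_thirdDiff_signedPow_le_tailBound
      (by norm_num) (by simp; linarith) (by linarith) j) (norm_nonneg _)
      ((norm_nonneg _).trans (hM 0))
  have hfin : ∑ j ∈ Finset.Ico (-(((q * n : ℕ) : ℤ) / 2)) (-(((q * n : ℕ) : ℤ) / 2) + (q * n : ℕ)),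
      A ((j + 3 : ℤ) : ZMod q) * thirdDiff (cosSinPow s (q * n)) j =
      ∑' j : ℤ, A ((j + 3 : ℤ) : ZMod q) *
      (if j ∈ centredWindow (q * n) then thirdDiff (cosSinPow s (q * n)) j else 0) := by
    rw [tsum_eq_sum (s := centredWindow (q * n)) fun j hj => by rw [if_neg hj, mul_zero]]
    exact Finset.sum_congr rfl fun j hj => by rw [if_pos hj]
  rw [hfin]
  have hsplit : ∑' j : ℤ, A ((j + 3 : ℤ) : ZMod q) * windowedError s (q * n) j =
      ((((q * n : ℕ) : ℝ) ^ (2 - s) : ℝ) : ℂ) * (∑' j : ℤ, A ((j + 3 : ℤ) : ZMod q) *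
      (if j ∈ centredWindow (q * n) then thirdDiff (cosSinPow s (q * n)) j else 0) -
      (((Real.pi / (q * n : ℕ)) ^ (-s) : ℝ) : ℂ) *
        ∑' j : ℤ, A ((j + 3 : ℤ) : ZMod q) * thirdDiff (signedPow s) j) := by
    rw [← tsum_mul_left (a := (((Real.pi / (q * n : ℕ)) ^ (-s) : ℝ) : ℂ)),
      ← Summable.tsum_sub hsum1 (hsum2.mul_left _), ← tsum_mul_left]
    refine tsum_congr fun j => ?_
    rw [windowedError]
    ring
  rw [hsplit]
  ring

/-- The scalar in front of the trigonometric sum in `xiDiscrete`. -/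
noncomputable def xiConst (q : ℕ) (s : ℝ) : ℝ :=
  2 * (q : ℝ) ^ s * (Real.pi / q) ^ (s / 2) * Real.Gamma ((s + 1) / 2)

lemma xiConst_pos (q : ℕ) [NeZero q] {s : ℝ} (hs : 0 < s) : 0 < xiConst q s := by
  have hq : (0 : ℝ) < q := Nat.cast_pos.mpr (NeZero.pos q)
  have := Real.pi_pos
  have := Real.Gamma_pos_of_pos (s := (s + 1) / 2) (by linarith)
  unfold xiConst
  positivity

lemma xiDiscrete_eq {q : ℕ} [NeZero q] (χ : DirichletCharacter ℂ q) {n : ℕ} (hn : 0 < n) (s : ℝ) :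
    xiDiscrete χ n s = ((xiConst q s * ((q * n : ℕ) : ℝ) ^ (-s) : ℝ) : ℂ) *
      ∑ j ∈ Finset.Ico 0 ((q * n : ℕ) : ℤ), χ (j : ZMod q) * cosSinPow s (q * n) j := by
  have hq : (0 : ℝ) < q := Nat.cast_pos.mpr (NeZero.pos q)
  have hn' : (0 : ℝ) < n := Nat.cast_pos.mpr hn
  have hN : 0 < q * n := Nat.mul_pos (NeZero.pos q) hn
  have hN' : (0 : ℝ) < ((q * n : ℕ) : ℝ) := Nat.cast_pos.mpr hN
  have hsum : discreteLodd χ n (((s : ℂ) - 1) / 2) = (((2 : ℝ) ^ (1 - s) : ℝ) : ℂ) *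
      ∑ j ∈ Finset.Ico 0 ((q * n : ℕ) : ℤ), χ (j : ZMod q) * cosSinPow s (q * n) j := by
    have hIco : Finset.Ico (0 : ℤ) ((q * n : ℕ) : ℤ) =
        (Finset.Ico 0 (q * n)).map Nat.castEmbedding := by
      ext j
      simp only [Finset.mem_Ico, Finset.mem_map, Nat.castEmbedding_apply]
      constructor
      · rintro ⟨h0, h1⟩
        exact ⟨j.toNat, by omega, by simpa using h0⟩
      · rintro ⟨k, hk, rfl⟩
        exact ⟨by positivity, by exact_mod_cast hk.2⟩
    rw [hIco, Finset.sum_map, Finset.sum_eq_sum_Ico_succ_bot hN]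
    have h0 : cosSinPow s (q * n) ((Nat.castEmbedding 0 : ℤ)) = 0 := by
      simp [cosSinPow]
    rw [h0, mul_zero, zero_add, Finset.mul_sum, discreteLodd]
    refine Finset.sum_congr rfl fun j hj ↦ ?_
    rw [Finset.mem_Ico] at hj
    have hj0 : (0 : ℝ) < j := by exact_mod_cast hj.1
    have hj1 : (j : ℝ) < ((q * n : ℕ) : ℝ) := by exact_mod_cast hj.2
    have hsin : 0 < Real.sin (Real.pi * (j : ℝ) / ((q * n : ℕ) : ℝ)) := by
      apply Real.sin_pos_of_pos_of_lt_pi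
      · have := Real.pi_pos
        positivity
      · rw [div_lt_iff₀ hN']
        exact mul_lt_mul_of_pos_left hj1 Real.pi_pos
    have hc := cosSinPow_of_pos s (N := q * n) (j := (j : ℤ)) (by simpa using hsin)
    rw [Nat.castEmbedding_apply, hc]
    have hx : Real.pi * (j : ℝ) / ((q : ℝ) * (n : ℝ)) = Real.pi * (j : ℝ) / ((q * n : ℕ) : ℝ) := by
      push_cast; rfl
    simp only [Int.cast_natCast]
    rw [hx]
    set S := Real.sin (Real.pi * (j : ℝ) / ((q * n : ℕ) : ℝ)) with hS
    set C := Real.cos (Real.pi * (j : ℝ) / ((q * n : ℕ) : ℝ)) with hC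
    rw [Real.cot_eq_cos_div_sin, ← hS, ← hC]
    have hexp : (-(((s : ℂ) - 1) / 2)) = (((1 - s) / 2 : ℝ) : ℂ) := by push_cast; ring
    rw [hexp, ← Complex.ofReal_cpow (by positivity)]
    have hpow : (4 * S ^ 2) ^ ((1 - s) / 2) = 2 ^ (1 - s) * (S * S ^ (-s)) := by
      rw [show 4 * S ^ 2 = (2 * S) ^ (2 : ℝ) by rw [Real.rpow_two]; ring,
        ← Real.rpow_mul (by positivity), mul_div_cancel₀ _ two_ne_zero,
        Real.mul_rpow zero_le_two hsin.le, sub_eq_add_neg, Real.rpow_add hsin, Real.rpow_one]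
    rw [hpow]
    have hS0 : (S : ℂ) ≠ 0 := by exact_mod_cast hsin.ne'
    push_cast
    field_simp
  rw [xiDiscrete, hsum, ← mul_assoc]
  congr 1
  have e1 : ((2 : ℂ) ^ (s : ℂ)) = (((2 : ℝ) ^ s : ℝ) : ℂ) := by
    rw [Complex.ofReal_cpow zero_le_two]; norm_num
  have e2 : ((n : ℂ) ^ (-(s : ℂ))) = (((n : ℝ) ^ (-s) : ℝ) : ℂ) := by
    rw [Complex.ofReal_cpow hn'.le]; norm_num
  have e3 : (((Real.pi / q : ℝ) : ℂ) ^ ((s : ℂ) / 2)) = (((Real.pi / q) ^ (s / 2) : ℝ) : ℂ) := by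
    rw [Complex.ofReal_cpow (by positivity)]; norm_num
  have e4 : Complex.Gamma (((s : ℂ) + 1) / 2) = (Real.Gamma ((s + 1) / 2) : ℂ) := by
    rw [← Complex.Gamma_ofReal]; norm_num
  rw [e1, e2, e3, e4]
  norm_cast
  have h2 : (2 : ℝ) ^ s * 2 ^ (1 - s) = 2 := by
    rw [← Real.rpow_add two_pos]; norm_num
  have h3 : (q : ℝ) ^ s * ((q * n : ℕ) : ℝ) ^ (-s) = (n : ℝ) ^ (-s) := by
    rw [Nat.cast_mul, Real.mul_rpow hq.le hn'.le, ← mul_assoc, ← Real.rpow_add hq]; simp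
  rw [xiConst]
  linear_combination ((n : ℝ) ^ (-s) * (Real.pi / q) ^ (s / 2) * Real.Gamma ((s + 1) / 2)) * h2 -
    (2 * (Real.pi / q) ^ (s / 2) * Real.Gamma ((s + 1) / 2)) * h3

lemma tendsto_sq_mul_xiDiscrete_sub {q : ℕ} [NeZero q] {χ : DirichletCharacter ℂ q} (hodd : χ.Odd)
    {s : ℝ} (hs : 0 < s) :
    Filter.Tendsto (fun n : ℕ ↦ (((q * n : ℕ) : ℝ) ^ 2 : ℂ) *
      (xiDiscrete χ n s - ((2 * xiConst q s * Real.pi ^ (-s) : ℝ) : ℂ) *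
        DirichletCharacter.LFunction χ s)) Filter.atTop
      (nhds (((-(3 - s) / 3 * xiConst q s * Real.pi ^ (2 - s) : ℝ) : ℂ) *
        DirichletCharacter.LFunction χ (s - 2))) := by
  have h := (tendsto_scaled_sum_cosSinPow hodd hs).const_mul (xiConst q s : ℂ)
  convert h.congr' ?_ using 2
  · push_cast; ring
  filter_upwards [Filter.eventually_gt_atTop 0] with n hn
  have hN' : (0 : ℝ) < ((q * n : ℕ) : ℝ) := Nat.cast_pos.mpr (Nat.mul_pos (NeZero.pos q) hn)
  rw [xiDiscrete_eq χ hn]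
  set N : ℝ := ((q * n : ℕ) : ℝ)
  have e1 : N ^ (2 - s) = N ^ 2 * N ^ (-s) := by
    rw [sub_eq_add_neg, Real.rpow_add hN', Real.rpow_two]
  have e2 : N ^ (-s) * (Real.pi / N) ^ (-s) = Real.pi ^ (-s) := by
    rw [← Real.mul_rpow hN'.le (by positivity), mul_div_cancel₀ _ hN'.ne']
  rw [e1, ← e2]
  push_cast
  ring

lemma tendsto_xiDiscrete {q : ℕ} [NeZero q] {χ : DirichletCharacter ℂ q} (hodd : χ.Odd)
    {s : ℝ} (hs : 0 < s) :
    Filter.Tendsto (fun n : ℕ ↦ xiDiscrete χ n s) Filter.atTop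
      (nhds (((2 * xiConst q s * Real.pi ^ (-s) : ℝ) : ℂ) * DirichletCharacter.LFunction χ s)) := by
  have hN : Filter.Tendsto (fun n : ℕ ↦ ((((q * n : ℕ) : ℝ) ^ 2)⁻¹ : ℂ)) Filter.atTop (nhds 0) := by
    have h : Filter.Tendsto (fun n : ℕ ↦ (((q * n : ℕ) : ℝ) ^ 2)⁻¹) Filter.atTop (nhds 0) := by
      refine tendsto_inv_atTop_zero.comp ((Filter.tendsto_pow_atTop two_ne_zero).comp
        (tendsto_natCast_atTop_atTop.comp ?_))
      exact Filter.Tendsto.const_mul_atTop' (NeZero.pos q) Filter.tendsto_id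
    convert (Complex.continuous_ofReal.tendsto 0).comp h using 2 <;> simp
  have h := (hN.mul (tendsto_sq_mul_xiDiscrete_sub hodd hs)).add_const
    (((2 * xiConst q s * Real.pi ^ (-s) : ℝ) : ℂ) * DirichletCharacter.LFunction χ s)
  rw [zero_mul, zero_add] at h
  refine h.congr' ?_
  filter_upwards [Filter.eventually_gt_atTop 0] with n hn
  have hN' : (((q * n : ℕ) : ℝ) ^ 2 : ℂ) ≠ 0 := by
    have := (Nat.mul_pos (NeZero.pos q) hn).ne'
    exact pow_ne_zero _ (by exact_mod_cast this)
  rw [inv_mul_cancel_left₀ hN']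
  ring

lemma isQuadratic_of_im_eq_zero {q : ℕ} [NeZero q] {χ : DirichletCharacter ℂ q}
    (hreal : ∀ x : ZMod q, (χ x).im = 0) : χ.IsQuadratic := by
  intro a
  by_cases ha : IsUnit a
  · obtain ⟨u, rfl⟩ := ha
    have h1 := DirichletCharacter.unit_norm_eq_one χ u
    have h2 : χ u = (((χ u).re : ℝ) : ℂ) := Complex.ext rfl (by simpa using hreal u)
    rw [h2, Complex.norm_real, Real.norm_eq_abs] at h1
    rw [h2]
    rcases eq_or_eq_neg_of_abs_eq h1 with h | h <;> rw [h] <;> simp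
  · exact Or.inl (χ.map_nonunit ha)

lemma Gamma_mul_LFunction_one_sub {q : ℕ} [NeZero q] {χ : DirichletCharacter ℂ q}
    (hprim : χ.IsPrimitive) (hquad : χ.IsQuadratic) (hodd : χ.Odd) (hq : q ≠ 1) {x : ℝ}
    (h₁ : Real.Gamma ((x + 1) / 2) ≠ 0) (h₂ : Real.Gamma ((2 - x) / 2) ≠ 0) :
    (Real.Gamma ((2 - x) / 2) : ℂ) * DirichletCharacter.LFunction χ (1 - x) =
      (((q / Real.pi) ^ (x - 1 / 2) * Real.Gamma ((x + 1) / 2) : ℝ) : ℂ) *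
        DirichletCharacter.LFunction χ x := by
  have hq0 : (0 : ℝ) < q := Nat.cast_pos.mpr (NeZero.pos q)
  have hπ := Real.pi_pos
  have key : ∀ y : ℝ, Real.Gamma ((y + 1) / 2) ≠ 0 →
      DirichletCharacter.completedLFunction χ y =
        ((Real.pi ^ (-(y + 1) / 2) * Real.Gamma ((y + 1) / 2) : ℝ) : ℂ) *
          DirichletCharacter.LFunction χ y := by
    intro y hy
    have hG : χ.gammaFactor y =
        ((Real.pi ^ (-(y + 1) / 2) * Real.Gamma ((y + 1) / 2) : ℝ) : ℂ) := by
      rw [DirichletCharacter.Odd.gammaFactor_def hodd, Complex.Gammaℝ_def, Complex.ofReal_mul,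
        Complex.ofReal_cpow hπ.le, ← Complex.Gamma_ofReal]
      push_cast
      rfl
    have hG0 : χ.gammaFactor y ≠ 0 := by
      rw [hG, Complex.ofReal_ne_zero]
      exact mul_ne_zero (Real.rpow_pos_of_pos hπ _).ne' hy
    rw [DirichletCharacter.LFunction_eq_completed_div_gammaFactor χ y (Or.inr hq), ← hG,
      mul_div_cancel₀ _ hG0]
  have hFE := hprim.completedLFunction_one_sub (x : ℂ)
  rw [rootNumber_eq_one_of_isQuadratic hprim hquad hodd, hquad.inv, mul_one, key x h₁] at hFE
  have k2 := key (1 - x) (by rwa [show (1 - x + 1) / 2 = (2 - x) / 2 by ring])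
  rw [Complex.ofReal_sub, Complex.ofReal_one, hFE] at k2
  have hqc : ((q : ℂ) ^ ((x : ℂ) - 1 / 2)) = (((q : ℝ) ^ (x - 1 / 2) : ℝ) : ℂ) := by
    rw [Complex.ofReal_cpow hq0.le]; push_cast; rfl
  rw [hqc, show (1 - x + 1) / 2 = (2 - x) / 2 by ring, show -(1 - x + 1) / 2 = (x - 2) / 2 by ring]
    at k2
  have e : (q / Real.pi) ^ (x - 1 / 2) * Real.pi ^ ((x - 2) / 2) =
      (q : ℝ) ^ (x - 1 / 2) * Real.pi ^ (-(x + 1) / 2) := by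
    rw [Real.div_rpow hq0.le hπ.le, div_mul_eq_mul_div, div_eq_iff (by positivity), mul_assoc,
      ← Real.rpow_add hπ]
    ring_nf
  have hP : ((Real.pi ^ ((x - 2) / 2) : ℝ) : ℂ) ≠ 0 := by
    exact_mod_cast (Real.rpow_pos_of_pos hπ _).ne'
  apply mul_left_cancel₀ hP
  have e' := congrArg (fun r : ℝ ↦ (r : ℂ)) e
  simp only [Complex.ofReal_mul] at e' k2 ⊢
  linear_combination -k2 - (Real.Gamma ((x + 1) / 2) : ℂ) * DirichletCharacter.LFunction χ x * e'

lemma xiDiscrete_limit_symm {q : ℕ} [NeZero q] {χ : DirichletCharacter ℂ q}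
    (hprim : χ.IsPrimitive) (hquad : χ.IsQuadratic) (hodd : χ.Odd) (hq : q ≠ 1) {s : ℝ}
    (hs0 : 0 < s) (hs1 : s < 1) :
    ((2 * xiConst q (1 - s) * Real.pi ^ (-(1 - s)) : ℝ) : ℂ) *
        DirichletCharacter.LFunction χ (1 - s) =
      ((2 * xiConst q s * Real.pi ^ (-s) : ℝ) : ℂ) * DirichletCharacter.LFunction χ s := by
  have hq0 : (0 : ℝ) < q := Nat.cast_pos.mpr (NeZero.pos q)
  have hπ := Real.pi_pos
  have h := Gamma_mul_LFunction_one_sub hprim hquad hodd hq (x := s)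
    (Real.Gamma_pos_of_pos (by linarith)).ne' (Real.Gamma_pos_of_pos (by linarith)).ne'
  have e : (q : ℝ) ^ (1 - s) * (Real.pi / q) ^ ((1 - s) / 2) * Real.pi ^ (-(1 - s)) *
      (q / Real.pi) ^ (s - 1 / 2) = (q : ℝ) ^ s * (Real.pi / q) ^ (s / 2) * Real.pi ^ (-s) := by
    have hq1 : (0 : ℝ) < q / Real.pi := by positivity
    have hq2 : (0 : ℝ) < Real.pi / q := by positivity
    simp only [Real.rpow_def_of_pos hq0, Real.rpow_def_of_pos hπ, Real.rpow_def_of_pos hq1,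
      Real.rpow_def_of_pos hq2, Real.log_div hq0.ne' hπ.ne', Real.log_div hπ.ne' hq0.ne',
      ← Real.exp_add]
    ring_nf
  have he := congrArg (fun r : ℝ ↦ (r : ℂ)) e
  rw [xiConst, xiConst, show (1 - s + 1) / 2 = (2 - s) / 2 by ring]
  simp only [Complex.ofReal_mul, Complex.ofReal_ofNat] at he h ⊢
  linear_combination 4 * ((((q : ℝ) ^ (1 - s) : ℝ) : ℂ) *
    (((Real.pi / q) ^ ((1 - s) / 2) : ℝ) : ℂ) * ((Real.pi ^ (-(1 - s)) : ℝ) : ℂ)) * h +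
    4 * (Real.Gamma ((s + 1) / 2) : ℂ) * DirichletCharacter.LFunction χ s * he

/-- At a zero in the critical strip, the next order term of `xiDiscrete`, expressed at `3 - s`
through the functional equation. -/
lemma tendsto_sq_mul_xiDiscrete_of_zero {q : ℕ} [NeZero q] {χ : DirichletCharacter ℂ q}
    (hprim : χ.IsPrimitive) (hquad : χ.IsQuadratic) (hodd : χ.Odd) (hq : q ≠ 1) {s : ℝ}
    (hs0 : 0 < s) (hs1 : s < 1) (hL : DirichletCharacter.LFunction χ s = 0) {u : ℝ}
    (hu : u = 3 - s) :
    Filter.Tendsto (fun n : ℕ ↦ (((q * n : ℕ) : ℝ) ^ 2 : ℂ) * xiDiscrete χ n s) Filter.atTop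
      (nhds ((((q : ℝ) ^ 2 / 3 * (u * (u - 2) * (q / Real.pi) ^ ((u - 2) / 2) *
        Real.Gamma ((u + 1) / 2) * (DirichletCharacter.LFunction χ u).re) : ℝ) : ℂ))) := by
  have hq0 : (0 : ℝ) < q := Nat.cast_pos.mpr (NeZero.pos q)
  have hπ := Real.pi_pos
  have h := tendsto_sq_mul_xiDiscrete_sub hodd hs0
  simp only [hL, mul_zero, sub_zero] at h
  convert h using 2
  obtain ⟨r, -, hr⟩ := exists_tendsto_prod_primesBelow hquad
  have hLu := (hr u (by linarith)).1
  have hG : Real.Gamma ((s + 1) / 2) = (s - 1) / 2 * Real.Gamma ((s - 1) / 2) := by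
    rw [← Real.Gamma_add_one (by linarith)]
    ring_nf
  have hGs : Real.Gamma ((s - 1) / 2) ≠ 0 := by
    intro h0
    rw [h0, mul_zero] at hG
    exact (Real.Gamma_pos_of_pos (by linarith : 0 < (s + 1) / 2)).ne' hG
  have hF := Gamma_mul_LFunction_one_sub hprim hquad hodd hq (x := u)
    (Real.Gamma_pos_of_pos (by linarith)).ne'
    (by rwa [show (2 - u) / 2 = (s - 1) / 2 by rw [hu]; ring])
  rw [show (2 - u) / 2 = (s - 1) / 2 by rw [hu]; ring,
    show (1 : ℂ) - (u : ℂ) = (s : ℂ) - 2 by rw [hu]; push_cast; ring] at hF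
  have e : (q : ℝ) ^ s * (Real.pi / q) ^ (s / 2) * Real.pi ^ (2 - s) * (q / Real.pi) ^ (u - 1 / 2) =
      (q : ℝ) ^ 2 * (q / Real.pi) ^ ((u - 2) / 2) := by
    have hq1 : (0 : ℝ) < q / Real.pi := by positivity
    have hq2 : (0 : ℝ) < Real.pi / q := by positivity
    rw [← Real.rpow_two, hu]
    simp only [Real.rpow_def_of_pos hq0, Real.rpow_def_of_pos hπ, Real.rpow_def_of_pos hq1,
      Real.rpow_def_of_pos hq2, Real.log_div hq0.ne' hπ.ne', Real.log_div hπ.ne' hq0.ne',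
      ← Real.exp_add]
    ring_nf
  have e' := congrArg (fun r : ℝ ↦ (r : ℂ)) e
  rw [xiConst, hG]
  simp only [Complex.ofReal_mul] at e' hF ⊢
  rw [← hLu]
  have hsu : (s : ℂ) = 3 - u := by rw [hu]; push_cast; ring
  push_cast at e' hF ⊢
  generalize DirichletCharacter.LFunction χ ((s : ℂ) - 2) = X at hF ⊢
  rw [hsu]
  linear_combination -((u : ℂ) * (u - 2) / 3 * Real.Gamma ((u + 1) / 2) *
    DirichletCharacter.LFunction χ u) * e' - ((u : ℂ) * (u - 2) / 3 * (((q : ℝ) ^ s : ℝ) : ℂ) *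
    (((Real.pi / q) ^ (s / 2) : ℝ) : ℂ) * ((Real.pi ^ (2 - s) : ℝ) : ℂ)) * hF

theorem real_zeros_for_odd_real_characters {q : ℕ} [NeZero q] (hq : 1 < q)
    (χ : DirichletCharacter ℂ q) (hχ : χ (-1) = -1) (hprim : χ.IsPrimitive)
    (hreal : ∀ x : ZMod q, (χ x).im = 0)
    (s : ℝ) (hs0 : 0 < s) (hs1 : s < 1) (hs : s ≠ 1 / 2) :
    DirichletCharacter.LFunction χ (s : ℂ) ≠ 0 ↔
      Filter.Tendsto
        (fun n : ℕ => xiDiscrete χ n (s : ℂ) / xiDiscrete χ n ((1 - s : ℝ) : ℂ))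
        Filter.atTop (nhds 1) := by
  have hodd : χ.Odd := hχ
  have hquad : χ.IsQuadratic := isQuadratic_of_im_eq_zero hreal
  have hq3 : 3 ≤ q := by
    have h2 : q ≠ 2 := by
      rintro rfl
      exact not_isPrimitive_two χ hprim
    omega
  have hsymm := xiDiscrete_limit_symm hprim hquad hodd hq.ne' hs0 hs1
  have hlim := tendsto_xiDiscrete hodd hs0
  have hlim' := tendsto_xiDiscrete hodd (s := 1 - s) (by linarith)
  have hconst : ∀ t : ℝ, 0 < t → ((2 * xiConst q t * Real.pi ^ (-t) : ℝ) : ℂ) ≠ 0 := by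
    intro t ht
    have := xiConst_pos q ht
    have := Real.pi_pos
    exact Complex.ofReal_ne_zero.mpr (by positivity)
  have hcast : (((1 - s : ℝ) : ℂ)) = 1 - (s : ℂ) := by push_cast; rfl
  constructor
  · intro hL
    have hne := mul_ne_zero (hconst s hs0) hL
    rw [hcast, hsymm] at hlim'
    have h := hlim.div hlim' hne
    rw [div_self hne] at h
    rw [hcast]
    exact h
  · intro hT hL
    have hL' : DirichletCharacter.LFunction χ ((1 - s : ℝ) : ℂ) = 0 := by
      rw [hL, mul_zero] at hsymm
      rw [hcast]
      exact (mul_eq_zero.mp hsymm).resolve_left (hconst (1 - s) (by linarith))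
    have h₁ := tendsto_sq_mul_xiDiscrete_of_zero hprim hquad hodd hq.ne' hs0 hs1 hL rfl
    have h₂ := tendsto_sq_mul_xiDiscrete_of_zero hprim hquad hodd hq.ne' (s := 1 - s)
      (by linarith) (by linarith) hL' (u := 2 + s) (by ring)
    have hq0 : (0 : ℝ) < (q : ℝ) ^ 2 / 3 := by
      have : (0 : ℝ) < q := Nat.cast_pos.mpr (NeZero.pos q)
      positivity
    set Z : ℝ → ℝ := fun u ↦ u * (u - 2) * (q / Real.pi) ^ ((u - 2) / 2) *
      Real.Gamma ((u + 1) / 2) * (DirichletCharacter.LFunction χ u).re with hZ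
    have hZpos : 0 < Z (2 + s) := by
      have hq' : (0 : ℝ) < q := Nat.cast_pos.mpr (NeZero.pos q)
      have := Real.pi_pos
      have h1 := LFunction_re_pos hquad (u := 2 + s) (by linarith)
      have h2 := Real.Gamma_pos_of_pos (s := (2 + s + 1) / 2) (by linarith)
      have h3 : 0 < 2 + s - 2 := by linarith
      simp only [hZ]
      positivity
    have hZne : Z (3 - s) ≠ Z (2 + s) := by
      rcases lt_or_gt_of_ne hs with h | h
      · exact (secondary_term_lt hq3 hquad (by linarith) (by linarith)).ne'
      · exact (secondary_term_lt hq3 hquad (by linarith) (by linarith)).ne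
    have hne : (((q : ℝ) ^ 2 / 3 * Z (2 + s) : ℝ) : ℂ) ≠ 0 :=
      Complex.ofReal_ne_zero.mpr (mul_pos hq0 hZpos).ne'
    have hT' : Filter.Tendsto
        (fun n : ℕ => xiDiscrete χ n (s : ℂ) / xiDiscrete χ n ((1 - s : ℝ) : ℂ)) Filter.atTop
        (nhds ((((q : ℝ) ^ 2 / 3 * Z (3 - s) : ℝ) : ℂ) /
          (((q : ℝ) ^ 2 / 3 * Z (2 + s) : ℝ) : ℂ))) := by
      refine (h₁.div h₂ hne).congr' ?_
      filter_upwards [Filter.eventually_gt_atTop 0] with n hn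
      have hN : (((q * n : ℕ) : ℝ) ^ 2 : ℂ) ≠ 0 := by
        have := (Nat.mul_pos (NeZero.pos q) hn).ne'
        exact pow_ne_zero _ (by exact_mod_cast this)
      exact mul_div_mul_left _ _ hN
    have h := tendsto_nhds_unique hT hT'
    rw [eq_comm, div_eq_one_iff_eq hne, Complex.ofReal_inj] at h
    exact hZne (mul_left_cancel₀ hq0.ne' h)
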